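/- There exist absolute constants C₁, C₂ > 0 such that the following holds. Let H₀, H, N be real/integer parameters with 1 ≤ H₀ ≤ H and log H₀ ≥ (log H)^{2/3} (log log H)², and let 𝐏 be a set of primes contained in [H₀, H] with 𝓛 = ∑_{p∈𝐏} 1/p ≥ e and log H ≤ √((log N)/𝓛). Then for every real K with 1 ≤ K ≤ (log N)/(𝓛 (log H)²) there exists a subset 𝒳 ⊆ 𝐍 with |𝐍 ∖ 𝒳| ≤ C₁ (N e^{−K 𝓛 log K} + N/√H₀), such that every eigenvalue of the restricted operator A|_𝒳 has absolute value at most C₂ √(K 𝓛). -/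

import Mathlib

/-- The operator `A` from the paper: for `f : ℤ → ℂ` (thought of as a function on
`𝐍 = {N+1, …, 2N}`), `(A f)(n) = ∑_{σ=±1} ∑_{p ∈ 𝐏, p ∣ n, n+σp ∈ 𝐍} f(n+σp)
− ∑_{σ=±1} ∑_{p ∈ 𝐏, n+σp ∈ 𝐍} f(n+σp)/p`. -/
noncomputable def opA (N : ℕ) (P : Finset ℕ) (f : ℤ → ℂ) (n : ℤ) : ℂ :=
  (∑ σ ∈ ({-1, 1} : Finset ℤ), ∑ p ∈ P,
      if (p : ℤ) ∣ n ∧ n + σ * (p : ℤ) ∈ Finset.Ioc (N : ℤ) (2 * (N : ℤ))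
      then f (n + σ * (p : ℤ)) else 0)
  - (∑ σ ∈ ({-1, 1} : Finset ℤ), ∑ p ∈ P,
      if n + σ * (p : ℤ) ∈ Finset.Ioc (N : ℤ) (2 * (N : ℤ))
      then f (n + σ * (p : ℤ)) / (p : ℂ) else 0)

/-- The restriction `A|_X : f ↦ (A(f·1_X))·1_X`. -/
noncomputable def opARestrict (N : ℕ) (P : Finset ℕ) (X : Finset ℤ) (f : ℤ → ℂ) (n : ℤ) : ℂ :=
  if n ∈ X then opA N P (fun m => if m ∈ X then f m else 0) n else 0

section PartZero
open scoped Classical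

/-- lists of length `k` over `A` -/
noncomputable def words {α : Type*} (A : Finset α) : ℕ → Finset (List α)
  | 0 => {[]}
  | k + 1 => (A ×ˢ words A k).image (fun p => p.1 :: p.2)

theorem sum_words_zero {α : Type*} (A : Finset α) (f : List α → ℝ) :
    ∑ w ∈ words A 0, f w = f [] := by simp [words]

theorem sum_words_succ {α : Type*} (A : Finset α) (k : ℕ) (f : List α → ℝ) :
    ∑ w ∈ words A (k + 1), f w = ∑ a ∈ A, ∑ w ∈ words A k, f (a :: w) := by
  rw [words, Finset.sum_image, Finset.sum_product]
  rintro ⟨a, b⟩ _ ⟨c, d⟩ _ h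
  simp at h; simp [h]

theorem mem_words {α : Type*} (A : Finset α) (k : ℕ) (w : List α) :
    w ∈ words A k ↔ w.length = k ∧ ∀ a ∈ w, a ∈ A := by
  induction k generalizing w with
  | zero => 
    simp only [words, Finset.mem_singleton, List.length_eq_zero_iff]
    constructor
    · rintro rfl; simp
    · exact fun h => h.1
  | succ k ih =>
    simp only [words, Finset.mem_image, Finset.mem_product, Prod.exists]
    constructor
    · rintro ⟨a, b, ⟨ha, hb⟩, rfl⟩
      rw [ih] at hb
      simp only [List.length_cons, hb.1, List.mem_cons, true_and]
      rintro x (rfl | hx)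
      · exact ha
      · exact hb.2 x hx
    · rintro ⟨h1, h2⟩
      cases w with
      | nil => simp at h1
      | cons a b =>
        refine ⟨a, b, ⟨h2 a (by simp), ?_⟩, rfl⟩
        rw [ih]
        exact ⟨by simpa using h1, fun x hx => h2 x (by simp [hx])⟩

/-- non-backtracking with previous step `e` -/
def nb : ℤ → List ℤ → Prop
  | _, [] => True
  | e, d :: w => d ≠ -e ∧ nb d w

def lastS : ℤ → List ℤ → ℤ
  | e, [] => e
  | _, d :: w => lastS d w

/-- product of edge weights along a path -/
noncomputable def Hw (x : ℤ → ℤ → ℝ) : ℤ → List ℤ → ℝ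
  | _, [] => 1
  | n, d :: w => x n d * Hw x (n + d) w

theorem Hw_neg (x : ℤ → ℤ → ℝ) (n : ℤ) (w : List ℤ) :
    Hw (fun n d => - x n d) n w = (-1) ^ w.length * Hw x n w := by
  induction w generalizing n with
  | nil => simp [Hw]
  | cons d w ih => simp only [Hw, ih, List.length_cons, pow_succ]; ring

/-- the pair sum -/
noncomputable def Qs (x : ℤ → ℤ → ℝ) (D : Finset ℤ) (k : ℕ) (n : ℤ) : ℝ :=
  ∑ d' ∈ D, ∑ w ∈ words D k, ∑ w' ∈ words D k,
    if (nb 0 w ∧ d' ≠ - lastS 0 w) ∧ (nb 0 w' ∧ d' ≠ - lastS 0 w') ∧ w.sum = w'.sum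
    then Hw x n w * Hw x n w' else 0

theorem Qs_neg (x : ℤ → ℤ → ℝ) (D : Finset ℤ) (k : ℕ) (n : ℤ) :
    Qs (fun n d => - x n d) D k n = Qs x D k n := by
  unfold Qs
  refine Finset.sum_congr rfl fun d' _ => Finset.sum_congr rfl fun w hw =>
    Finset.sum_congr rfl fun w' hw' => ?_
  rw [mem_words] at hw hw'
  rw [Hw_neg, Hw_neg, hw.1, hw'.1]
  split_ifs
  · have : ((-1:ℝ)^k) * (-1)^k = 1 := by rw [← mul_pow]; simp
    linear_combination (Hw x n w * Hw x n w') * this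
  · rfl

/-- iteration of the edge identity -/
theorem iter_id (x φ : ℤ → ℤ → ℝ) (D : Finset ℤ) (t : ℝ)
    (hφ : ∀ n, ∀ d ∈ D, φ n d = t * x n d * ∑ d' ∈ D, if d' ≠ -d then φ (n + d) d' else 0)
    (k : ℕ) (n e : ℤ) :
    (∑ d ∈ D, if d ≠ -e then φ n d else 0) =
      t ^ k * ∑ w ∈ words D k, if nb e w then
        Hw x n w * ∑ d' ∈ D, (if d' ≠ - lastS e w then φ (n + w.sum) d' else 0) else 0 := by
  induction k generalizing n e with
  | zero => rw [sum_words_zero]; simp [nb, Hw, lastS]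
  | succ k ih =>
    rw [sum_words_succ, Finset.mul_sum]
    refine Finset.sum_congr rfl fun d hd => ?_
    by_cases h : d = -e
    · simp [h, nb]
    · simp only [ne_eq, h, not_false_eq_true, if_true, nb, true_and, lastS, Hw, List.sum_cons]
      rw [hφ n d hd, ih (n + d) d, Finset.mul_sum, Finset.mul_sum, Finset.mul_sum]
      refine Finset.sum_congr rfl fun w _ => ?_
      split_ifs
      · rw [pow_succ, add_assoc]; ring_nf
      · simp
end PartZero

section PartOne
open scoped Classical

theorem Hw_mem (x : ℤ → ℤ → ℝ) (D S : Finset ℤ)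
    (hS : ∀ n ∈ S, ∀ d ∈ D, x n d ≠ 0 → n + d ∈ S) (w : List ℤ) (hw : ∀ d ∈ w, d ∈ D)
    (n : ℤ) (hn : n ∈ S) (h : Hw x n w ≠ 0) : n + w.sum ∈ S := by
  induction w generalizing n with
  | nil => simpa using hn
  | cons d w ih =>
    simp only [Hw, ne_eq, mul_eq_zero, not_or] at h
    have := ih (fun e he => hw e (by simp [he])) (n + d) (hS n hn d (hw d (by simp)) h.1) h.2
    simpa [List.sum_cons, add_assoc] using this

theorem phi_sq_bound (a b s : ℝ) (hs : |s| ≤ 1/2) :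
    ((s * b - s^2 * a) / (1 - s^2))^2 ≤ 2 * (a^2 + b^2) := by
  have h1 : s^2 ≤ 1/4 := by
    have := sq_le_sq' (by linarith [abs_nonneg s] : -(1/2) ≤ |s|) hs
    rw [sq_abs] at this; linarith
  have h2 : 0 < 1 - s^2 := by linarith
  rw [div_pow, div_le_iff₀ (by positivity)]
  have h3 : (s * b - s^2 * a)^2 ≤ 2 * (s^2 * b^2 + s^2 * s^2 * a^2) := by
    nlinarith [sq_nonneg (s * b + s^2 * a)]
  have h4 : (9/16:ℝ) ≤ (1 - s^2)^2 := by nlinarith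
  have h5 : s^2 * b^2 ≤ 1/4 * b^2 := by nlinarith [sq_nonneg b]
  have h6 : s^2 * s^2 * a^2 ≤ 1/4 * a^2 := by
    have : s^2 * s^2 ≤ 1/4 := by nlinarith [sq_nonneg s]
    nlinarith [sq_nonneg a]
  nlinarith [sq_nonneg a, sq_nonneg b]

theorem null_bound (x : ℤ → ℤ → ℝ) (D S : Finset ℤ) (k : ℕ) (t : ℝ) (v : ℤ → ℝ)
    (hD : ∀ d ∈ D, -d ∈ D) (hD0 : (0:ℤ) ∉ D)
    (hx1 : ∀ n d, |x n d| ≤ 1) (hsym : ∀ n, ∀ d ∈ D, x (n + d) (-d) = x n d)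
    (hS : ∀ n ∈ S, ∀ d ∈ D, x n d ≠ 0 → n + d ∈ S)
    (ht0 : 0 < t) (ht : t ≤ 1/2) (hv : ∀ n, n ∉ S → v n = 0)
    (hM : ∀ n ∈ S, v n + (∑ d ∈ D, (t * x n d)^2 / (1 - (t * x n d)^2)) * v n
      - ∑ d ∈ D, (t * x n d) / (1 - (t * x n d)^2) * v (n + d) = 0) :
    ∑ n ∈ S, v n ^ 2 ≤ 4 * D.card * t^(2*k) * (∑ n ∈ S, Qs x D k n) * ∑ n ∈ S, v n ^ 2 := by
  have hs : ∀ n d, |t * x n d| ≤ 1/2 := by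
    intro n d
    rw [abs_mul, abs_of_pos ht0]
    nlinarith [hx1 n d, abs_nonneg (x n d)]
  have hden : ∀ n d, 0 < 1 - (t * x n d)^2 := by
    intro n d
    have h1 := hs n d
    have := sq_le_sq' (by linarith [abs_nonneg (t * x n d)] : -(1/2) ≤ |t * x n d|) h1
    rw [sq_abs] at this; linarith
  set φ : ℤ → ℤ → ℝ := fun n d =>
    ((t * x n d) * v (n + d) - (t * x n d)^2 * v n) / (1 - (t * x n d)^2) with hφdef
  have hφ0 : ∀ n, n ∉ S → ∀ d ∈ D, φ n d = 0 := by
    intro n hn d hd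
    by_cases hx : x n d = 0
    · simp [hφdef, hx]
    · have : n + d ∉ S := by
        intro h
        apply hn
        have := hS _ h (-d) (hD d hd) (by rw [hsym n d hd]; exact hx)
        simpa using this
      simp [hφdef, hv n hn, hv _ this]
  have hsum : ∀ n, ∑ d ∈ D, φ n d = v n := by
    intro n
    by_cases hn : n ∈ S
    · have h := hM n hn
      have : ∑ d ∈ D, φ n d = ∑ d ∈ D, (t * x n d) / (1 - (t * x n d)^2) * v (n + d)
          - (∑ d ∈ D, (t * x n d)^2 / (1 - (t * x n d)^2)) * v n := by
        rw [Finset.sum_mul, ← Finset.sum_sub_distrib]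
        refine Finset.sum_congr rfl fun d _ => ?_
        simp only [hφdef]; ring
      linarith
    · rw [hv n hn]; exact Finset.sum_eq_zero fun d hd => hφ0 n hn d hd
  have hrec : ∀ n, ∀ d ∈ D, φ n d = t * x n d * ∑ d' ∈ D, if d' ≠ -d then φ (n + d) d' else 0 := by
    intro n d hd
    have h1 : ∑ d' ∈ D, (if d' ≠ -d then φ (n + d) d' else 0) = v (n + d) - φ (n + d) (-d) := by
      rw [← hsum (n + d), ← Finset.sum_filter, Finset.filter_ne' D (-d)]
      rw [← Finset.add_sum_erase D _ (hD d hd)]; ring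
    rw [h1]
    simp only [hφdef]
    rw [hsym n d hd]
    have := (hden n d).ne'
    have e : n + d + -d = n := by ring
    rw [e]
    generalize t * x n d = s at this ⊢
    have h2 := div_mul_cancel₀ (s * v n - s ^ 2 * v (n + d)) this
    rw [div_eq_iff this]
    linear_combination s * h2
  -- sum of squares
  have hsq : ∑ p ∈ D ×ˢ S, φ p.2 p.1 ^ 2 ≤ 4 * D.card * ∑ n ∈ S, v n ^ 2 := by
    rw [Finset.sum_product]
    have : ∀ d ∈ D, ∑ n ∈ S, φ n d ^ 2 ≤ 4 * ∑ n ∈ S, v n ^ 2 := by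
      intro d _
      have h1 : ∑ n ∈ S, φ n d ^ 2 ≤ ∑ n ∈ S, 2 * (v n ^ 2 + v (n + d) ^ 2) :=
        Finset.sum_le_sum fun n _ => phi_sq_bound _ _ _ (hs n d)
      have h2 : ∑ n ∈ S, v (n + d) ^ 2 ≤ ∑ n ∈ S, v n ^ 2 := by
        have : ∑ n ∈ S, v (n + d) ^ 2 = ∑ n ∈ S.image (· + d), v n ^ 2 := by
          rw [Finset.sum_image]; intro a _ b _ h; simpa using h
        rw [this, ← Finset.sum_filter_add_sum_filter_not _ (· ∈ S)]
        have h0 : ∑ n ∈ (S.image (· + d)).filter (fun n => ¬ n ∈ S), v n ^ 2 = 0 := by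
          refine Finset.sum_eq_zero fun n hn => ?_
          rw [hv n (Finset.mem_filter.1 hn).2]; simp
        rw [h0, add_zero]
        refine Finset.sum_le_sum_of_subset_of_nonneg ?_ fun _ _ _ => sq_nonneg _
        intro n hn; exact (Finset.mem_filter.1 hn).2
      rw [← Finset.mul_sum, Finset.sum_add_distrib] at h1
      linarith
    calc _ ≤ ∑ d ∈ D, 4 * ∑ n ∈ S, v n ^ 2 := Finset.sum_le_sum this
      _ = _ := by rw [Finset.sum_const, nsmul_eq_mul]; ring
  -- per-point bound
  have hpt : ∀ n ∈ S, v n ^ 2 ≤ t^(2*k) * Qs x D k n * (4 * D.card * ∑ n ∈ S, v n ^ 2) := by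
    intro n hn
    set c : ℤ × ℤ → ℝ := fun p => ∑ w ∈ words D k,
      if (nb 0 w ∧ p.1 ≠ - lastS 0 w) ∧ n + w.sum = p.2 then Hw x n w else 0 with hc
    have hin : ∀ w ∈ words D k, Hw x n w ≠ 0 → n + w.sum ∈ S := fun w hw h =>
      Hw_mem x D S hS w ((mem_words _ _ _).1 hw).2 n hn h
    have h1 : v n = t^k * ∑ p ∈ D ×ˢ S, c p * φ p.2 p.1 := by
      have h := iter_id x φ D t hrec k n 0
      have h' : (∑ d ∈ D, if d ≠ -0 then φ n d else 0) = v n := by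
        rw [← hsum n]
        refine Finset.sum_congr rfl fun d hd => ?_
        rw [if_pos]; rintro rfl; exact hD0 (by simpa using hd)
      rw [h'] at h
      rw [h]; congr 1
      rw [Finset.sum_product]
      simp only [hc, Finset.sum_mul]
      have : ∀ d ∈ D, (∑ y ∈ S, ∑ w ∈ words D k, (if (nb 0 w ∧ d ≠ - lastS 0 w) ∧ n + w.sum = y then Hw x n w else 0) * φ y d) = ∑ w ∈ words D k, (if nb 0 w ∧ d ≠ - lastS 0 w then Hw x n w * φ (n + w.sum) d else 0) := by
        intro d _
        rw [Finset.sum_comm]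
        refine Finset.sum_congr rfl fun w hw => ?_
        by_cases hA : nb 0 w ∧ d ≠ - lastS 0 w
        · simp only [hA, and_self, true_and, ne_eq, not_false_eq_true, if_true]
          by_cases hz : Hw x n w = 0
          · simp [hz]
          · rw [Finset.sum_eq_single (n + w.sum)]
            · simp
            · intro b _ hb; rw [if_neg (Ne.symm hb)]; simp
            · intro h; exact absurd (hin w hw hz) h
        · simp only [hA, false_and, if_false, zero_mul, Finset.sum_const_zero]
      rw [Finset.sum_congr rfl this, Finset.sum_comm]
      refine Finset.sum_congr rfl fun w _ => ?_
      by_cases hb : nb 0 w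
      · simp only [hb, if_true, true_and, Finset.mul_sum]
        refine Finset.sum_congr rfl fun d _ => ?_
        split_ifs <;> simp
      · simp [hb]
    have h2 : ∑ p ∈ D ×ˢ S, c p ^ 2 = Qs x D k n := by
      rw [Finset.sum_product, Qs]
      refine Finset.sum_congr rfl fun d _ => ?_
      simp only [hc, sq, Finset.sum_mul_sum]
      rw [Finset.sum_comm]
      refine Finset.sum_congr rfl fun w hw => ?_
      rw [Finset.sum_comm]
      refine Finset.sum_congr rfl fun w' hw' => ?_
      by_cases hA : nb 0 w ∧ d ≠ - lastS 0 w
      · by_cases hB : nb 0 w' ∧ d ≠ - lastS 0 w'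
        · simp only [hA, hB, and_self, true_and, ne_eq, not_false_eq_true]
          by_cases hz : Hw x n w = 0
          · simp [hz]
          · rw [Finset.sum_eq_single (n + w.sum)]
            · by_cases e : w.sum = w'.sum
              · simp [e]
              · have : ¬ (w'.sum = w.sum) := fun h => e h.symm
                simp [e, this]
            · intro b _ hb; rw [if_neg (Ne.symm hb)]; simp
            · intro h; exact absurd (hin w hw hz) h
        · simp only [hB, false_and, and_false, if_false, mul_zero, Finset.sum_const_zero]
      · simp only [hA, false_and, if_false, zero_mul, Finset.sum_const_zero]
    have hcs := Finset.sum_mul_sq_le_sq_mul_sq (D ×ˢ S) c (fun p => φ p.2 p.1)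
    rw [h2] at hcs
    have hQ : 0 ≤ Qs x D k n := h2 ▸ Finset.sum_nonneg fun _ _ => sq_nonneg _
    rw [h1, mul_pow, ← pow_mul, mul_comm k 2, mul_assoc]
    refine mul_le_mul_of_nonneg_left (hcs.trans ?_) (by positivity)
    exact mul_le_mul_of_nonneg_left hsq hQ
  calc ∑ n ∈ S, v n ^ 2 ≤ ∑ n ∈ S, t^(2*k) * Qs x D k n * (4 * D.card * ∑ n ∈ S, v n ^ 2) :=
        Finset.sum_le_sum hpt
    _ = _ := by rw [← Finset.sum_mul, ← Finset.mul_sum]; ring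
end PartOne

section PartOneB
open scoped Classical

theorem reindex_sym (b : ℤ → ℤ → ℝ) (D S : Finset ℤ) (hD : ∀ d ∈ D, -d ∈ D)
    (hsym : ∀ n, ∀ d ∈ D, b (n + d) (-d) = b n d) (v w : ℤ → ℝ)
    (hv : ∀ n, n ∉ S → v n = 0) (hw : ∀ n, n ∉ S → w n = 0) :
    ∑ n ∈ S, ∑ d ∈ D, b n d * v (n + d) * w n = ∑ n ∈ S, ∑ d ∈ D, b n d * w (n + d) * v n := by
  rw [← Finset.sum_product', ← Finset.sum_product']
  refine Finset.sum_bij_ne_zero (fun p _ _ => (p.1 + p.2, -p.2)) ?_ ?_ ?_ ?_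
  · rintro ⟨n, d⟩ h1 h2
    simp only [Finset.mem_product] at h1 ⊢
    refine ⟨?_, hD d h1.2⟩
    by_contra h
    exact h2 (by simp [hv _ h])
  · rintro ⟨n, d⟩ _ _ ⟨n', d'⟩ _ _ h
    simp only [Prod.mk.injEq, neg_inj] at h ⊢
    obtain ⟨h1, rfl⟩ := h
    exact ⟨by linarith, rfl⟩
  · rintro ⟨n, d⟩ h1 h2
    simp only [Finset.mem_product] at h1
    refine ⟨(n + d, -d), ?_, ?_, ?_⟩
    · simp only [Finset.mem_product]
      refine ⟨?_, hD d h1.2⟩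
      by_contra h
      exact h2 (by simp [hw _ h])
    · simp only [hsym n d h1.2]
      have e : n + d + -d = n := by ring
      rw [e]
      simpa [mul_comm, mul_left_comm, mul_assoc] using h2
    · simp
  · rintro ⟨n, d⟩ h1 h2
    simp only [Finset.mem_product] at h1
    simp only [hsym n d h1.2]
    have e : n + d + -d = n := by ring
    rw [e]; ring

/-- quadratic form of Ihara-Bass type -/
noncomputable def qf (x : ℤ → ℤ → ℝ) (D S : Finset ℤ) (t : ℝ) (v : ℤ → ℝ) : ℝ :=
  ∑ n ∈ S, (1 + ∑ d ∈ D, (t * x n d)^2 / (1 - (t * x n d)^2)) * v n ^ 2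
    - ∑ n ∈ S, ∑ d ∈ D, (t * x n d) / (1 - (t * x n d)^2) * v (n + d) * v n

theorem lin_zero (b c : ℝ) (h : ∀ ε : ℝ, 0 ≤ 2 * ε * b + ε^2 * c) : b = 0 := by
  have hc : 0 ≤ c := by
    have h1 := h 1; have h2 := h (-1); nlinarith
  have h3 := h (-b / (c + 1))
  have hc1 : 0 < c + 1 := by linarith
  have h4 : 2 * (-b / (c + 1)) * b + (-b / (c + 1))^2 * c = -(b^2 * (c + 2)) / (c+1)^2 := by
    field_simp; ring
  rw [h4, le_div_iff₀ (by positivity)] at h3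
  have : b^2 ≤ 0 := by nlinarith [sq_nonneg b]
  exact pow_eq_zero_iff (two_ne_zero) |>.1 (le_antisymm this (sq_nonneg b))

theorem qf_null (x : ℤ → ℤ → ℝ) (D S : Finset ℤ) (t : ℝ) (v : ℤ → ℝ)
    (hD : ∀ d ∈ D, -d ∈ D) (hsym : ∀ n, ∀ d ∈ D, x (n + d) (-d) = x n d)
    (hv : ∀ n, n ∉ S → v n = 0)
    (hpos : ∀ w : ℤ → ℝ, (∀ n, n ∉ S → w n = 0) → 0 ≤ qf x D S t w)
    (h0 : qf x D S t v = 0) (m : ℤ) (hm : m ∈ S) :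
    v m + (∑ d ∈ D, (t * x m d)^2 / (1 - (t * x m d)^2)) * v m
      - ∑ d ∈ D, (t * x m d) / (1 - (t * x m d)^2) * v (m + d) = 0 := by
  set w : ℤ → ℝ := fun n => if n = m then 1 else 0 with hw
  have hw0 : ∀ n, n ∉ S → w n = 0 := by
    intro n hn; simp only [hw]; rw [if_neg]; rintro rfl; exact hn hm
  set a : ℤ → ℝ := fun n => 1 + ∑ d ∈ D, (t * x n d)^2 / (1 - (t * x n d)^2) with ha
  set b : ℤ → ℤ → ℝ := fun n d => (t * x n d) / (1 - (t * x n d)^2) with hb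
  have hbs : ∀ n, ∀ d ∈ D, b (n + d) (-d) = b n d := by
    intro n d hd; simp only [hb, hsym n d hd]
  have hre := reindex_sym b D S hD hbs v w hv hw0
  have hB : (∑ n ∈ S, a n * v n * w n - ∑ n ∈ S, ∑ d ∈ D, b n d * v (n + d) * w n) = 0 := by
    apply lin_zero _ (qf x D S t w)
    intro ε
    have h := hpos (fun n => v n + ε * w n) (fun n hn => by simp [hv n hn, hw0 n hn])
    have e : qf x D S t (fun n => v n + ε * w n) = qf x D S t v
      + ε * (2 * ∑ n ∈ S, a n * v n * w n - ∑ n ∈ S, ∑ d ∈ D, b n d * v (n + d) * w n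
        - ∑ n ∈ S, ∑ d ∈ D, b n d * w (n + d) * v n) + ε^2 * qf x D S t w := by
      simp only [qf]
      change ∑ n ∈ S, a n * (v n + ε * w n)^2 - ∑ n ∈ S, ∑ d ∈ D, b n d * (v (n + d) + ε * w (n + d)) * (v n + ε * w n) =
        (∑ n ∈ S, a n * (v n)^2 - ∑ n ∈ S, ∑ d ∈ D, b n d * v (n + d) * v n) + _ +
        ε^2 * (∑ n ∈ S, a n * (w n)^2 - ∑ n ∈ S, ∑ d ∈ D, b n d * w (n + d) * w n)
      simp only [mul_sub, mul_add, Finset.mul_sum, ← Finset.sum_sub_distrib, ← Finset.sum_add_distrib]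
      refine Finset.sum_congr rfl fun n _ => ?_
      have : ∑ d ∈ D, b n d * (v (n + d) + ε * w (n + d)) * (v n + ε * w n)
        = ∑ d ∈ D, b n d * v (n + d) * v n + ∑ d ∈ D, ε * (b n d * v (n + d) * w n)
          + ∑ d ∈ D, ε * (b n d * w (n + d) * v n) + ∑ d ∈ D, ε^2 * (b n d * w (n + d) * w n) := by
        simp only [← Finset.sum_add_distrib]
        exact Finset.sum_congr rfl fun d _ => by ring
      simp only [mul_add] at this
      rw [this]; ring
    rw [e, h0, ← hre] at h
    linarith
  have s1 : ∑ n ∈ S, a n * v n * w n = a m * v m := by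
    rw [Finset.sum_eq_single m]
    · simp [hw]
    · intro n _ hn; simp [hw, hn]
    · intro h; exact absurd hm h
  have s2 : ∑ n ∈ S, ∑ d ∈ D, b n d * v (n + d) * w n = ∑ d ∈ D, b m d * v (m + d) := by
    rw [Finset.sum_eq_single m]
    · simp [hw]
    · intro n _ hn; simp [hw, hn]
    · intro h; exact absurd hm h
  rw [s1, s2] at hB
  rw [← hB]; simp only [ha, hb]; ring

theorem qf_nonneg (x : ℤ → ℤ → ℝ) (D S : Finset ℤ) (t₀ : ℝ)
    (hD : ∀ d ∈ D, -d ∈ D) (hsym : ∀ n, ∀ d ∈ D, x (n + d) (-d) = x n d)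
    (hx1 : ∀ n d, |x n d| ≤ 1) (ht0 : 0 < t₀) (ht : t₀ ≤ 1/2)
    (hnull : ∀ t, 0 < t → t ≤ t₀ → ∀ v : ℤ → ℝ, (∀ n, n ∉ S → v n = 0) →
      (∀ m ∈ S, v m + (∑ d ∈ D, (t * x m d)^2 / (1 - (t * x m d)^2)) * v m
      - ∑ d ∈ D, (t * x m d) / (1 - (t * x m d)^2) * v (m + d) = 0) → ∑ n ∈ S, v n ^ 2 = 0)
    (v : ℤ → ℝ) (hv : ∀ n, n ∉ S → v n = 0) : 0 ≤ qf x D S t₀ v := by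
  by_contra hneg
  push Not at hneg
  let ext : EuclideanSpace ℝ S → ℤ → ℝ := fun u n => if h : n ∈ S then u ⟨n, h⟩ else 0
  have hext0 : ∀ u n, n ∉ S → ext u n = 0 := fun u n h => by simp [ext, h]
  have hextc : ∀ n, Continuous fun u => ext u n := by
    intro n
    by_cases h : n ∈ S
    · simp only [ext, h, dif_pos]; fun_prop
    · simp only [ext, h, dif_neg, not_false_eq_true]; exact continuous_const
  have hextn : ∀ u, ∑ n ∈ S, ext u n ^ 2 = ‖u‖^2 := by
    intro u
    rw [EuclideanSpace.norm_sq_eq, ← Finset.sum_coe_sort S]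
    refine Finset.sum_congr rfl fun i _ => ?_
    simp [ext]
  have hden : ∀ t ∈ Set.Icc 0 t₀, ∀ n d, 1 - (t * x n d)^2 ≠ 0 := by
    intro t ht' n d
    have h1 : |t * x n d| ≤ 1/2 := by
      rw [abs_mul, abs_of_nonneg ht'.1]
      nlinarith [hx1 n d, abs_nonneg (x n d), ht'.2, ht'.1]
    have := sq_le_sq' (by linarith [abs_nonneg (t * x n d)] : -(1/2) ≤ |t * x n d|) h1
    rw [sq_abs] at this; linarith
  let K : Set (ℝ × EuclideanSpace ℝ S) := Set.Icc 0 t₀ ×ˢ Metric.sphere 0 1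
  have hK : IsCompact K := isCompact_Icc.prod (isCompact_sphere 0 1)
  have hcont : ContinuousOn (fun p : ℝ × EuclideanSpace ℝ S => qf x D S p.1 (ext p.2)) K := by
    have hA : ∀ n d, ContinuousOn (fun p : ℝ × EuclideanSpace ℝ S => 1 - (p.1 * x n d)^2) K := by
      intro n d; fun_prop
    have hE : ∀ n, ContinuousOn (fun p : ℝ × EuclideanSpace ℝ S => ext p.2 n) K := fun n =>
      ((hextc n).comp continuous_snd).continuousOn
    unfold qf
    refine ContinuousOn.sub ?_ ?_
    · refine continuousOn_finsetSum _ fun n _ => ContinuousOn.mul ?_ ((hE n).pow 2)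
      refine continuousOn_const.add (continuousOn_finsetSum _ fun d _ => ?_)
      refine ContinuousOn.div (by fun_prop) (hA n d) fun p hp => hden _ hp.1 n d
    · refine continuousOn_finsetSum _ fun n _ => continuousOn_finsetSum _ fun d _ => ?_
      refine ContinuousOn.mul (ContinuousOn.mul ?_ (hE _)) (hE _)
      refine ContinuousOn.div (by fun_prop) (hA n d) fun p hp => hden _ hp.1 n d
  let K' := K ∩ (fun p : ℝ × EuclideanSpace ℝ S => qf x D S p.1 (ext p.2)) ⁻¹' Set.Iic 0
  have hK' : IsCompact K' :=
    hK.of_isClosed_subset (hcont.preimage_isClosed_of_isClosed hK.isClosed isClosed_Iic)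
      Set.inter_subset_left
  -- scaling
  have hscale : ∀ t c (w : ℤ → ℝ), qf x D S t (fun n => c * w n) = c^2 * qf x D S t w := by
    intro t c w
    simp only [qf, mul_sub, Finset.mul_sum]
    congr 1
    · exact Finset.sum_congr rfl fun n _ => by ring
    · exact Finset.sum_congr rfl fun n _ => Finset.sum_congr rfl fun d _ => by ring
  -- from a function to the sphere
  have hsph : ∀ t, ∀ w : ℤ → ℝ, (∀ n, n ∉ S → w n = 0) → qf x D S t w < 0 →
      ∃ u ∈ Metric.sphere (0 : EuclideanSpace ℝ S) 1, qf x D S t (ext u) < 0 := by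
    intro t w hw hq
    set u : EuclideanSpace ℝ S := WithLp.toLp 2 (fun i : S => w i) with hu
    have hue : ext u = w := by
      funext n
      by_cases h : n ∈ S
      · simp [ext, h, hu]
      · simp [ext, h, hw n h]
    have hun : u ≠ 0 := by
      intro h
      have : w = 0 := by
        rw [← hue, h]; funext n; simp [ext]
      rw [this] at hq
      have := hscale t 0 0
      simp at this
      have h0 : qf x D S t 0 = 0 := by
        simp [qf]
      linarith
    refine ⟨(‖u‖)⁻¹ • u, ?_, ?_⟩
    · simp [norm_smul, hun]
    · have : ext ((‖u‖)⁻¹ • u) = fun n => (‖u‖)⁻¹ * w n := by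
        funext n
        rw [← hue]
        by_cases h : n ∈ S
        · simp [ext, h]
        · simp [ext, h]
      rw [this, hscale]
      have : 0 < ‖u‖ := norm_pos_iff.2 hun
      have : 0 < (‖u‖)⁻¹ ^ 2 := by positivity
      nlinarith
  obtain ⟨u₀, hu₀, hq₀⟩ := hsph t₀ v hv hneg
  have hne : K'.Nonempty := ⟨(t₀, u₀), ⟨⟨⟨ht0.le, le_rfl⟩, hu₀⟩, hq₀.le⟩⟩
  obtain ⟨⟨t, u⟩, ⟨⟨htI, hu⟩, hq⟩, hmin⟩ := hK'.exists_isMinOn hne continuous_fst.continuousOn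
  have hun : ‖u‖ = 1 := by simpa using hu
  simp only [Set.mem_preimage, Set.mem_Iic] at hq
  have htpos : 0 < t := by
    rcases htI.1.lt_or_eq with h | h
    · exact h
    · exfalso
      simp only at h
      rw [← h] at hq
      have : qf x D S 0 (ext u) = 1 := by
        have := hextn u
        rw [hun] at this
        simp [qf, this]
      linarith
  have hpos : ∀ w : ℤ → ℝ, (∀ n, n ∉ S → w n = 0) → 0 ≤ qf x D S t w := by
    intro w hw
    by_contra hlt
    push Not at hlt
    obtain ⟨u₁, hu₁, hq₁⟩ := hsph t w hw hlt
    -- by continuity, some smaller t also is negative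
    have hc1 : ContinuousOn (fun s : ℝ => qf x D S s (ext u₁)) (Set.Icc 0 t₀) :=
      hcont.comp (f := fun s : ℝ => (s, u₁)) (by fun_prop) fun s hs => ⟨hs, hu₁⟩
    have hc2 : ContinuousWithinAt (fun s : ℝ => qf x D S s (ext u₁)) (Set.Iio t ∩ Set.Icc 0 t₀) t :=
      (hc1 t htI).mono Set.inter_subset_right
    have hev := hc2.eventually (gt_mem_nhds hq₁)
    have hnb : (nhdsWithin t (Set.Iio t ∩ Set.Icc 0 t₀)).NeBot := by
      have h1 : Set.Ioo 0 t ⊆ Set.Iio t ∩ Set.Icc 0 t₀ := fun s hs =>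
        ⟨hs.2, hs.1.le, hs.2.le.trans htI.2⟩
      exact (right_nhdsWithin_Ioo_neBot htpos).mono (nhdsWithin_mono _ h1)
    obtain ⟨s, hs1, hs2⟩ := (hev.and self_mem_nhdsWithin).exists
    have := hmin (a := (s, u₁)) ⟨⟨hs2.2, hu₁⟩, by simpa using hs1.le⟩
    simp only [Set.mem_ofPred_eq] at this
    exact absurd hs2.1 (not_lt.2 this)
  have hz : qf x D S t (ext u) = 0 := le_antisymm hq (hpos _ (hext0 u))
  have := hnull t htpos htI.2 (ext u) (hext0 u)
    (qf_null x D S t (ext u) hD hsym (hext0 u) hpos hz)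
  rw [hextn, hun] at this
  norm_num at this

/-- positivity for good blocks -/
theorem qf_nonneg_block (x : ℤ → ℤ → ℝ) (D S : Finset ℤ) (k : ℕ) (t₀ : ℝ)
    (hD : ∀ d ∈ D, -d ∈ D) (hD0 : (0:ℤ) ∉ D)
    (hx1 : ∀ n d, |x n d| ≤ 1) (hsym : ∀ n, ∀ d ∈ D, x (n + d) (-d) = x n d)
    (hS : ∀ n ∈ S, ∀ d ∈ D, x n d ≠ 0 → n + d ∈ S)
    (ht0 : 0 < t₀) (ht : t₀ ≤ 1/2)
    (hgood : 4 * D.card * t₀^(2*k) * (∑ n ∈ S, Qs x D k n) < 1)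
    (v : ℤ → ℝ) (hv : ∀ n, n ∉ S → v n = 0) : 0 ≤ qf x D S t₀ v := by
  refine qf_nonneg x D S t₀ hD hsym hx1 ht0 ht ?_ v hv
  intro t htp htl w hw hM
  have h := null_bound x D S k t w hD hD0 hx1 hsym hS htp (htl.trans ht) hw hM
  have h0 : 0 ≤ ∑ n ∈ S, w n ^ 2 := Finset.sum_nonneg fun _ _ => sq_nonneg _
  by_contra hne
  have hpos : 0 < ∑ n ∈ S, w n ^ 2 := lt_of_le_of_ne h0 (Ne.symm hne)
  have h1 : 1 ≤ 4 * D.card * t^(2*k) * (∑ n ∈ S, Qs x D k n) := by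
    by_contra hlt
    push Not at hlt
    nlinarith
  have hQ : 0 ≤ ∑ n ∈ S, Qs x D k n := by
    by_contra hlt
    push Not at hlt
    have : (0:ℝ) ≤ 4 * D.card * t^(2*k) := by positivity
    nlinarith
  have h2 : t^(2*k) ≤ t₀^(2*k) := pow_le_pow_left₀ htp.le htl _
  have h3 : 4 * D.card * t^(2*k) * (∑ n ∈ S, Qs x D k n) ≤ 4 * D.card * t₀^(2*k) * (∑ n ∈ S, Qs x D k n) := by
    gcongr
  linarith
end PartOneB

section PartOneC
open scoped Classical

theorem qf_one_side (x : ℤ → ℤ → ℝ) (D S : Finset ℤ) (t R : ℝ)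
    (hD : ∀ d ∈ D, -d ∈ D)
    (hx1 : ∀ n d, |x n d| ≤ 1) (hsym : ∀ n, ∀ d ∈ D, x (n + d) (-d) = x n d)
    (ht0 : 0 < t) (ht : t ≤ 1/2)
    (v : ℤ → ℝ) (hv : ∀ n, n ∉ S → v n = 0)
    (hR : ∀ n, v n ≠ 0 → ∑ d ∈ D, |x n d| ≤ R)
    (hq : 0 ≤ qf x D S t v) :
    t * ∑ n ∈ S, ∑ d ∈ D, x n d * v (n + d) * v n ≤ (1 + 2 * t^2 * R) * ∑ n ∈ S, v n ^ 2 := by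
  have hs : ∀ n d, (t * x n d)^2 ≤ t^2 * |x n d| := by
    intro n d
    rw [mul_pow, ← sq_abs (x n d)]
    have : |x n d|^2 ≤ |x n d| := by nlinarith [hx1 n d, abs_nonneg (x n d)]
    gcongr
  have hs4 : ∀ n d, (t * x n d)^2 ≤ 1/4 := by
    intro n d
    have := hs n d
    have : t^2 * |x n d| ≤ 1/4 * 1 := by
      apply mul_le_mul _ (hx1 n d) (abs_nonneg _) (by norm_num); nlinarith
    linarith
  have ha : ∀ n d, (t * x n d)^2 / (1 - (t * x n d)^2) ≤ 4/3 * (t^2 * |x n d|) := by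
    intro n d
    have h1 := hs n d; have h2 := hs4 n d
    rw [div_le_iff₀ (by linarith)]
    have : 0 ≤ t^2 * |x n d| := by positivity
    nlinarith
  have hb : ∀ n d, |(t * x n d) / (1 - (t * x n d)^2) - t * x n d| ≤ 2/3 * (t^2 * |x n d|) := by
    intro n d
    have h2 := hs4 n d
    have h3 : (t * x n d) / (1 - (t * x n d)^2) - t * x n d = t * x n d * ((t * x n d)^2 / (1 - (t * x n d)^2)) := by
      have : 1 - (t * x n d)^2 ≠ 0 := by linarith
      generalize t * x n d = s at this ⊢
      field_simp; ring
    rw [h3, abs_mul]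
    have h4 : |t * x n d| ≤ 1/2 := by
      rw [abs_mul, abs_of_pos ht0]
      nlinarith [hx1 n d, abs_nonneg (x n d)]
    have h5 : 0 ≤ (t * x n d)^2 / (1 - (t * x n d)^2) := div_nonneg (sq_nonneg _) (by linarith)
    rw [abs_of_nonneg h5]
    calc _ ≤ 1/2 * (4/3 * (t^2 * |x n d|)) := mul_le_mul h4 (ha n d) h5 (by norm_num)
      _ = _ := by ring
  -- weighted row sums
  have hrow : ∑ n ∈ S, ∑ d ∈ D, |x n d| * v n ^ 2 ≤ R * ∑ n ∈ S, v n ^ 2 := by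
    rw [Finset.mul_sum]
    refine Finset.sum_le_sum fun n _ => ?_
    rw [← Finset.sum_mul]
    by_cases h : v n = 0
    · simp [h]
    · exact mul_le_mul_of_nonneg_right (hR n h) (sq_nonneg _)
  have hcol : ∑ n ∈ S, ∑ d ∈ D, |x n d| * v (n + d) ^ 2 ≤ R * ∑ n ∈ S, v n ^ 2 := by
    have h := reindex_sym (fun n d => |x n d|) D S hD (fun n d hd => by simp only [hsym n d hd])
      (fun n => v n ^ 2) (fun n => if n ∈ S then 1 else 0) (fun n hn => by simp [hv n hn])
      (fun n hn => by simp [hn])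
    have h1 : ∑ n ∈ S, ∑ d ∈ D, |x n d| * v (n + d) ^ 2 =
        ∑ n ∈ S, ∑ d ∈ D, |x n d| * v (n + d)^2 * (if n ∈ S then 1 else 0) :=
      Finset.sum_congr rfl fun n hn => by simp [hn]
    rw [h1, h]
    refine le_trans (Finset.sum_le_sum fun n _ => Finset.sum_le_sum fun d _ => ?_) hrow
    refine mul_le_mul_of_nonneg_right ?_ (sq_nonneg _)
    split_ifs <;> simp
  have hcross : ∀ n d, t * x n d * v (n + d) * v n ≤ (t * x n d) / (1 - (t * x n d)^2) * v (n + d) * v n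
      + t^2 / 3 * (|x n d| * v n ^2 + |x n d| * v (n + d)^2) := by
    intro n d
    have h1 : -( (t * x n d) / (1 - (t * x n d)^2) - t * x n d) * (v (n + d) * v n) ≤
        |(t * x n d) / (1 - (t * x n d)^2) - t * x n d| * |v (n + d) * v n| := by
      calc _ ≤ |-( (t * x n d) / (1 - (t * x n d)^2) - t * x n d) * (v (n + d) * v n)| := le_abs_self _
        _ = _ := by rw [abs_mul, abs_neg]
    have h2 : |v (n + d) * v n| ≤ (v n ^2 + v (n + d)^2) / 2 := by
      rw [abs_mul]; nlinarith [sq_nonneg (|v (n+d)| - |v n|), sq_abs (v (n+d)), sq_abs (v n)]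
    have h3 := mul_le_mul (hb n d) h2 (abs_nonneg _) (by positivity)
    nlinarith
  have hsum : t * ∑ n ∈ S, ∑ d ∈ D, x n d * v (n + d) * v n ≤
      ∑ n ∈ S, ∑ d ∈ D, (t * x n d) / (1 - (t * x n d)^2) * v (n + d) * v n
      + t^2 / 3 * (∑ n ∈ S, ∑ d ∈ D, |x n d| * v n ^2 + ∑ n ∈ S, ∑ d ∈ D, |x n d| * v (n + d)^2) := by
    simp only [mul_add, Finset.mul_sum, ← Finset.sum_add_distrib]
    refine Finset.sum_le_sum fun n _ => Finset.sum_le_sum fun d _ => ?_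
    have := hcross n d
    linarith
  have hdiag : ∑ n ∈ S, (1 + ∑ d ∈ D, (t * x n d)^2 / (1 - (t * x n d)^2)) * v n ^ 2 ≤
      ∑ n ∈ S, v n ^ 2 + 4/3 * t^2 * ∑ n ∈ S, ∑ d ∈ D, |x n d| * v n ^2 := by
    rw [Finset.mul_sum, ← Finset.sum_add_distrib]
    refine Finset.sum_le_sum fun n _ => ?_
    rw [add_mul, one_mul, ← Finset.sum_mul, ← mul_assoc, Finset.mul_sum]
    gcongr with d hd
    have := ha n d
    linarith
  have hpos : 0 ≤ t^2 := sq_nonneg _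
  unfold qf at hq
  nlinarith [mul_le_mul_of_nonneg_left hrow hpos, mul_le_mul_of_nonneg_left hcol hpos]

theorem block_bound (x : ℤ → ℤ → ℝ) (D S : Finset ℤ) (k : ℕ) (t R : ℝ)
    (hD : ∀ d ∈ D, -d ∈ D) (hD0 : (0:ℤ) ∉ D)
    (hx1 : ∀ n d, |x n d| ≤ 1) (hsym : ∀ n, ∀ d ∈ D, x (n + d) (-d) = x n d)
    (hS : ∀ n ∈ S, ∀ d ∈ D, x n d ≠ 0 → n + d ∈ S)
    (ht0 : 0 < t) (ht : t ≤ 1/2)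
    (hgood : 4 * D.card * t^(2*k) * (∑ n ∈ S, Qs x D k n) < 1)
    (v : ℤ → ℝ) (hv : ∀ n, n ∉ S → v n = 0)
    (hR : ∀ n, v n ≠ 0 → ∑ d ∈ D, |x n d| ≤ R) :
    |∑ n ∈ S, ∑ d ∈ D, x n d * v (n + d) * v n| ≤ (1 / t + 2 * t * R) * ∑ n ∈ S, v n ^ 2 := by
  have h1 := qf_one_side x D S t R hD hx1 hsym ht0 ht v hv hR
    (qf_nonneg_block x D S k t hD hD0 hx1 hsym hS ht0 ht hgood v hv)
  have h2 := qf_one_side (fun n d => - x n d) D S t R hD (by simpa using hx1)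
    (fun n d hd => by simp [hsym n d hd]) ht0 ht v hv (by simpa using hR)
    (qf_nonneg_block _ D S k t hD hD0 (by simpa using hx1)
      (fun n d hd => by simp [hsym n d hd]) (fun n hn d hd h => hS n hn d hd (by simpa using h)) ht0 ht
      (by simp only [Qs_neg]; exact hgood) v hv)
  simp only [neg_mul, Finset.sum_neg_distrib] at h2
  have h3 : (1 / t + 2 * t * R) * ∑ n ∈ S, v n ^ 2 = (1 + 2 * t^2 * R) * (∑ n ∈ S, v n ^ 2) / t := by
    field_simp
  rw [h3, le_div_iff₀ ht0, ← abs_of_pos ht0, ← abs_mul, abs_of_pos ht0]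
  refine abs_le.2 ⟨?_, ?_⟩ <;> linarith
end PartOneC

section PartTwo
open scoped Classical

def pathR (ρ : ℕ → ℤ → Prop) : ℤ → List (ℕ × ℤ) → Prop
  | _, [] => True
  | u, a :: t => ρ a.1 u ∧ pathR ρ (u + a.2 * a.1) t

def runSum (l : List (ℕ × ℤ)) : ℤ := (l.map fun a => a.2 * (a.1 : ℤ)).sum

theorem runSum_cons (a : ℕ × ℤ) (l : List (ℕ × ℤ)) : runSum (a :: l) = a.2 * a.1 + runSum l := by
  simp [runSum]

theorem pathR_append (ρ : ℕ → ℤ → Prop) (l1 l2 : List (ℕ × ℤ)) (u : ℤ) :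
    pathR ρ u (l1 ++ l2) ↔ pathR ρ u l1 ∧ pathR ρ (u + runSum l1) l2 := by
  induction l1 generalizing u with
  | nil => simp [pathR, runSum]
  | cons a t ih => simp only [List.cons_append, pathR, ih, runSum_cons, and_assoc, add_assoc]

/-- witness data -/
def IsWit (P : Finset ℕ) (g : ℕ) (q : ℕ × List (ℕ × ℤ)) : Prop :=
  q.1 ∈ P ∧ q.2.length ≤ g ∧ (∀ a ∈ q.2, a.1 ∈ P ∧ a.2 ≠ 0 ∧ |a.2| ≤ g) ∧
    (q.2.map Prod.fst).Nodup ∧ q.1 ∉ q.2.map Prod.fst ∧ runSum q.2 ≠ 0 ∧ (q.1 : ℤ) ∣ runSum q.2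

def YR (P : Finset ℕ) (g : ℕ) (ρ : ℕ → ℤ → Prop) (u : ℤ) : Prop :=
  ∃ q, IsWit P g q ∧ ρ q.1 u ∧ pathR ρ u q.2

theorem pathR_mono {ρ ρ' : ℕ → ℤ → Prop} (h : ∀ p u, ρ p u → ρ' p u) (l : List (ℕ × ℤ)) (u : ℤ)
    (hl : pathR ρ u l) : pathR ρ' u l := by
  induction l generalizing u with
  | nil => trivial
  | cons a t ih => exact ⟨h _ _ hl.1, ih _ hl.2⟩

theorem YR_mono {P : Finset ℕ} {g : ℕ} {ρ ρ' : ℕ → ℤ → Prop} (h : ∀ p u, ρ p u → ρ' p u) (u : ℤ)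
    (hl : YR P g ρ u) : YR P g ρ' u := by
  obtain ⟨q, h1, h2, h3⟩ := hl
  exact ⟨q, h1, h _ _ h2, pathR_mono h _ _ h3⟩

def realW (ρ : ℕ → ℤ → Prop) : ℤ → List ℤ → Prop
  | _, [] => True
  | u, d :: w => ρ d.natAbs u ∧ realW ρ (u + d) w

def goodW (G : ℤ → Prop) : ℤ → List ℤ → Prop
  | u, [] => G u
  | u, d :: w => G u ∧ goodW G (u + d) w

theorem goodW_head {G : ℤ → Prop} {u : ℤ} {w : List ℤ} (h : goodW G u w) : G u := by
  cases w with
  | nil => exact h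
  | cons d w => exact h.1

structure RhoOK (ρ : ℕ → ℤ → Prop) : Prop where
  h1 : ∀ p u v, ρ p u → (p : ℤ) ∣ v - u → ρ p v
  h2 : ∀ p u v, ρ p u → ρ p v → (p : ℤ) ∣ v - u

theorem sign_facts (d : ℤ) (hd : d ≠ 0) : d.sign ≠ 0 ∧ 0 < d.sign * d ∧ d.sign.natAbs = 1 ∧
    d.sign * (d.natAbs : ℤ) = d := by
  rcases lt_or_gt_of_ne hd with h | h
  · rw [Int.sign_eq_neg_one_of_neg h]; refine ⟨by norm_num, by linarith, by rfl, by omega⟩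
  · rw [Int.sign_eq_one_of_pos h]; refine ⟨by norm_num, by linarith, by rfl, by omega⟩

theorem runs_exist (P : Finset ℕ) (hP : ∀ p ∈ P, 0 < p) (g : ℕ) (ρ : ℕ → ℤ → Prop) (hρ : RhoOK ρ)
    (w : List ℤ) (d u : ℤ) (hd : d.natAbs ∈ P) (hw : ∀ e ∈ w, e.natAbs ∈ P) (hnb : nb d w)
    (hr : realW ρ u (d :: w)) (hg : goodW (fun u => ¬ YR P g ρ u) u (d :: w))
    (hl : (d :: w).length ≤ g) :
    ∃ (c : ℤ) (t : List (ℕ × ℤ)), c ≠ 0 ∧ 0 < c * d ∧ c.natAbs + t.length ≤ (d :: w).length ∧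
      (∀ a ∈ t, a.1 ∈ P ∧ a.2 ≠ 0 ∧ |a.2| ≤ g) ∧ (d.natAbs :: t.map Prod.fst).Nodup ∧
      pathR ρ u ((d.natAbs, c) :: t) ∧ ¬ YR P g ρ (u + c * d.natAbs) ∧
      (t = [] ∨ (lastS d w).natAbs ∈ t.map Prod.fst) ∧ (t = [] → ∀ e ∈ w, e = d) := by
  induction w generalizing d u with
  | nil =>
    have hd0 : d ≠ 0 := by have := hP _ hd; omega
    obtain ⟨s1, s2, s3, s4⟩ := sign_facts d hd0
    refine ⟨d.sign, [], s1, s2, ?_, by simp, by simp, ⟨hr.1, trivial⟩, ?_, Or.inl rfl, by simp⟩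
    · simp; omega
    · rw [s4]; exact hg.2
  | cons e w ih =>
    have hd0 : d ≠ 0 := by have := hP _ hd; omega
    obtain ⟨s1, s2, s3, s4⟩ := sign_facts d hd0
    have he : e.natAbs ∈ P := hw e (by simp)
    have hpd : (0:ℤ) < d.natAbs := by exact_mod_cast hP _ hd
    obtain ⟨c, t, c1, c2, c3, c4, c5, c6, c7, c8, c9⟩ := ih e (u + d) he
      (fun x hx => hw x (by simp [hx])) hnb.2 hr.2 hg.2 (by simp at hl ⊢; omega)
    have hcl : c.natAbs ≤ g := by simp at hl c3; omega
    have hpos1 : 1 ≤ c.natAbs := by omega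
    by_cases hde : d.natAbs = e.natAbs
    · have hde' : d = e := by
        rcases Int.natAbs_eq_natAbs_iff.1 hde with h | h
        · exact h
        · exact absurd (by omega : e = -d) hnb.1
      subst hde'
      refine ⟨c + d.sign, t, ?_, ?_, ?_, c4, c5, ⟨hr.1, ?_⟩, ?_, ?_, ?_⟩
      · intro h
        have : (c + d.sign) * d = 0 := by rw [h]; simp
        nlinarith
      · nlinarith
      · have := Int.natAbs_add_le c d.sign
        simp at c3 ⊢; omega
      · have h := c6.2
        simp only at h ⊢
        have e1 : u + (c + d.sign) * (d.natAbs : ℤ) = u + d + c * d.natAbs := by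
          rw [add_mul, s4]; ring
        rw [e1]; exact h
      · have e1 : u + (c + d.sign) * (d.natAbs : ℤ) = u + d + c * d.natAbs := by
          rw [add_mul, s4]; ring
        rw [e1]; exact c7
      · exact c8
      · intro h x hx
        rcases List.mem_cons.1 hx with rfl | hx
        · rfl
        · exact c9 h x hx
    · have hnot : d.natAbs ∉ t.map Prod.fst := by
        intro hmem
        obtain ⟨⟨p, c2'⟩, hm, hpe⟩ := List.mem_map.1 hmem
        simp only at hpe
        obtain ⟨mid, l2, rfl⟩ := List.append_of_mem hm
        have hlen : mid.length + 1 ≤ g := by simp at c3 hl; omega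
        have hdn : (d.natAbs : ℤ) ∣ d := Int.natAbs_dvd.2 dvd_rfl
        have hρ1 : ρ p (u + d) := by rw [hpe]; exact hρ.h1 _ _ _ hr.1 (by simpa using hdn)
        have hpath := c6.2
        simp only at hpath
        rw [pathR_append] at hpath
        have hρ2 := hpath.2.1
        simp only at hρ2
        have hnd : (mid.map Prod.fst).Nodup ∧ e.natAbs ∉ mid.map Prod.fst ∧ p ∉ mid.map Prod.fst := by
          simp only [List.map_append, List.map_cons, List.nodup_cons, List.nodup_append,
            List.mem_append, not_or, List.mem_cons] at c5
          refine ⟨c5.2.1, c5.1.1, ?_⟩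
          intro h
          exact c5.2.2.2 p h p (Or.inl rfl) rfl
        have hlet : ∀ a ∈ mid, a.1 ∈ P ∧ a.2 ≠ 0 ∧ |a.2| ≤ g := fun a ha => c4 a (by simp [ha])
        have heg : |c| ≤ (g:ℤ) := by rw [Int.abs_eq_natAbs]; exact_mod_cast hcl
        by_cases hF : c * e.natAbs + runSum mid = 0
        · -- witness (e.natAbs, mid)
          apply c7
          have he0 : (0:ℤ) < e.natAbs := by exact_mod_cast hP _ he
          have hre : runSum mid = -(c * e.natAbs) := by linarith
          refine ⟨(e.natAbs, mid), ⟨he, by simp; omega, hlet, hnd.1, hnd.2.1, ?_, ?_⟩, ?_, hpath.1⟩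
          · simp only [hre]
            intro h
            rw [neg_eq_zero, mul_eq_zero] at h
            rcases h with h | h
            · exact c1 h
            · omega
          · simp only [hre]; exact (Dvd.intro_left _ rfl : (e.natAbs:ℤ) ∣ c * e.natAbs).neg_right
          · exact hρ.h1 _ _ _ c6.1 (by simp)
        · apply goodW_head hg.2
          refine ⟨(p, (e.natAbs, c) :: mid), ⟨by rw [hpe]; exact hd, by simpa using hlen, ?_, ?_, ?_, ?_, ?_⟩, hρ1, c6.1, hpath.1⟩
          · intro a ha
            rcases List.mem_cons.1 ha with rfl | ha
            · exact ⟨he, c1, heg⟩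
            · exact hlet a ha
          · simp only [List.map_cons, List.nodup_cons]; exact ⟨hnd.2.1, hnd.1⟩
          · simp only [List.map_cons, List.mem_cons, not_or]
            exact ⟨by rw [hpe]; exact hde, hnd.2.2⟩
          · simp only [runSum_cons]; exact hF
          · simp only [runSum_cons]
            have := hρ.h2 _ _ _ hρ1 hρ2
            convert this using 1; ring
      refine ⟨d.sign, (e.natAbs, c) :: t, s1, s2, ?_, ?_, ?_, ?_, ?_, ?_, ?_⟩
      · simp at c3 ⊢; omega
      · intro a ha
        rcases List.mem_cons.1 ha with rfl | ha
        · exact ⟨he, c1, by rw [Int.abs_eq_natAbs]; exact_mod_cast hcl⟩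
        · exact c4 a ha
      · rw [List.nodup_cons]
        refine ⟨?_, c5⟩
        simp only [List.map_cons, List.mem_cons, not_or]
        exact ⟨hde, hnot⟩
      · refine ⟨hr.1, ?_⟩
        simp only [s4]; exact c6
      · rw [s4]; exact goodW_head hg.2
      · right
        rcases c8 with h | h
        · have hall := c9 h
          have : lastS d (e :: w) = e := by
            simp only [lastS]
            clear * - hall
            induction w with
            | nil => rfl
            | cons x w ih =>
              have hx := hall x (by simp)
              subst hx
              exact ih (fun y hy => hall y (by simp [hy]))
          rw [this]; simp
        · simp only [lastS, List.map_cons]; exact List.mem_cons_of_mem _ h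
      · intro h; simp at h

theorem LR (P : Finset ℕ) (hP : ∀ p ∈ P, 0 < p) (g : ℕ) (ρ : ℕ → ℤ → Prop) (hρ : RhoOK ρ)
    (w : List ℤ) (d u : ℤ) (hd : d.natAbs ∈ P) (hw : ∀ e ∈ w, e.natAbs ∈ P) (hnb : nb d w)
    (hr : realW ρ u (d :: w)) (hg : goodW (fun u => ¬ YR P g ρ u) u (d :: w))
    (hl : (d :: w).length ≤ g) (hlast : (lastS d w).natAbs = d.natAbs) : ∀ e ∈ w, e = d := by
  obtain ⟨c, t, c1, c2, c3, c4, c5, c6, c7, c8, c9⟩ := runs_exist P hP g ρ hρ w d u hd hw hnb hr hg hl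
  rcases c8 with h | h
  · exact c9 h
  · rw [hlast] at h; exact absurd h (List.nodup_cons.1 c5).1
end PartTwo

section PartTwoB
open scoped Classical

def revP (w : List ℤ) : List ℤ := (w.map fun d => -d).reverse

theorem revP_cons (d : ℤ) (w : List ℤ) : revP (d :: w) = revP w ++ [-d] := by simp [revP]

theorem realW_rev (ρ : ℕ → ℤ → Prop) (hρ : RhoOK ρ) (w z : List ℤ) (u : ℤ) (h1 : realW ρ u w)
    (h2 : realW ρ u z) : realW ρ (u + w.sum) (revP w ++ z) := by
  induction w generalizing u z with
  | nil => simpa [revP] using h2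
  | cons d w ih =>
    rw [revP_cons, List.append_assoc, List.sum_cons, ← add_assoc]
    apply ih _ _ h1.2
    refine ⟨?_, ?_⟩
    · rw [Int.natAbs_neg]
      exact hρ.h1 _ _ _ h1.1 (by simpa using Int.natAbs_dvd.2 (dvd_refl d))
    · have : u + d + -d = u := by ring
      rw [this]; exact h2

theorem goodW_rev (G : ℤ → Prop) (w z : List ℤ) (u : ℤ) (h1 : goodW G u w)
    (h2 : goodW G u z) : goodW G (u + w.sum) (revP w ++ z) := by
  induction w generalizing u z with
  | nil => simpa [revP] using h2
  | cons d w ih =>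
    rw [revP_cons, List.append_assoc, List.sum_cons, ← add_assoc]
    apply ih _ _ h1.2
    refine ⟨goodW_head h1.2, ?_⟩
    have : u + d + -d = u := by ring
    change goodW G (u + d + -d) z
    rw [this]; exact h2

theorem nb_iff (e : ℤ) (w : List ℤ) : nb e w ↔ List.IsChain (fun x y => y ≠ -x) (e :: w) := by
  induction w generalizing e with
  | nil => simp [nb]
  | cons d w ih => rw [nb, ih, List.isChain_cons_cons]

theorem revP_head (d : ℤ) (w : List ℤ) : ∃ r, revP (d :: w) = -(lastS d w) :: r := by
  induction w generalizing d with
  | nil => exact ⟨[], rfl⟩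
  | cons e w ih =>
    obtain ⟨r, hr⟩ := ih e
    rw [revP_cons, hr]
    exact ⟨r ++ [-d], rfl⟩

theorem lastS_append (x b : ℤ) (r w : List ℤ) : lastS x (r ++ b :: w) = lastS b w := by
  induction r generalizing x with
  | nil => rfl
  | cons c r ih => exact ih c

theorem lastS_mem (b : ℤ) (w : List ℤ) : lastS b w ∈ b :: w := by
  induction w generalizing b with
  | nil => simp [lastS]
  | cons c w ih => exact List.mem_cons_of_mem _ (ih c)

theorem nb_rev (e a b : ℤ) (α β : List ℤ) (hab : a ≠ b) (h1 : nb e (a :: α)) (h2 : nb e (b :: β)) :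
    List.IsChain (fun x y : ℤ => y ≠ -x) (revP (a :: α) ++ b :: β) := by
  rw [List.isChain_append]
  refine ⟨?_, (nb_iff _ _).1 h2.2, ?_⟩
  · have := (nb_iff _ _).1 h1.2
    rw [revP, List.isChain_reverse, List.isChain_map]
    refine this.imp ?_
    intro x y h; simp only [neg_neg]; intro h'; apply h; omega
  · intro x hx y hy
    rw [revP_cons] at hx
    simp at hx hy
    subst hx hy
    simp only [neg_neg]
    exact fun h => hab h.symm

theorem path_inj (P : Finset ℕ) (hP : ∀ p ∈ P, 0 < p) (g : ℕ) (ρ : ℕ → ℤ → Prop) (hρ : RhoOK ρ)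
    (α β : List ℤ) (e u : ℤ) (hlen : α.length = β.length) (hg : 2 * α.length ≤ g)
    (hα : ∀ d ∈ α, d.natAbs ∈ P) (hβ : ∀ d ∈ β, d.natAbs ∈ P)
    (nα : nb e α) (nβ : nb e β) (rα : realW ρ u α) (rβ : realW ρ u β)
    (gα : goodW (fun u => ¬ YR P g ρ u) u α) (gβ : goodW (fun u => ¬ YR P g ρ u) u β)
    (hl : lastS e α = lastS e β) : α = β := by
  induction α generalizing β e u with
  | nil => simp at hlen; exact (List.eq_nil_of_length_eq_zero hlen.symm).symm
  | cons a α ih =>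
    cases β with
    | nil => simp at hlen
    | cons b β =>
      by_cases hab : a = b
      · subst hab
        rw [ih β a (u + a) (by simpa using hlen) (by simp at hg ⊢; omega)
          (fun d hd => hα d (by simp [hd])) (fun d hd => hβ d (by simp [hd])) nα.2 nβ.2 rα.2 rβ.2
          gα.2 gβ.2 hl]
      · exfalso
        simp only [lastS] at hl
        have c1 := nb_rev e a b α β hab nα nβ
        have c2 := realW_rev ρ hρ (a :: α) (b :: β) u rα rβ
        have c3 := goodW_rev _ (a :: α) (b :: β) u gα gβ
        have c4 : (revP (a :: α) ++ b :: β).length ≤ g := by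
          simp [revP] at hlen hg ⊢; omega
        have c5 : ∀ d ∈ revP (a :: α) ++ b :: β, d.natAbs ∈ P := by
          intro d hd
          rw [List.mem_append] at hd
          rcases hd with hd | hd
          · simp only [revP, List.mem_reverse, List.mem_map] at hd
            obtain ⟨x, hx, rfl⟩ := hd
            rw [Int.natAbs_neg]; exact hα x hx
          · exact hβ d hd
        obtain ⟨r, hr⟩ := revP_head a α
        rw [hr, List.cons_append] at c1 c2 c3 c4 c5
        have := LR P hP g ρ hρ (r ++ b :: β) (-(lastS a α)) _ (c5 _ (by simp))
          (fun d hd => c5 d (by simp only [List.mem_cons]; exact Or.inr hd)) ((nb_iff _ _).2 c1) c2 c3 c4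
          (by rw [lastS_append, Int.natAbs_neg, hl])
        have h1 := this (lastS b β) (List.mem_append_right _ (lastS_mem b β))
        rw [hl] at h1
        have h2 := hP _ (hβ _ (lastS_mem b β))
        omega

theorem realW_mem {ρ : ℕ → ℤ → Prop} {K : Finset ℕ} (hK : ∀ p u, ρ p u → p ∈ K) {w : List ℤ} {u : ℤ}
    (h : realW ρ u w) : ∀ d ∈ w, d.natAbs ∈ K := by
  induction w generalizing u with
  | nil => simp
  | cons d w ih =>
    intro x hx
    rcases List.mem_cons.1 hx with rfl | hx
    · exact hK _ _ h.1
    · exact ih h.2 x hx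

/-- the paths along known lines -/
noncomputable def cpaths (P : Finset ℕ) (g : ℕ) (ρ : ℕ → ℤ → Prop) (D : Finset ℤ) (i : ℕ) (u e : ℤ) :
    Finset (List ℤ) :=
  (words D i).filter fun w => nb e w ∧ realW ρ u w ∧ goodW (fun u => ¬ YR P g ρ u) u w

theorem card_cpaths (P : Finset ℕ) (hP : ∀ p ∈ P, 0 < p) (g : ℕ) (ρ : ℕ → ℤ → Prop) (hρ : RhoOK ρ)
    (D : Finset ℤ) (hD : ∀ d ∈ D, d.natAbs ∈ P) (K : Finset ℕ) (hK : ∀ p u, ρ p u → p ∈ K)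
    (i : ℕ) (hi : 1 ≤ i) (hig : 2 * i ≤ g) (u e : ℤ) :
    (cpaths P g ρ D i u e).card ≤ 2 * K.card := by
  have h1 : (cpaths P g ρ D i u e).card ≤
      (K.image (fun p : ℕ => (p : ℤ)) ∪ K.image (fun p : ℕ => -(p : ℤ))).card := by
    refine Finset.card_le_card_of_injOn (lastS e) ?_ ?_
    · intro w hw
      simp only [cpaths, Finset.coe_filter, Set.mem_ofPred_eq, mem_words] at hw
      cases w with
      | nil => simp at hw; omega
      | cons d w =>
        have := realW_mem hK hw.2.2.1 _ (lastS_mem d w)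
        simp only [lastS, Finset.mem_coe, Finset.mem_union, Finset.mem_image]
        rcases Int.natAbs_eq (lastS d w) with h | h
        · exact Or.inl ⟨_, this, h.symm⟩
        · exact Or.inr ⟨_, this, h.symm⟩
    · intro α hα β hβ h
      simp only [cpaths, Finset.coe_filter, Set.mem_ofPred_eq, mem_words] at hα hβ
      exact path_inj P hP g ρ hρ α β e u (by rw [hα.1.1, hβ.1.1]) (by rw [hα.1.1]; exact hig)
        (fun d hd => hD d (hα.1.2 d hd)) (fun d hd => hD d (hβ.1.2 d hd)) hα.2.1 hβ.2.1 hα.2.2.1 hβ.2.2.1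
        hα.2.2.2 hβ.2.2.2 h
  refine h1.trans ((Finset.card_union_le _ _).trans ?_)
  have := Finset.card_image_le (s := K) (f := fun p : ℕ => (p : ℤ))
  have := Finset.card_image_le (s := K) (f := fun p : ℕ => -(p : ℤ))
  omega
end PartTwoB

section PartThree
open scoped Classical

noncomputable def steps (P : Finset ℕ) : Finset ℤ :=
  P.image (fun p : ℕ => (p : ℤ)) ∪ P.image (fun p : ℕ => -(p : ℤ))

theorem mem_steps {P : Finset ℕ} {d : ℤ} : d ∈ steps P ↔ d.natAbs ∈ P := by
  simp only [steps, Finset.mem_union, Finset.mem_image]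
  constructor
  · rintro (⟨p, hp, rfl⟩ | ⟨p, hp, rfl⟩) <;> simpa using hp
  · intro h
    rcases Int.natAbs_eq d with h' | h'
    · exact Or.inl ⟨_, h, h'.symm⟩
    · exact Or.inr ⟨_, h, h'.symm⟩

theorem sum_steps {P : Finset ℕ} (hP : ∀ p ∈ P, 0 < p) (f : ℤ → ℝ) :
    ∑ d ∈ steps P, f d = ∑ p ∈ P, (f p + f (-(p:ℤ))) := by
  rw [steps, Finset.sum_union, Finset.sum_image, Finset.sum_image, Finset.sum_add_distrib]
  · intro a _ b _ h; simpa using h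
  · intro a _ b _ h; simpa using h
  · rw [Finset.disjoint_left]
    intro x hx hy
    simp only [Finset.mem_image] at hx hy
    obtain ⟨a, ha, rfl⟩ := hx
    obtain ⟨b, hb, h⟩ := hy
    have := hP a ha; omega

def rhoS (K : Finset ℕ) (off : ℕ → ℤ) (p : ℕ) (u : ℤ) : Prop := p ∈ K ∧ (p : ℤ) ∣ u - off p

theorem rhoS_ok (K : Finset ℕ) (off : ℕ → ℤ) : RhoOK (rhoS K off) where
  h1 p u v h hd := ⟨h.1, by
    rw [show v - off p = (u - off p) + (v - u) by ring]; exact dvd_add h.2 hd⟩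
  h2 p u v h h' := by
    rw [show v - u = (v - off p) - (u - off p) by ring]; exact dvd_sub h'.2 h.2

noncomputable def fw (L : ℝ) (seen : Finset ℕ) (p : ℕ) : ℝ := (if p ∈ seen then 1 else 1 / L) / p

variable (P : Finset ℕ) (g : ℕ) (L : ℝ) (G : Finset ℕ → (ℕ → ℤ) → Finset ℕ → ℝ)

noncomputable def Zf : ℕ → ℤ → ℤ → Finset ℕ → (ℕ → ℤ) → Finset ℕ → ℝ
  | 0, pos, _, K, off, seen => if YR P g (rhoS K off) pos then 0 else G K off seen
  | j + 1, pos, e, K, off, seen => if YR P g (rhoS K off) pos then 0 else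
      ∑ d ∈ steps P, if d = -e then 0 else
        (fw L seen d.natAbs * Zf j (pos + d) d K off (insert d.natAbs seen)
        + if d.natAbs ∈ K then
            (if rhoS K off d.natAbs pos then Zf j (pos + d) d K off (insert d.natAbs seen) else 0)
          else fw L seen d.natAbs * Zf j (pos + d) d (insert d.natAbs K)
            (Function.update off d.natAbs pos) (insert d.natAbs seen))

noncomputable def ZN : ℕ → ℤ → ℤ → Finset ℕ → (ℕ → ℤ) → Finset ℕ → ℝ
  | 0, _, _, K, off, seen => G K off seen
  | j + 1, pos, e, K, off, seen =>
      ∑ d ∈ steps P, if d = -e then 0 else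
        (fw L seen d.natAbs * Zf P g L G j (pos + d) d K off (insert d.natAbs seen)
        + if d.natAbs ∈ K then 0
          else fw L seen d.natAbs * Zf P g L G j (pos + d) d (insert d.natAbs K)
            (Function.update off d.natAbs pos) (insert d.natAbs seen))

theorem fw_nonneg {L : ℝ} (hL : 0 ≤ L) (seen : Finset ℕ) (p : ℕ) : 0 ≤ fw L seen p := by
  unfold fw; split_ifs <;> positivity

theorem Zf_nonneg (hL : 0 ≤ L) (hG : ∀ K off seen, 0 ≤ G K off seen) (j : ℕ) (pos e : ℤ) (K : Finset ℕ)
    (off : ℕ → ℤ) (seen : Finset ℕ) : 0 ≤ Zf P g L G j pos e K off seen := by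
  induction j generalizing pos e K off seen with
  | zero => simp only [Zf]; split_ifs; exacts [le_rfl, hG _ _ _]
  | succ j ih =>
    simp only [Zf]
    split_ifs
    · exact le_rfl
    refine Finset.sum_nonneg fun d _ => ?_
    have := fw_nonneg hL seen d.natAbs
    split_ifs
    · exact le_rfl
    · exact add_nonneg (mul_nonneg this (ih _ _ _ _ _)) (ih _ _ _ _ _)
    · exact add_nonneg (mul_nonneg this (ih _ _ _ _ _)) le_rfl
    · exact add_nonneg (mul_nonneg this (ih _ _ _ _ _)) (mul_nonneg this (ih _ _ _ _ _))

theorem Zf_bad (j : ℕ) (pos e : ℤ) (K : Finset ℕ) (off : ℕ → ℤ) (seen : Finset ℕ)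
    (h : YR P g (rhoS K off) pos) : Zf P g L G j pos e K off seen = 0 := by
  cases j <;> simp [Zf, h]

theorem Zf_split (j : ℕ) (pos e : ℤ) (K : Finset ℕ) (off : ℕ → ℤ) (seen : Finset ℕ) (hK : K ⊆ seen)
    (h : ¬ YR P g (rhoS K off) pos) : Zf P g L G (j + 1) pos e K off seen =
      ZN P g L G (j + 1) pos e K off seen + ∑ d ∈ steps P,
        if d ≠ -e ∧ rhoS K off d.natAbs pos then Zf P g L G j (pos + d) d K off seen else 0 := by
  simp only [Zf, ZN, h, if_false]
  rw [← Finset.sum_add_distrib]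
  refine Finset.sum_congr rfl fun d _ => ?_
  by_cases h1 : d = -e
  · simp [h1]
  · by_cases h2 : d.natAbs ∈ K
    · rw [Finset.insert_eq_of_mem (hK h2)]
      simp [h1, h2]
    · have : ¬ rhoS K off d.natAbs pos := fun h => h2 h.1
      simp [h1, h2, this]

theorem cp_zero (ρ : ℕ → ℤ → Prop) (D : Finset ℤ) (u e : ℤ) (h : ¬ YR P g ρ u) :
    (cpaths P g ρ D 0 u e).card = 1 := by
  rw [Finset.card_eq_one]
  refine ⟨[], ?_⟩
  ext w
  simp only [cpaths, words, Finset.mem_filter, Finset.mem_singleton]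
  constructor
  · exact fun h => h.1
  · rintro rfl; exact ⟨rfl, trivial, trivial, h⟩

theorem cp_succ (ρ : ℕ → ℤ → Prop) (D : Finset ℤ) (i : ℕ) (u e : ℤ) (h : ¬ YR P g ρ u) :
    ((cpaths P g ρ D (i + 1) u e).card : ℝ) = ∑ d ∈ D,
      if d ≠ -e ∧ ρ d.natAbs u then ((cpaths P g ρ D i (u + d) d).card : ℝ) else 0 := by
  have hc : ∀ i u e, ((cpaths P g ρ D i u e).card : ℝ) = ∑ w ∈ words D i,
      if nb e w ∧ realW ρ u w ∧ goodW (fun u => ¬ YR P g ρ u) u w then 1 else 0 := by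
    intro i u e; rw [cpaths, Finset.card_filter]; push_cast; rfl
  rw [hc, sum_words_succ]
  refine Finset.sum_congr rfl fun d _ => ?_
  by_cases h1 : d ≠ -e ∧ ρ d.natAbs u
  · rw [if_pos h1, hc]
    refine Finset.sum_congr rfl fun w _ => ?_
    simp only [nb, realW, goodW, h1.1, h1.2, h, true_and, not_false_eq_true, ne_eq]
  · rw [if_neg h1]
    refine Finset.sum_eq_zero fun w _ => ?_
    rw [if_neg]
    rintro ⟨a, b, c⟩
    exact h1 ⟨a.1, b.1⟩

/-- unrolling along known lines -/
theorem Zf_unroll (K : Finset ℕ) (off : ℕ → ℤ) (seen : Finset ℕ) (hK : K ⊆ seen) (Γ Zs : ℝ)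
    (m j : ℕ) (hm : m ≤ j)
    (hN : ∀ i, j < i + m → i ≤ j → ∀ pos e, ZN P g L G i pos e K off seen ≤ 8 ^ i * Γ)
    (hs : ∀ pos e, Zf P g L G (j - m) pos e K off seen ≤ Zs) (pos e : ℤ) :
    Zf P g L G j pos e K off seen ≤ ∑ i ∈ Finset.range m,
      ((cpaths P g (rhoS K off) (steps P) i pos e).card : ℝ) * (8 ^ (j - i) * Γ)
      + ((cpaths P g (rhoS K off) (steps P) m pos e).card : ℝ) * Zs := by
  induction m generalizing j pos e with
  | zero =>
    by_cases hb : YR P g (rhoS K off) pos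
    · rw [Zf_bad _ _ _ _ _ _ _ _ _ _ hb]
      have : (cpaths P g (rhoS K off) (steps P) 0 pos e) = ∅ := by
        rw [Finset.eq_empty_iff_forall_notMem]
        intro w hw
        simp only [cpaths, words, Finset.mem_filter, Finset.mem_singleton] at hw
        obtain ⟨rfl, _, _, h⟩ := hw
        exact h hb
      simp [this]
    · rw [cp_zero _ _ _ _ _ _ hb]
      simpa using hs pos e
  | succ m ih =>
    obtain ⟨j, rfl⟩ : ∃ j', j = j' + 1 := ⟨j - 1, by omega⟩
    by_cases hb : YR P g (rhoS K off) pos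
    · rw [Zf_bad _ _ _ _ _ _ _ _ _ _ hb]
      have : ∀ i, (cpaths P g (rhoS K off) (steps P) i pos e) = ∅ := by
        intro i
        rw [Finset.eq_empty_iff_forall_notMem]
        intro w hw
        simp only [cpaths, Finset.mem_filter] at hw
        exact goodW_head hw.2.2.2 hb
      simp [this]
    · rw [Zf_split _ _ _ _ _ _ _ _ _ _ hK hb, Finset.sum_range_succ', cp_zero _ _ _ _ _ _ hb]
      have h1 := hN (j + 1) (by omega) le_rfl pos e
      have h2 : ∑ d ∈ steps P, (if d ≠ -e ∧ rhoS K off d.natAbs pos then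
            Zf P g L G j (pos + d) d K off seen else 0) ≤
          ∑ d ∈ steps P, (if d ≠ -e ∧ rhoS K off d.natAbs pos then
            (∑ i ∈ Finset.range m,
              ((cpaths P g (rhoS K off) (steps P) i (pos + d) d).card : ℝ) * (8 ^ (j - i) * Γ)
              + ((cpaths P g (rhoS K off) (steps P) m (pos + d) d).card : ℝ) * Zs) else 0) := by
        refine Finset.sum_le_sum fun d _ => ?_
        split_ifs
        · refine ih j (by omega) (fun i h1 h2 => hN i (by omega) (by omega)) ?_ _ _
          intro pos e
          have := hs pos e
          rwa [Nat.add_sub_add_right] at this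
        · exact le_rfl
      have h3 : ∑ d ∈ steps P, (if d ≠ -e ∧ rhoS K off d.natAbs pos then
            (∑ i ∈ Finset.range m,
              ((cpaths P g (rhoS K off) (steps P) i (pos + d) d).card : ℝ) * (8 ^ (j - i) * Γ)
              + ((cpaths P g (rhoS K off) (steps P) m (pos + d) d).card : ℝ) * Zs) else 0) =
          ∑ i ∈ Finset.range m,
            ((cpaths P g (rhoS K off) (steps P) (i + 1) pos e).card : ℝ) * (8 ^ (j + 1 - (i + 1)) * Γ)
            + ((cpaths P g (rhoS K off) (steps P) (m + 1) pos e).card : ℝ) * Zs := by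
        simp only [cp_succ _ _ _ _ _ _ _ hb, Nat.add_sub_add_right, Finset.sum_mul]
        rw [Finset.sum_comm, ← Finset.sum_add_distrib]
        refine Finset.sum_congr rfl fun d _ => ?_
        split_ifs
        · rfl
        · simp
      rw [h3] at h2
      simp only [Nat.cast_one, one_mul, Nat.sub_zero]
      linarith
end PartThree

section PartThreeB
open scoped Classical

theorem straight (P : Finset ℕ) (hP : ∀ p ∈ P, 0 < p) (g : ℕ) (L : ℝ) (hL : 0 ≤ L)
    (G : Finset ℕ → (ℕ → ℤ) → Finset ℕ → ℝ) (hG0 : ∀ K off seen, 0 ≤ G K off seen)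
    (Γ : ℝ) (hΓ : 0 ≤ Γ) (K : Finset ℕ) (off : ℕ → ℤ) (seen : Finset ℕ) (hK : K ⊆ seen) (d : ℤ)
    (i : ℕ) (pos : ℤ)
    (hN : ∀ i' ≤ i, ∀ pos e, ZN P g L G i' pos e K off seen ≤ 8 ^ i' * Γ)
    (hs : ∀ p ∈ K, p ≠ d.natAbs → ∀ m : ℕ, m ≤ i → ¬ (p : ℤ) ∣ pos + m * d - off p) :
    Zf P g L G i pos d K off seen ≤ 8 / 7 * 8 ^ i * Γ := by
  induction i generalizing pos with
  | zero =>
    by_cases hb : YR P g (rhoS K off) pos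
    · rw [Zf_bad _ _ _ _ _ _ _ _ _ _ hb]; positivity
    · have := hN 0 le_rfl pos d
      simp only [ZN] at this
      simp only [Zf, hb, if_false]
      simp only [pow_zero] at *
      linarith
  | succ i ih =>
    by_cases hb : YR P g (rhoS K off) pos
    · rw [Zf_bad _ _ _ _ _ _ _ _ _ _ hb]; positivity
    · rw [Zf_split _ _ _ _ _ _ _ _ _ _ hK hb]
      have h1 := hN (i+1) le_rfl pos d
      have h2 := ih (pos + d) (fun i' hi' => hN i' (by omega)) (by
        intro p hp hpd m hm
        have := hs p hp hpd (m+1) (by omega)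
        push_cast at this
        rwa [show pos + ((m:ℤ) + 1) * d - off p = pos + d + m * d - off p by ring] at this)
      have h3 : ∑ d2 ∈ steps P, (if d2 ≠ -d ∧ rhoS K off d2.natAbs pos then
          Zf P g L G i (pos + d2) d2 K off seen else 0) ≤
          ∑ d2 ∈ steps P, if d2 = d then Zf P g L G i (pos + d) d K off seen else 0 := by
        refine Finset.sum_le_sum fun d2 hd2 => ?_
        have hz := Zf_nonneg P g L G hL hG0 i (pos + d) d K off seen
        by_cases hc : d2 ≠ -d ∧ rhoS K off d2.natAbs pos
        · rw [if_pos hc]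
          have : d2.natAbs = d.natAbs := by
            by_contra hne
            have := hs _ hc.2.1 hne 0 (by omega)
            apply this
            simpa using hc.2.2
          have : d2 = d := by
            rcases Int.natAbs_eq_natAbs_iff.1 this with h | h
            · exact h
            · exact absurd h hc.1
          subst this; simp
        · rw [if_neg hc]; split_ifs; exacts [hz, le_rfl]
      have h4 : ∑ d2 ∈ steps P, (if d2 = d then Zf P g L G i (pos + d) d K off seen else 0) ≤
          Zf P g L G i (pos + d) d K off seen := by
        rw [Finset.sum_ite_eq']
        split_ifs
        · exact le_rfl
        · exact Zf_nonneg P g L G hL hG0 i (pos + d) d K off seen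
      rw [pow_succ] at *
      nlinarith

/-- hypotheses bundle for Case A -/
structure CA (P : Finset ℕ) (g h k2 : ℕ) (L H0 B ε : ℝ) : Prop where
  hP : ∀ p ∈ P, 0 < p
  hL : 1 ≤ L
  hsum : ∑ p ∈ P, 1 / (p : ℝ) = L
  hH0 : 0 < H0
  hp : ∀ p ∈ P, H0 ≤ (p : ℝ)
  hB : 2 * (k2 : ℝ) ≤ B
  hB1 : 1 ≤ B
  hg : g = 2 * h
  hh : 1 ≤ h
  h8 : 2 * B ≤ 8 ^ h
  hε0 : 0 ≤ ε
  hε : ∀ p ∈ P, ∀ b m : ℤ, m ≠ 0 → m.natAbs ≤ k2 →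
    ∑ q ∈ P.filter (fun q => q ≠ p ∧ (p : ℤ) ∣ b + m * q), 1 / (q : ℝ) ≤ ε
  hsmall : (4 * k2 / H0 + 4 * k2 ^ 2 * ε) * (3 * B) ≤ 3

theorem turn_sum {P : Finset ℕ} {g h k2 : ℕ} {L H0 B ε : ℝ} (c : CA P g h k2 L H0 B ε)
    (K : Finset ℕ) (hK : K ⊆ P) (hKc : K.card ≤ k2) (off : ℕ → ℤ) (pos : ℤ) :
    ∑ d ∈ (steps P).filter (fun d => d.natAbs ∉ K ∧ ∃ m ∈ Finset.Icc 1 k2, ∃ p ∈ K,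
      (p : ℤ) ∣ pos + (m : ℤ) * d - off p), 1 / (d.natAbs : ℝ) ≤ 2 * k2 ^ 2 * ε := by
  have h1 : ∑ d ∈ (steps P).filter (fun d => d.natAbs ∉ K ∧ ∃ m ∈ Finset.Icc 1 k2, ∃ p ∈ K,
      (p : ℤ) ∣ pos + (m : ℤ) * d - off p), 1 / (d.natAbs : ℝ) ≤
      ∑ m ∈ Finset.Icc 1 k2, ∑ p ∈ K, ∑ d ∈ steps P,
        if d.natAbs ≠ p ∧ (p : ℤ) ∣ pos + (m : ℤ) * d - off p then 1 / (d.natAbs : ℝ) else 0 := by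
    rw [Finset.sum_filter]
    simp_rw [Finset.sum_comm (s := K)]
    rw [Finset.sum_comm]
    refine Finset.sum_le_sum fun d _ => ?_
    have hnn : ∀ m ∈ Finset.Icc 1 k2, 0 ≤ ∑ p ∈ K, 
        if d.natAbs ≠ p ∧ (p : ℤ) ∣ pos + (m : ℤ) * d - off p then 1 / (d.natAbs : ℝ) else 0 := by
      intro m _; refine Finset.sum_nonneg fun p _ => ?_; split_ifs <;> positivity
    split_ifs with hc
    · obtain ⟨hdK, m, hm, p, hp, hdv⟩ := hc
      refine le_trans ?_ (Finset.single_le_sum hnn hm)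
      refine le_trans ?_ (Finset.single_le_sum (f := fun p => if d.natAbs ≠ p ∧ (p : ℤ) ∣ pos + (m : ℤ) * d - off p then 1 / (d.natAbs : ℝ) else 0) (fun p _ => by split_ifs <;> positivity) hp)
      rw [if_pos]
      exact ⟨fun h => hdK (h ▸ hp), hdv⟩
    · exact Finset.sum_nonneg hnn
  refine h1.trans ?_
  have h2 : ∀ m ∈ Finset.Icc 1 k2, ∀ p ∈ K, (∑ d ∈ steps P,
        if d.natAbs ≠ p ∧ (p : ℤ) ∣ pos + (m : ℤ) * d - off p then 1 / (d.natAbs : ℝ) else 0) ≤ 2 * ε := by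
    intro m hm p hp
    rw [Finset.mem_Icc] at hm
    rw [sum_steps c.hP]
    have e1 := c.hε p (hK hp) (pos - off p) m (by omega) (by omega)
    have e2 := c.hε p (hK hp) (pos - off p) (-m) (by omega) (by omega)
    rw [Finset.sum_filter] at e1 e2
    rw [Finset.sum_add_distrib]
    have : ∀ q : ℕ, (pos + (m:ℤ) * q - off p) = pos - off p + m * q := fun q => by ring
    have h' : ∀ q : ℕ, (pos + (m:ℤ) * (-(q:ℤ)) - off p) = pos - off p + (-m) * q := fun q => by ring
    simp only [Int.natAbs_neg, Int.natAbs_natCast, this, h']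
    linarith
  calc _ ≤ ∑ m ∈ Finset.Icc 1 k2, ∑ p ∈ K, 2 * ε :=
        Finset.sum_le_sum fun m hm => Finset.sum_le_sum fun p hp => h2 m hm p hp
    _ = k2 * (K.card * (2 * ε)) := by simp
    _ ≤ k2 * (k2 * (2 * ε)) := by
        have : (K.card : ℝ) ≤ k2 := by exact_mod_cast hKc
        have := c.hε0
        gcongr
    _ = _ := by ring

theorem caseA {P : Finset ℕ} {g h k2 : ℕ} {L H0 B ε : ℝ} (c : CA P g h k2 L H0 B ε)
    (G : Finset ℕ → (ℕ → ℤ) → Finset ℕ → ℝ) (hG0 : ∀ K off seen, 0 ≤ G K off seen)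
    (Γ : ℝ) (hΓ : 0 ≤ Γ) (hG : ∀ K off seen, K ⊆ seen → seen ⊆ P → seen.card ≤ k2 → G K off seen ≤ Γ)
    (j : ℕ) (pos e : ℤ) (K : Finset ℕ) (off : ℕ → ℤ) (seen : Finset ℕ) (hK : K ⊆ seen) (hs : seen ⊆ P)
    (hc : seen.card + j ≤ k2) :
    ZN P g L G j pos e K off seen ≤ 8 ^ j * Γ ∧
    Zf P g L G j pos e K off seen ≤ 3 * B * 8 ^ j * Γ := by
  induction j using Nat.strong_induction_on generalizing pos e K off seen with
  | _ j ih =>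
  have hL0 : 0 ≤ L := by linarith [c.hL]
  have hB1 := c.hB1
  have hZN : ZN P g L G j pos e K off seen ≤ 8 ^ j * Γ ∧
      ∀ pos e, ZN P g L G j pos e K off seen ≤ 8 ^ j * Γ := by
    refine (fun h => ⟨h pos e, h⟩) ?_
    clear pos e
    intro pos e
    cases j with
    | zero => simpa [ZN] using hG K off seen hK hs (by omega)
    | succ j =>
      have hZf0 := fun pos e K off seen => Zf_nonneg P g L G hL0 hG0 j pos e K off seen
      set T : ℤ → Prop := fun d => d.natAbs ∉ K ∧ ∃ m ∈ Finset.Icc 1 k2, ∃ p ∈ K,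
        (p : ℤ) ∣ pos + (m : ℤ) * d - off p with hT
      set Φ := 8 ^ j * Γ with hΦ
      have hΦ0 : 0 ≤ Φ := by positivity
      -- per-step bound
      have hstep : ∀ d ∈ steps P, (if d = -e then 0 else
        (fw L seen d.natAbs * Zf P g L G j (pos + d) d K off (insert d.natAbs seen)
        + if d.natAbs ∈ K then 0
          else fw L seen d.natAbs * Zf P g L G j (pos + d) d (insert d.natAbs K)
            (Function.update off d.natAbs pos) (insert d.natAbs seen))) ≤
          (if d.natAbs ∈ seen then 2 * (1 / H0) * (3 * B * Φ) else 0) +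
          2 * (1 / L) * (1 / (d.natAbs : ℝ)) * (8 / 7 * Φ) +
          2 * (1 / L) * (if T d then 1 / (d.natAbs : ℝ) else 0) * (3 * B * Φ) := by
        intro d hd
        have hdP := mem_steps.1 hd
        have hd0 : 0 < d.natAbs := c.hP _ hdP
        have hdr : (0 : ℝ) < d.natAbs := by exact_mod_cast hd0
        have hL1 := c.hL
        have hnn2 : 0 ≤ 2 * (1 / L) * (1 / (d.natAbs : ℝ)) * (8 / 7 * Φ) := by positivity
        have hnn3 : 0 ≤ 2 * (1 / L) * (if T d then 1 / (d.natAbs : ℝ) else 0) * (3 * B * Φ) := by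
          have : 0 ≤ (if T d then 1 / (d.natAbs : ℝ) else 0) := by split_ifs <;> positivity
          positivity
        have hH0 := c.hH0
        have hnn1 : 0 ≤ (if d.natAbs ∈ seen then 2 * (1 / H0) * (3 * B * Φ) else 0) := by
          split_ifs <;> positivity
        by_cases h1 : d = -e
        · rw [if_pos h1]; linarith
        rw [if_neg h1]
        by_cases h2 : d.natAbs ∈ seen
        · rw [if_pos h2, Finset.insert_eq_of_mem h2]
          have hfw : fw L seen d.natAbs ≤ 1 / H0 := by
            simp only [fw, h2, if_true]
            exact one_div_le_one_div_of_le hH0 (c.hp _ hdP)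
          have hfw0 := fw_nonneg hL0 seen d.natAbs
          have z1 := (ih j (by omega) (pos + d) d K off seen hK hs (by omega)).2
          have z2 := (ih j (by omega) (pos + d) d (insert d.natAbs K) (Function.update off d.natAbs pos)
            seen (Finset.insert_subset h2 hK) hs (by omega)).2
          rw [mul_assoc] at z1 z2
          have a1 := mul_le_mul hfw z1 (hZf0 _ _ _ _ _) (by positivity)
          have a2 := mul_le_mul hfw z2 (hZf0 _ _ _ _ _) (by positivity)
          have : (if d.natAbs ∈ K then 0 else fw L seen d.natAbs * Zf P g L G j (pos + d) d (insert d.natAbs K)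
              (Function.update off d.natAbs pos) seen) ≤ 1 / H0 * (3 * B * Φ) := by
            split_ifs
            · positivity
            · exact a2
          linarith
        · have h3 : d.natAbs ∉ K := fun h => h2 (hK h)
          rw [if_neg h2, if_neg h3]
          have hcard : (insert d.natAbs seen).card + j ≤ k2 := by
            rw [Finset.card_insert_of_notMem h2]; omega
          have hsub : insert d.natAbs seen ⊆ P := Finset.insert_subset hdP hs
          have hfw : fw L seen d.natAbs = 1 / L * (1 / (d.natAbs : ℝ)) := by
            simp only [fw, h2, if_false]; ring
          have hfwn : 0 ≤ 1 / L * (1 / (d.natAbs : ℝ)) := by positivity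
          have key : ∀ K' off', (K' = K ∧ off' = off ∨ K' = insert d.natAbs K ∧ off' = Function.update off d.natAbs pos) →
              Zf P g L G j (pos + d) d K' off' (insert d.natAbs seen) ≤
                8 / 7 * Φ + (if T d then 1 else 0) * (3 * B * Φ) := by
            intro K' off' hK'
            have hsubK : K' ⊆ insert d.natAbs seen := by
              rcases hK' with ⟨rfl, _⟩ | ⟨rfl, _⟩
              · exact hK.trans (Finset.subset_insert _ _)
              · exact Finset.insert_subset_insert _ hK
            by_cases hTd : T d
            · rw [if_pos hTd]
              have := (ih j (by omega) (pos + d) d K' off' _ hsubK hsub hcard).2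
              rw [mul_assoc] at this
              linarith
            · rw [if_neg hTd]
              have := straight P c.hP g L hL0 G hG0 Γ hΓ K' off' _ hsubK d j (pos + d)
                (fun i' hi' pos' e' => (ih i' (by omega) pos' e' K' off' _ hsubK hsub (by omega)).1) (by
                  intro p hp hpd m hm hdv
                  apply hTd
                  refine ⟨h3, m + 1, Finset.mem_Icc.2 ⟨by omega, by omega⟩, p, ?_⟩
                  have hpK : p ∈ K ∧ off' p = off p := by
                    rcases hK' with ⟨rfl, rfl⟩ | ⟨rfl, rfl⟩
                    · exact ⟨hp, rfl⟩
                    · exact ⟨Finset.mem_of_mem_insert_of_ne hp hpd, Function.update_of_ne hpd _ _⟩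
                  refine ⟨hpK.1, ?_⟩
                  rw [hpK.2] at hdv
                  push_cast
                  rwa [show pos + ((m:ℤ) + 1) * d - off p = pos + d + m * d - off p by ring])
              rw [mul_assoc] at this
              linarith
          have z1 := mul_le_mul_of_nonneg_left (key K off (Or.inl ⟨rfl, rfl⟩)) hfwn
          have z2 := mul_le_mul_of_nonneg_left (key _ _ (Or.inr ⟨rfl, rfl⟩)) hfwn
          rw [hfw]
          have e1 : (if T d then 1 / (d.natAbs : ℝ) else 0) = (1 / (d.natAbs : ℝ)) * (if T d then 1 else 0) := by
            split_ifs <;> simp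
          rw [e1]
          linarith
      have hsumle := Finset.sum_le_sum hstep
      simp only [ZN]
      refine hsumle.trans ?_
      rw [Finset.sum_add_distrib, Finset.sum_add_distrib]
      have s1 : ∑ d ∈ steps P, (if d.natAbs ∈ seen then 2 * (1 / H0) * (3 * B * Φ) else 0) ≤
          4 * k2 / H0 * (3 * B * Φ) := by
        have hH0 := c.hH0
        have hnn : 0 ≤ 2 * (1 / H0) * (3 * B * Φ) := by positivity
        rw [sum_steps c.hP, Finset.sum_add_distrib]
        simp only [Int.natAbs_neg, Int.natAbs_natCast]
        rw [← Finset.sum_filter, Finset.sum_const, nsmul_eq_mul]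
        have : ((P.filter (fun p => p ∈ seen)).card : ℝ) ≤ k2 := by
          have : (P.filter (fun p => p ∈ seen)).card ≤ seen.card :=
            Finset.card_le_card fun x hx => (Finset.mem_filter.1 hx).2
          exact_mod_cast (by omega : (P.filter (fun p => p ∈ seen)).card ≤ k2)
        have := mul_le_mul_of_nonneg_right this hnn
        calc _ ≤ 2 * (k2 * (2 * (1 / H0) * (3 * B * Φ))) := by linarith
          _ = _ := by ring
      have s2 : ∑ d ∈ steps P, 2 * (1 / L) * (1 / (d.natAbs : ℝ)) * (8 / 7 * Φ) = 32 / 7 * Φ := by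
        rw [sum_steps c.hP]
        simp only [Int.natAbs_neg, Int.natAbs_natCast]
        have : ∀ p : ℕ, (2 * (1 / L) * (1 / (p : ℝ)) * (8 / 7 * Φ) + 2 * (1 / L) * (1 / (p : ℝ)) * (8 / 7 * Φ)) =
          (4 * (1 / L) * (8 / 7 * Φ)) * (1 / (p:ℝ)) := fun p => by ring
        simp only [this]
        rw [← Finset.mul_sum, c.hsum]
        have := c.hL
        field_simp; ring
      have s3 : ∑ d ∈ steps P, 2 * (1 / L) * (if T d then 1 / (d.natAbs : ℝ) else 0) * (3 * B * Φ) ≤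
          4 * k2 ^ 2 * ε * (3 * B * Φ) := by
        rw [← Finset.sum_mul, ← Finset.mul_sum, ← Finset.sum_filter]
        have := turn_sum c K (hK.trans hs) ((Finset.card_le_card hK).trans (by omega)) off pos
        have hle : 1 / L ≤ 1 := by rw [div_le_one (by linarith [c.hL])]; exact c.hL
        have hnn : 0 ≤ 1 / L := by positivity
        have hε0 := c.hε0
        have : 2 * (1 / L) * ∑ d ∈ (steps P).filter T, 1 / (d.natAbs : ℝ) ≤ 2 * 1 * (2 * k2 ^ 2 * ε) := by
          gcongr
        have := mul_le_mul_of_nonneg_right this (by positivity : 0 ≤ 3 * B * Φ)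
        linarith
      rw [s2]
      have := mul_le_mul_of_nonneg_right c.hsmall hΦ0
      have e8 : (8:ℝ) ^ (j + 1) * Γ = 8 * Φ := by rw [hΦ]; ring
      rw [e8]
      linarith
  refine ⟨hZN.1, ?_⟩
  replace hZN := hZN.2
  have hcard : ∀ i, 1 ≤ i → i ≤ h → ((cpaths P g (rhoS K off) (steps P) i pos e).card : ℝ) ≤ B := by
    intro i hi hih
    have := card_cpaths P c.hP g (rhoS K off) (rhoS_ok K off) (steps P) (fun d hd => mem_steps.1 hd) K
      (fun p u h => h.1) i hi (by rw [c.hg]; omega) pos e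
    have h2 : (cpaths P g (rhoS K off) (steps P) i pos e).card ≤ 2 * k2 := by
      have := Finset.card_le_card hK; omega
    have : ((cpaths P g (rhoS K off) (steps P) i pos e).card : ℝ) ≤ 2 * k2 := by exact_mod_cast h2
    linarith [c.hB]
  have hNall : ∀ i ≤ j, ∀ pos e, ZN P g L G i pos e K off seen ≤ 8 ^ i * Γ := by
    intro i hi pos e
    rcases Nat.lt_or_ge i j with h' | h'
    · exact (ih i h' pos e K off seen hK hs (by omega)).1
    · have : i = j := by omega
      subst this; exact hZN pos e
  have hZ0 : ∀ pos e, Zf P g L G 0 pos e K off seen ≤ Γ := by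
    intro pos e
    simp only [Zf]
    split_ifs
    · exact hΓ
    · exact hG _ _ _ hK hs (by omega)
  -- partial sums
  have hpart : ∀ m, m ≤ j → m ≤ h + 1 → ∑ i ∈ Finset.range m,
      ((cpaths P g (rhoS K off) (steps P) i pos e).card : ℝ) * (8 ^ (j - i) * Γ) ≤
      (1 + B / 7) * 8 ^ j * Γ - B / 7 * 8 ^ (j + 1 - m) * Γ + (if m = 0 then B * 8 ^ (j+1) * Γ else 0) := by
    intro m hm hmh
    induction m with
    | zero =>
      simp only [Finset.range_zero, Finset.sum_empty, if_true, Nat.sub_zero, pow_succ]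
      have : 0 ≤ 8 ^ j * Γ := by positivity
      nlinarith
    | succ m ihm =>
      rw [Finset.sum_range_succ]
      rw [if_neg (by omega)]
      rcases Nat.eq_zero_or_pos m with rfl | hmp
      · have : ((cpaths P g (rhoS K off) (steps P) 0 pos e).card : ℝ) ≤ 1 := by
          have : (cpaths P g (rhoS K off) (steps P) 0 pos e).card ≤ 1 := by
            refine (Finset.card_filter_le _ _).trans ?_
            simp [words]
          exact_mod_cast this
        have h8 : 0 ≤ (8:ℝ) ^ j * Γ := by positivity
        have := mul_le_mul_of_nonneg_right this h8
        simp only [Finset.range_zero, Finset.sum_empty, Nat.sub_zero, zero_add, Nat.add_sub_cancel]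
        linarith
      · have i1 := ihm (by omega) (by omega)
        rw [if_neg (by omega)] at i1
        have := hcard m hmp (by omega)
        have h8 : 0 ≤ (8:ℝ) ^ (j - m) * Γ := by positivity
        have := mul_le_mul_of_nonneg_right this h8
        have e1 : j + 1 - m = (j - m) + 1 := by omega
        have e2 : j + 1 - (m + 1) = j - m := by omega
        rw [e1, pow_succ] at i1
        rw [e2]
        linarith
  rcases Nat.eq_zero_or_pos j with rfl | hj
  · have := hZ0 pos e
    simp only [pow_zero]
    nlinarith
  have h8j : 0 ≤ (8:ℝ) ^ j * Γ := by positivity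
  rcases le_or_gt j h with hjh | hjh
  · have u := Zf_unroll P g L G K off seen hK Γ Γ j j le_rfl (fun i _ hi => hNall i hi)
      (fun pos e => by simpa using hZ0 pos e) pos e
    have p1 := hpart j le_rfl (by omega)
    rw [if_neg (by omega)] at p1
    have := mul_le_mul_of_nonneg_right (hcard j hj hjh) hΓ
    have e2 : j + 1 - j = 1 := by omega
    rw [e2] at p1
    have : 0 ≤ B * Γ := by positivity
    nlinarith
  · have hh := c.hh
    have u := Zf_unroll P g L G K off seen hK Γ (3 * B * 8 ^ (j - h) * Γ) h j hjh.le
      (fun i _ hi => hNall i hi)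
      (fun pos e => (ih (j - h) (by omega) pos e K off seen hK hs (by omega)).2) pos e
    have p1 := hpart h hjh.le (by omega)
    rw [if_neg (by omega)] at p1
    have hX : 0 ≤ (8:ℝ) ^ (j - h) * Γ := by positivity
    have := mul_le_mul_of_nonneg_right (hcard h hh le_rfl) (by positivity : 0 ≤ 3 * B * 8 ^ (j - h) * Γ)
    have e3 : (8:ℝ) ^ j = 8 ^ h * 8 ^ (j - h) := by rw [← pow_add]; congr 1; omega
    have h8 := mul_le_mul_of_nonneg_right c.h8 hX
    have e4 : (8:ℝ) ^ h * (8 ^ (j - h) * Γ) = 8 ^ j * Γ := by rw [e3]; ring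
    rw [e4] at h8
    have h8' := mul_le_mul_of_nonneg_left h8 (by linarith : 0 ≤ 3 / 2 * B)
    have hn : 0 ≤ B / 7 * 8 ^ (j + 1 - h) * Γ := by positivity
    nlinarith
end PartThreeB

section PartThreeC
open scoped Classical

/-- the exceptional set -/
def Yb (P : Finset ℕ) (g : ℕ) (u : ℤ) : Prop := YR P g (fun p v => (p : ℤ) ∣ v) u

theorem pathR_shift (ρ : ℕ → ℤ → Prop) (n : ℤ) (l : List (ℕ × ℤ)) (u : ℤ) :
    pathR (fun p v => ρ p (n + v)) u l ↔ pathR ρ (n + u) l := by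
  induction l generalizing u with
  | nil => simp [pathR]
  | cons a l ih => simp only [pathR, ih, add_assoc]

theorem YR_shift (P : Finset ℕ) (g : ℕ) (ρ : ℕ → ℤ → Prop) (n : ℤ) (u : ℤ) :
    YR P g (fun p v => ρ p (n + v)) u ↔ YR P g ρ (n + u) := by
  simp only [YR, pathR_shift]

def primesOf (w : List ℤ) : Finset ℕ := (w.map Int.natAbs).toFinset

noncomputable def ye (u d : ℤ) : ℝ := (if ((d.natAbs : ℤ)) ∣ u then 1 else 0) + 1 / (d.natAbs : ℝ)

noncomputable def Rw (P : Finset ℕ) (g : ℕ) (Λ : ℤ → Finset ℕ → ℝ) :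
    ℕ → ℤ → ℤ → ℤ → Finset ℕ → ℝ
  | 0, n, pos, _, seen => if Yb P g (n + pos) then 0 else Λ n seen
  | j + 1, n, pos, e, seen => if Yb P g (n + pos) then 0 else
      ∑ d ∈ steps P, if d = -e then 0 else
        ye (n + pos) d * Rw P g Λ j n (pos + d) d (insert d.natAbs seen)

theorem ye_nonneg (u d : ℤ) : 0 ≤ ye u d := by unfold ye; split_ifs <;> positivity

theorem Rw_nonneg (P : Finset ℕ) (g : ℕ) (Λ : ℤ → Finset ℕ → ℝ) (hΛ : ∀ n s, 0 ≤ Λ n s)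
    (j : ℕ) (n pos e : ℤ) (seen : Finset ℕ) : 0 ≤ Rw P g Λ j n pos e seen := by
  induction j generalizing pos e seen with
  | zero => simp only [Rw]; split_ifs; exacts [le_rfl, hΛ _ _]
  | succ j ih =>
    simp only [Rw]
    split_ifs
    · exact le_rfl
    refine Finset.sum_nonneg fun d _ => ?_
    split_ifs
    · exact le_rfl
    · exact mul_nonneg (ye_nonneg _ _) (ih _ _ _)

theorem words_le_Rw (P : Finset ℕ) (g : ℕ) (Λ : ℤ → Finset ℕ → ℝ) (hΛ : ∀ n s, 0 ≤ Λ n s)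
    (x : ℤ → ℤ → ℝ) (hx : ∀ u, ∀ d ∈ steps P, |x u d| ≤ ye u d)
    (hxY : ∀ u d, x u d ≠ 0 → ¬ Yb P g u ∧ ¬ Yb P g (u + d))
    (j : ℕ) (n pos e : ℤ) (seen : Finset ℕ) (hg : ¬ Yb P g (n + pos)) :
    ∑ w ∈ words (steps P) j, (if nb e w then |Hw x (n + pos) w| * Λ n (seen ∪ primesOf w) else 0) ≤
      Rw P g Λ j n pos e seen := by
  induction j generalizing pos e seen with
  | zero => simp [sum_words_zero, nb, Hw, primesOf, Rw, hg]
  | succ j ih =>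
    rw [sum_words_succ]
    simp only [Rw, hg, if_false]
    refine Finset.sum_le_sum fun d hd => ?_
    by_cases h1 : d = -e
    · simp [nb, h1]
    simp only [nb, Hw, h1, if_false, ne_eq, not_false_eq_true, true_and, abs_mul]
    by_cases h2 : x (n + pos) d = 0
    · simp only [h2, abs_zero, zero_mul, ite_self, Finset.sum_const_zero]
      exact mul_nonneg (ye_nonneg _ _) (Rw_nonneg _ _ _ hΛ _ _ _ _ _)
    have h3 := ih (pos + d) d (insert d.natAbs seen) (by rw [← add_assoc]; exact (hxY _ _ h2).2)
    refine le_trans (le_of_eq ?_) (mul_le_mul (hx _ d hd) h3 ?_ (ye_nonneg _ _))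
    · rw [Finset.mul_sum]
      refine Finset.sum_congr rfl fun w _ => ?_
      have : seen ∪ primesOf (d :: w) = insert d.natAbs seen ∪ primesOf w := by
        ext; simp [primesOf]
      rw [this, add_assoc]
      split_ifs <;> ring
    · refine Finset.sum_nonneg fun w _ => ?_
      split_ifs
      · exact mul_nonneg (abs_nonneg _) (hΛ _ _)
      · exact le_rfl

theorem words_le_Rw' (P : Finset ℕ) (g : ℕ) (Λ : ℤ → Finset ℕ → ℝ) (hΛ : ∀ n s, 0 ≤ Λ n s)
    (x : ℤ → ℤ → ℝ) (hx : ∀ u, ∀ d ∈ steps P, |x u d| ≤ ye u d)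
    (hxY : ∀ u d, x u d ≠ 0 → ¬ Yb P g u ∧ ¬ Yb P g (u + d))
    (j : ℕ) (hj : 1 ≤ j) (n : ℤ) (seen : Finset ℕ) :
    ∑ w ∈ words (steps P) j, (if nb 0 w then |Hw x n w| * Λ n (seen ∪ primesOf w) else 0) ≤
      Rw P g Λ j n 0 0 seen := by
  by_cases hg : Yb P g n
  · refine le_trans (le_of_eq ?_) (Rw_nonneg _ _ _ hΛ _ _ _ _ _)
    refine Finset.sum_eq_zero fun w hw => ?_
    rw [mem_words] at hw
    cases w with
    | nil => simp at hw; omega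
    | cons d w =>
      have : x n d = 0 := by by_contra h; exact (hxY _ _ h).1 hg
      simp [Hw, this]
  · have := words_le_Rw P g Λ hΛ x hx hxY j n 0 0 seen (by simpa using hg)
    simpa using this

noncomputable def NS (S : Finset ℤ) (K : Finset ℕ) (off : ℕ → ℤ) : Finset ℤ :=
  S.filter (fun n => ∀ p ∈ K, (p : ℤ) ∣ n + off p)

noncomputable def wt (K : Finset ℕ) : ℝ := ∏ p ∈ K, (1 / (p : ℝ))

theorem wt_nonneg (K : Finset ℕ) : 0 ≤ wt K := Finset.prod_nonneg fun p _ => by positivity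

theorem transfer (P : Finset ℕ) (g : ℕ) (L : ℝ) (hL : 0 < L)
    (G : Finset ℕ → (ℕ → ℤ) → Finset ℕ → ℝ)
    (S : Finset ℤ) (Λ : ℤ → Finset ℕ → ℝ) (hΛ : ∀ n s, 0 ≤ Λ n s)
    (hΛG : ∀ K off seen, K ⊆ seen → seen ⊆ P →
      ∑ n ∈ NS S K off, Λ n seen ≤ wt K * (1 / L) ^ seen.card * G K off seen)
    (j : ℕ) (pos e : ℤ) (K : Finset ℕ) (off : ℕ → ℤ) (seen : Finset ℕ) (hK : K ⊆ seen) (hs : seen ⊆ P) :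
    ∑ n ∈ NS S K off, Rw P g Λ j n pos e seen ≤
      wt K * (1 / L) ^ seen.card * Zf P g L G j pos e K off seen := by
  have hbad : ∀ K off pos, YR P g (rhoS K off) pos → ∀ n ∈ NS S K off, Yb P g (n + pos) := by
    intro K off pos h n hn
    rw [Yb, ← YR_shift]
    refine YR_mono ?_ _ h
    intro p u hpu
    rw [NS, Finset.mem_filter] at hn
    have := dvd_add (hn.2 p hpu.1) hpu.2
    rwa [show n + off p + (u - off p) = n + u by ring] at this
  induction j generalizing pos e K off seen with
  | zero =>
    simp only [Rw, Zf]
    by_cases hb : YR P g (rhoS K off) pos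
    · rw [if_pos hb]
      rw [Finset.sum_eq_zero]
      · simp
      · intro n hn; rw [if_pos (hbad _ _ _ hb n hn)]
    · rw [if_neg hb]
      refine le_trans ?_ (hΛG K off seen hK hs)
      refine Finset.sum_le_sum fun n hn => ?_
      split_ifs
      · exact hΛ _ _
      · exact le_rfl
  | succ j ih =>
    by_cases hb : YR P g (rhoS K off) pos
    · rw [Zf_bad _ _ _ _ _ _ _ _ _ _ hb, Finset.sum_eq_zero]
      · simp
      · intro n hn; simp only [Rw, if_pos (hbad _ _ _ hb n hn)]
    have h1 : ∑ n ∈ NS S K off, Rw P g Λ (j+1) n pos e seen ≤ ∑ d ∈ steps P, if d = -e then 0 else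
        ∑ n ∈ NS S K off, ye (n + pos) d * Rw P g Λ j n (pos + d) d (insert d.natAbs seen) := by
      have : ∀ n, Rw P g Λ (j+1) n pos e seen ≤ ∑ d ∈ steps P, if d = -e then 0 else
          ye (n + pos) d * Rw P g Λ j n (pos + d) d (insert d.natAbs seen) := by
        intro n
        simp only [Rw]
        split_ifs
        · refine Finset.sum_nonneg fun d _ => ?_
          split_ifs
          · exact le_rfl
          · exact mul_nonneg (ye_nonneg _ _) (Rw_nonneg _ _ _ hΛ _ _ _ _ _)
        · exact le_rfl
      refine (Finset.sum_le_sum fun n _ => this n).trans ?_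
      rw [Finset.sum_comm]
      refine Finset.sum_le_sum fun d _ => ?_
      by_cases h : d = -e <;> simp [h]
    refine h1.trans ?_
    simp only [Zf, hb, if_false]
    rw [Finset.mul_sum]
    refine Finset.sum_le_sum fun d hd => ?_
    by_cases h2 : d = -e
    · simp [h2]
    rw [if_neg h2, if_neg h2]
    have hdP := mem_steps.1 hd
    set p := d.natAbs with hp
    have hsub : insert p seen ⊆ P := Finset.insert_subset hdP hs
    have hpow : (1 / L) ^ (insert p seen).card * (1 / (p:ℝ)) = (1 / L) ^ seen.card * fw L seen p := by
      unfold fw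
      by_cases h : p ∈ seen
      · rw [Finset.insert_eq_of_mem h, if_pos h]
      · rw [Finset.card_insert_of_notMem h, if_neg h, pow_succ]; ring
    have hw0 := wt_nonneg K
    have e1 : ∑ n ∈ NS S K off, ye (n + pos) d * Rw P g Λ j n (pos + d) d (insert p seen) =
        (∑ n ∈ NS S K off, if (p:ℤ) ∣ n + pos then Rw P g Λ j n (pos + d) d (insert p seen) else 0)
        + 1 / (p:ℝ) * ∑ n ∈ NS S K off, Rw P g Λ j n (pos + d) d (insert p seen) := by
      rw [Finset.mul_sum, ← Finset.sum_add_distrib]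
      refine Finset.sum_congr rfl fun n _ => ?_
      simp only [ye, ← hp]
      split_ifs <;> ring
    have i1 := ih (pos + d) d K off (insert p seen) (hK.trans (Finset.subset_insert _ _)) hsub
    have i1' := mul_le_mul_of_nonneg_left i1 (by positivity : 0 ≤ 1 / (p:ℝ))
    rw [e1, mul_add, add_comm]
    refine add_le_add ?_ ?_
    · refine i1'.trans (le_of_eq ?_)
      linear_combination (wt K * Zf P g L G j (pos + d) d K off (insert p seen)) * hpow
    · by_cases hpK : p ∈ K
      · rw [if_pos hpK]
        have hiff : ∀ n ∈ NS S K off, ((p:ℤ) ∣ n + pos ↔ rhoS K off p pos) := by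
          intro n hn
          rw [NS, Finset.mem_filter] at hn
          have := hn.2 p hpK
          simp only [rhoS, hpK, true_and]
          rw [show n + pos = (n + off p) + (pos - off p) by ring]
          exact Int.dvd_add_right this
        by_cases hr : rhoS K off p pos
        · rw [if_pos hr]
          rw [Finset.sum_congr rfl fun n hn => if_pos ((hiff n hn).2 hr)]
          rw [Finset.insert_eq_of_mem (hK hpK)] at i1 ⊢
          exact i1
        · rw [if_neg hr]
          rw [Finset.sum_congr rfl fun n hn => if_neg (fun h => hr ((hiff n hn).1 h))]
          simp
      · rw [if_neg hpK, ← Finset.sum_filter]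
        have hf : (NS S K off).filter (fun n => (p:ℤ) ∣ n + pos) =
            NS S (insert p K) (Function.update off p pos) := by
          ext n
          simp only [NS, Finset.mem_filter, Finset.forall_mem_insert, Function.update_self, and_assoc]
          have : (∀ q ∈ K, (q:ℤ) ∣ n + Function.update off p pos q) ↔ ∀ q ∈ K, (q:ℤ) ∣ n + off q := by
            refine forall₂_congr fun q hq => ?_
            rw [Function.update_of_ne]
            rintro rfl; exact hpK hq
          rw [this]; tauto
        rw [hf]
        have i2 := ih (pos + d) d (insert p K) (Function.update off p pos) (insert p seen)
          (Finset.insert_subset_insert _ hK) hsub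
        refine i2.trans (le_of_eq ?_)
        have : wt (insert p K) = 1 / (p:ℝ) * wt K := by
          unfold wt; rw [Finset.prod_insert hpK]
        rw [this]
        linear_combination (wt K * Zf P g L G j (pos + d) d (insert p K) (Function.update off p pos) (insert p seen)) * hpow

/-- Case A: pairs of non-backtracking walks with few distinct primes -/
theorem caseA_total {P : Finset ℕ} {g h k : ℕ} {L H0 B ε : ℝ} (hk : 1 ≤ k)
    (c : CA P g h (2 * k) L H0 B ε)
    (x : ℤ → ℤ → ℝ) (hx : ∀ u, ∀ d ∈ steps P, |x u d| ≤ ye u d)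
    (hxY : ∀ u d, x u d ≠ 0 → ¬ Yb P g u ∧ ¬ Yb P g (u + d))
    (S : Finset ℤ) (um : ℕ) (A : ℝ) (hA : 0 ≤ A)
    (hS : ∀ K off, K ⊆ P → K.card ≤ um → ((NS S K off).card : ℝ) ≤ A * wt K) :
    ∑ n ∈ S, ∑ w ∈ words (steps P) k, ∑ w' ∈ words (steps P) k,
      (if nb 0 w ∧ nb 0 w' ∧ (primesOf w ∪ primesOf w').card ≤ um then |Hw x n w| * |Hw x n w'| else 0)
      ≤ A * L ^ um * (3 * B * 8 ^ k) ^ 2 := by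
  have hL1 := c.hL
  have hL0 : 0 < L := by linarith
  have hB1 := c.hB1
  set Λ2 : ℤ → Finset ℕ → ℝ := fun _ s => if s.card ≤ um then 1 else 0 with hΛ2
  have hLamTwo : ∀ n s, 0 ≤ Λ2 n s := by intro n s; simp only [hΛ2]; split_ifs <;> norm_num
  set Λ1 : ℤ → Finset ℕ → ℝ := fun n s => Rw P g Λ2 k n 0 0 s with hΛ1
  have hLamOne : ∀ n s, 0 ≤ Λ1 n s := fun n s => Rw_nonneg _ _ _ hLamTwo _ _ _ _ _
  set G2 : Finset ℕ → (ℕ → ℤ) → Finset ℕ → ℝ := fun _ _ _ => A * L ^ um with hG2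
  have hG2n : ∀ K off seen, 0 ≤ G2 K off seen := by intro _ _ _; simp only [hG2]; positivity
  set G1 : Finset ℕ → (ℕ → ℤ) → Finset ℕ → ℝ := fun K off s => if s.card ≤ k then Zf P g L G2 k 0 0 K off s
    else Zf P g L G2 k 0 0 K off s with hG1
  have hG1e : ∀ K off s, G1 K off s = Zf P g L G2 k 0 0 K off s := by intro K off s; simp [hG1]
  have hG1n : ∀ K off seen, 0 ≤ G1 K off seen := by
    intro K off s; rw [hG1e]; exact Zf_nonneg _ _ _ _ hL0.le hG2n _ _ _ _ _ _
  have t2 : ∀ K off seen, K ⊆ seen → seen ⊆ P →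
      ∑ n ∈ NS S K off, Λ1 n seen ≤ wt K * (1 / L) ^ seen.card * G1 K off seen := by
    intro K off seen hK hs
    rw [hG1e]
    refine transfer P g L hL0 G2 S Λ2 hLamTwo ?_ k 0 0 K off seen hK hs
    intro K off seen hK hs
    simp only [hΛ2, hG2]
    have hw := wt_nonneg K
    by_cases hc : seen.card ≤ um
    · simp only [hc, if_true, Finset.sum_const, nsmul_eq_mul, mul_one]
      refine (hS K off (hK.trans hs) ((Finset.card_le_card hK).trans hc)).trans ?_
      have : 1 ≤ (1 / L) ^ seen.card * L ^ um := by
        rw [one_div, inv_pow, inv_mul_eq_div, le_div_iff₀ (by positivity), one_mul]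
        exact pow_le_pow_right₀ hL1 hc
      calc A * wt K = (A * wt K) * 1 := by ring
        _ ≤ (A * wt K) * ((1 / L) ^ seen.card * L ^ um) := by
            exact mul_le_mul_of_nonneg_left this (by positivity)
        _ = _ := by ring
    · simp only [hc, if_false, Finset.sum_const_zero]
      positivity
  -- k-version of the bundle
  have c1 : CA P g h k L H0 B ε := by
    have hkr : (0:ℝ) ≤ k := by positivity
    refine ⟨c.hP, c.hL, c.hsum, c.hH0, c.hp, ?_, c.hB1, c.hg, c.hh, c.h8, c.hε0, ?_, ?_⟩
    · have := c.hB; push_cast at this; linarith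
    · intro p hp b m hm hmk; exact c.hε p hp b m hm (by omega)
    · refine le_trans ?_ c.hsmall
      have := c.hH0
      have := c.hε0
      push_cast
      gcongr <;> linarith
  have t1 := transfer P g L hL0 G1 S Λ1 hLamOne t2 k 0 0 ∅ (fun _ => 0) ∅ (Finset.Subset.refl _) (Finset.empty_subset _)
  have b1 := (caseA c1 G1 hG1n (3 * B * 8 ^ k * (A * L ^ um)) (by positivity) (by
    intro K off seen hK hs hc
    rw [hG1e]
    exact (caseA c G2 hG2n (A * L ^ um) (by positivity) (fun _ _ _ _ _ _ => le_rfl) k 0 0 K off seen hK hs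
      (by omega)).2) k 0 0 ∅ (fun _ => 0) ∅ (Finset.Subset.refl _) (Finset.empty_subset _) (by simp)).2
  have hNS : NS S ∅ (fun _ => 0) = S := by simp [NS]
  rw [hNS] at t1
  simp only [wt, Finset.prod_empty, Finset.card_empty, pow_zero, one_mul] at t1
  calc _ ≤ ∑ n ∈ S, Rw P g Λ1 k n 0 0 ∅ := by
        refine Finset.sum_le_sum fun n _ => ?_
        refine le_trans ?_ (words_le_Rw' P g Λ1 hLamOne x hx hxY k hk n ∅)
        refine Finset.sum_le_sum fun w _ => ?_
        by_cases hw : nb 0 w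
        · simp only [hw, true_and, if_true]
          have := words_le_Rw' P g Λ2 hLamTwo x hx hxY k hk n (∅ ∪ primesOf w)
          refine le_trans (le_of_eq ?_) (mul_le_mul_of_nonneg_left this (abs_nonneg _))
          rw [Finset.mul_sum]
          refine Finset.sum_congr rfl fun w' _ => ?_
          simp only [hΛ2, Finset.empty_union]
          by_cases h1 : nb 0 w' <;> by_cases h2 : (primesOf w ∪ primesOf w').card ≤ um <;> simp [h1, h2]
        · simp [hw]
    _ ≤ _ := t1
    _ ≤ _ := b1
    _ = _ := by ring
end PartThreeC

section PartFourA
open scoped Classical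

theorem count_mod (a b : ℤ) (hab : a ≤ b) (r : ℤ) (hr : 0 < r) (v : ℤ) :
    |(((Finset.Ioc a b).filter (fun n => n ≡ v [ZMOD r])).card : ℝ) - ((b - a : ℤ) : ℝ) / r| ≤ 1 := by
  have h := Int.Ioc_filter_modEq_card a b hr v
  have hr' : (0:ℝ) < r := by exact_mod_cast hr
  set X := ⌊((b - v : ℤ) : ℚ) / r⌋ with hX
  set Y := ⌊((a - v : ℤ) : ℚ) / r⌋ with hY
  have h1 : (((Finset.Ioc a b).filter (fun n => n ≡ v [ZMOD r])).card : ℤ) = X - Y := by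
    rw [h, max_eq_left]
    · simp only [hX, hY]; push_cast; rfl
    · have : Y ≤ X := by
        apply Int.floor_le_floor
        have : (0:ℚ) < r := by exact_mod_cast hr
        gcongr
      simp only [hX, hY] at this
      push_cast at this
      linarith
  have h2 : (((Finset.Ioc a b).filter (fun n => n ≡ v [ZMOD r])).card : ℝ) = X - Y := by exact_mod_cast h1
  have x1 : (X:ℚ) ≤ ((b - v : ℤ) : ℚ) / r := Int.floor_le _
  have x2 : ((b - v : ℤ) : ℚ) / r < X + 1 := Int.lt_floor_add_one _
  have y1 : (Y:ℚ) ≤ ((a - v : ℤ) : ℚ) / r := Int.floor_le _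
  have y2 : ((a - v : ℤ) : ℚ) / r < Y + 1 := Int.lt_floor_add_one _
  have x1' : (X:ℝ) ≤ ((b - v : ℤ) : ℝ) / r := by exact_mod_cast x1
  have x2' : ((b - v : ℤ) : ℝ) / r < X + 1 := by exact_mod_cast x2
  have y1' : (Y:ℝ) ≤ ((a - v : ℤ) : ℝ) / r := by exact_mod_cast y1
  have y2' : ((a - v : ℤ) : ℝ) / r < Y + 1 := by exact_mod_cast y2
  have e : ((b - a : ℤ) : ℝ) / r = ((b - v : ℤ) : ℝ) / r - ((a - v : ℤ) : ℝ) / r := by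
    push_cast; ring
  rw [h2, e, abs_le]
  constructor <;> linarith

theorem per_mod (F : ℤ → ℝ) (q : ℤ) (hF : ∀ n, F (n + q) = F n) (n m : ℤ) (h : n ≡ m [ZMOD q]) :
    F n = F m := by
  obtain ⟨t, ht⟩ := h.symm.dvd
  have : n = m + t * q := by linarith [ht, mul_comm q t]
  rw [this]
  have hp : Function.Periodic F q := hF
  exact hp.int_mul t m

theorem mean_zero (F : ℤ → ℝ) (q p : ℕ) (hq : 0 < q) (hp : 0 < p) (hc : Nat.Coprime q p)
    (hF : ∀ n, F (n + q) = F n) (hF1 : ∀ n, |F n| ≤ 1) (a b c : ℤ) (hab : a ≤ b) :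
    |∑ n ∈ Finset.Ioc a b, F n * ((if (p:ℤ) ∣ n + c then 1 else 0) - 1 / (p:ℝ))| ≤ 2 * q := by
  have hq' : (0:ℤ) < q := by exact_mod_cast hq
  have hp' : (0:ℤ) < p := by exact_mod_cast hp
  have hpr : (0:ℝ) < p := by exact_mod_cast hp
  have hqr : (0:ℝ) < q := by exact_mod_cast hq
  have hp1 : (1:ℝ) ≤ p := by exact_mod_cast hp
  have h1 : ∑ n ∈ Finset.Ioc a b, F n * ((if (p:ℤ) ∣ n + c then 1 else 0) - 1 / (p:ℝ)) =
      ∑ r ∈ Finset.range q, ∑ n ∈ (Finset.Ioc a b).filter (fun n : ℤ => (n % (q:ℤ)).toNat = r),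
        F n * ((if (p:ℤ) ∣ n + c then 1 else 0) - 1 / (p:ℝ)) := by
    rw [Finset.sum_fiberwise_of_maps_to]
    intro n _
    rw [Finset.mem_range]
    have := Int.emod_lt_of_pos n hq'
    have := Int.emod_nonneg n hq'.ne'
    omega
  rw [h1]
  refine (Finset.abs_sum_le_sum_abs _ _).trans ?_
  have h2 : ∀ r ∈ Finset.range q, |∑ n ∈ (Finset.Ioc a b).filter (fun n : ℤ => (n % (q:ℤ)).toNat = r),
        F n * ((if (p:ℤ) ∣ n + c then 1 else 0) - 1 / (p:ℝ))| ≤ 2 := by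
    intro r hr
    rw [Finset.mem_range] at hr
    have hset : (Finset.Ioc a b).filter (fun n : ℤ => (n % (q:ℤ)).toNat = r) =
        (Finset.Ioc a b).filter (fun n => n ≡ r [ZMOD q]) := by
      refine Finset.filter_congr fun n _ => ?_
      rw [Int.ModEq, Int.emod_eq_of_lt (by omega : (0:ℤ) ≤ r) (by omega)]
      have := Int.emod_nonneg n hq'.ne'
      omega
    rw [hset]
    have h3 : ∑ n ∈ (Finset.Ioc a b).filter (fun n => n ≡ r [ZMOD q]),
        F n * ((if (p:ℤ) ∣ n + c then 1 else 0) - 1 / (p:ℝ)) =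
        F r * ∑ n ∈ (Finset.Ioc a b).filter (fun n => n ≡ r [ZMOD q]),
          ((if (p:ℤ) ∣ n + c then 1 else 0) - 1 / (p:ℝ)) := by
      rw [Finset.mul_sum]
      refine Finset.sum_congr rfl fun n hn => ?_
      rw [per_mod F q hF n r (Finset.mem_filter.1 hn).2]
    rw [h3, abs_mul]
    have hcop : IsCoprime (q:ℤ) (p:ℤ) := by exact_mod_cast Nat.isCoprime_iff_coprime.2 hc
    obtain ⟨s, hs1, hs2⟩ : ∃ s : ℤ, s ≡ r [ZMOD q] ∧ s ≡ -c [ZMOD p] := by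
      obtain ⟨α, β, hαβ⟩ := hcop
      refine ⟨β * p * r + α * q * (-c), ?_, ?_⟩
      · rw [Int.modEq_iff_dvd]
        exact ⟨α * r + α * c, by linear_combination (-r:ℤ) * hαβ⟩
      · rw [Int.modEq_iff_dvd]
        exact ⟨-β * c - β * r, by linear_combination (c:ℤ) * hαβ⟩
    have hset2 : ((Finset.Ioc a b).filter (fun n => n ≡ r [ZMOD q])).filter (fun n => (p:ℤ) ∣ n + c) =
        (Finset.Ioc a b).filter (fun n => n ≡ s [ZMOD (q * p : ℤ)]) := by
      rw [Finset.filter_filter]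
      refine Finset.filter_congr fun n _ => ?_
      constructor
      · rintro ⟨h1, h2⟩
        have h2' : n ≡ s [ZMOD p] := by
          refine Int.ModEq.trans ?_ hs2.symm
          rw [Int.modEq_iff_dvd]
          rw [show -c - n = -(n + c) by ring]
          exact (dvd_neg).2 h2
        have h1' : n ≡ s [ZMOD q] := h1.trans hs1.symm
        rw [Int.modEq_iff_dvd] at *
        exact hcop.mul_dvd h1' h2'
      · intro h
        have hA : n ≡ s [ZMOD q] := Int.ModEq.of_mul_right _ h
        have hB : n ≡ s [ZMOD p] := Int.ModEq.of_mul_left _ h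
        refine ⟨hA.trans hs1, ?_⟩
        have := (hB.trans hs2).symm.dvd
        rwa [sub_neg_eq_add] at this
    have h4 : ∑ n ∈ (Finset.Ioc a b).filter (fun n => n ≡ r [ZMOD q]),
          ((if (p:ℤ) ∣ n + c then (1:ℝ) else 0) - 1 / (p:ℝ)) =
          (((Finset.Ioc a b).filter (fun n => n ≡ s [ZMOD (q * p : ℤ)])).card : ℝ)
          - (((Finset.Ioc a b).filter (fun n => n ≡ r [ZMOD q])).card : ℝ) * (1 / p) := by
      rw [Finset.sum_sub_distrib, ← Finset.sum_filter, hset2]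
      simp
    have c1 := count_mod a b hab (q * p) (by positivity) s
    have c2 := count_mod a b hab q hq' r
    rw [h4]
    have c2' : |(((Finset.Ioc a b).filter (fun n => n ≡ r [ZMOD q])).card : ℝ) * (1 / p)
        - ((b - a : ℤ) : ℝ) / ((q * p : ℤ) : ℝ)| ≤ 1 := by
      have : (((Finset.Ioc a b).filter (fun n => n ≡ r [ZMOD q])).card : ℝ) * (1 / p)
        - ((b - a : ℤ) : ℝ) / ((q * p : ℤ) : ℝ) = ((((Finset.Ioc a b).filter (fun n => n ≡ r [ZMOD q])).card : ℝ)
          - ((b - a : ℤ) : ℝ) / (q : ℤ)) * (1 / p) := by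
        push_cast; field_simp
      rw [this, abs_mul, abs_of_nonneg (by positivity : (0:ℝ) ≤ 1 / p)]
      have h1p : 1 / (p:ℝ) ≤ 1 := by rw [div_le_one hpr]; exact hp1
      exact mul_le_one₀ c2 (by positivity) h1p
    have := hF1 r
    rw [abs_le] at c1 c2'
    have h5 : |(((Finset.Ioc a b).filter (fun n => n ≡ s [ZMOD (q * p : ℤ)])).card : ℝ)
          - (((Finset.Ioc a b).filter (fun n => n ≡ r [ZMOD q])).card : ℝ) * (1 / p)| ≤ 2 := by
      rw [abs_le]; constructor <;> linarith
    refine (mul_le_mul this h5 (abs_nonneg _) (by norm_num)).trans (by norm_num)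
  calc _ ≤ ∑ r ∈ Finset.range q, (2:ℝ) := Finset.sum_le_sum h2
    _ = _ := by simp; ring

theorem ns_card (K : Finset ℕ) (hK : ∀ p ∈ K, p.Prime) (off : ℕ → ℤ) (a b : ℤ) (hab : a ≤ b) (A : ℝ)
    (hA1 : ((b - a : ℤ) : ℝ) ≤ A) (hA : ((∏ p ∈ K, p : ℕ) : ℝ) ≤ A) :
    ((NS (Finset.Ioc a b) K off).card : ℝ) ≤ 2 * A * wt K := by
  set m := ∏ p ∈ K, p with hm
  have hm0 : 0 < m := Finset.prod_pos fun p hp => (hK p hp).pos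
  have hmr : (0:ℝ) < m := by exact_mod_cast hm0
  have hw : wt K = 1 / (m:ℝ) := by
    simp only [wt, hm]; push_cast; simp
  rw [hw]
  rcases Finset.eq_empty_or_nonempty (NS (Finset.Ioc a b) K off) with h | ⟨n0, hn0⟩
  · have : 0 ≤ A := hmr.le.trans hA
    rw [h]; simp; positivity
  have hsub : NS (Finset.Ioc a b) K off ⊆ (Finset.Ioc a b).filter (fun n => n ≡ n0 [ZMOD m]) := by
    intro n hn
    rw [NS, Finset.mem_filter] at hn hn0
    rw [Finset.mem_filter]
    refine ⟨hn.1, ?_⟩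
    rw [Int.modEq_iff_dvd]
    rw [hm]; push_cast
    refine Finset.prod_dvd_of_coprime ?_ ?_
    · intro x hx y hy hxy
      exact Nat.isCoprime_iff_coprime.2 ((Nat.coprime_primes (hK x hx) (hK y hy)).2 hxy)
    · intro p hp
      have := dvd_sub (hn0.2 p hp) (hn.2 p hp)
      rwa [show n0 + off p - (n + off p) = n0 - n by ring] at this
  have h1 := count_mod a b hab m (by exact_mod_cast hm0) n0
  have h2 : ((NS (Finset.Ioc a b) K off).card : ℝ) ≤
      (((Finset.Ioc a b).filter (fun n => n ≡ n0 [ZMOD m])).card : ℝ) := by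
    exact_mod_cast Finset.card_le_card hsub
  rw [abs_le] at h1
  have h3 : ((b - a : ℤ) : ℝ) / ((m:ℤ):ℝ) ≤ A / m := by
    push_cast at hA1 ⊢; gcongr
  have h4 : 1 ≤ A / m := by rw [le_div_iff₀ hmr]; linarith
  have : 2 * A * (1 / (m:ℝ)) = A / m + A / m := by ring
  linarith
end PartFourA

section PartFourB
open scoped Classical

def edges : ℤ → List ℤ → List (ℤ × ℤ)
  | _, [] => []
  | u, d :: w => (u, d) :: edges (u + d) w

theorem Hw_edges (x : ℤ → ℤ → ℝ) (n u : ℤ) (w : List ℤ) :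
    Hw x (n + u) w = ((edges u w).map fun a => x (n + a.1) a.2).prod := by
  induction w generalizing u with
  | nil => simp [Hw, edges]
  | cons d w ih => simp only [Hw, edges, List.map_cons, List.prod_cons, ← ih, add_assoc]

theorem edges_snd (u : ℤ) (w : List ℤ) : (edges u w).map Prod.snd = w := by
  induction w generalizing u with
  | nil => rfl
  | cons d w ih => simp [edges, ih]

noncomputable def x0 (β : ℤ → ℤ → ℝ) (n d : ℤ) : ℝ :=
  β n d * ((if (d.natAbs : ℤ) ∣ n then 1 else 0) - 1 / (d.natAbs : ℝ))

noncomputable def psi (β : ℤ → ℤ → ℝ) (W : List (ℤ × ℤ)) (n : ℤ) : ℝ :=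
  (W.map fun a => x0 β (n + a.1) a.2).prod

def pW (W : List (ℤ × ℤ)) : Finset ℕ := (W.map fun a => a.2.natAbs).toFinset

theorem pW_cons (a : ℤ × ℤ) (W : List (ℤ × ℤ)) : pW (a :: W) = insert a.2.natAbs (pW W) := by
  simp [pW]

theorem wt_insert_le (p : ℕ) (hp : 0 < p) (K : Finset ℕ) : 1 / (p:ℝ) * wt K ≤ wt (insert p K) := by
  by_cases h : p ∈ K
  · rw [Finset.insert_eq_of_mem h]
    have : 1 / (p:ℝ) ≤ 1 := by
      rw [div_le_one (by exact_mod_cast hp)]; exact_mod_cast hp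
    nlinarith [wt_nonneg K]
  · unfold wt; rw [Finset.prod_insert h]

theorem NS_insert (S : Finset ℤ) (K : Finset ℕ) (off : ℕ → ℤ) (p : ℕ) (hpK : p ∉ K) (pos : ℤ) :
    (NS S K off).filter (fun n => (p:ℤ) ∣ n + pos) =
            NS S (insert p K) (Function.update off p pos) := by
  ext n
  simp only [NS, Finset.mem_filter, Finset.forall_mem_insert, Function.update_self, and_assoc]
  have : (∀ q ∈ K, (q:ℤ) ∣ n + Function.update off p pos q) ↔ ∀ q ∈ K, (q:ℤ) ∣ n + off q := by
    refine forall₂_congr fun q hq => ?_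
    rw [Function.update_of_ne]
    rintro rfl; exact hpK hq
  rw [this]; tauto

theorem x0_le (β : ℤ → ℤ → ℝ) (hβ : ∀ n d, |β n d| ≤ 1) (n d : ℤ) : |x0 β n d| ≤ ye n d := by
  unfold x0 ye
  rw [abs_mul]
  have h2 : |((if (d.natAbs : ℤ) ∣ n then (1:ℝ) else 0) - 1 / (d.natAbs : ℝ))| ≤
      (if (d.natAbs : ℤ) ∣ n then 1 else 0) + 1 / (d.natAbs : ℝ) := by
    refine (abs_sub _ _).trans ?_
    rw [abs_of_nonneg (by positivity : (0:ℝ) ≤ 1 / (d.natAbs : ℝ))]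
    split_ifs <;> simp
  have := hβ n d
  nlinarith [abs_nonneg ((if (d.natAbs : ℤ) ∣ n then (1:ℝ) else 0) - 1 / (d.natAbs : ℝ))]

theorem x0_le_one (β : ℤ → ℤ → ℝ) (hβ : ∀ n d, |β n d| ≤ 1) (n d : ℤ) : |x0 β n d| ≤ 1 := by
  unfold x0
  rw [abs_mul]
  have h3 : 1 / (d.natAbs : ℝ) ≤ 1 := by
    rcases Nat.eq_zero_or_pos d.natAbs with h | h
    · rw [h]; simp
    · rw [div_le_one (by exact_mod_cast h)]; exact_mod_cast h
  have h2 : |((if (d.natAbs : ℤ) ∣ n then (1:ℝ) else 0) - 1 / (d.natAbs : ℝ))| ≤ 1 := by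
    have : 0 ≤ 1 / (d.natAbs : ℝ) := by positivity
    rw [abs_le]; split_ifs <;> constructor <;> linarith
  exact mul_le_one₀ (hβ n d) (abs_nonneg _) h2

theorem leaf (P : Finset ℕ) (hP : ∀ p ∈ P, 0 < p) (β : ℤ → ℤ → ℝ) (hβ : ∀ n d, |β n d| ≤ 1)
    (S : Finset ℤ) (um : ℕ) (A : ℝ)
    (hS : ∀ K off, K ⊆ P → K.card ≤ um → ((NS S K off).card : ℝ) ≤ A * wt K)
    (W : List (ℤ × ℤ)) (hW : ∀ a ∈ W, a.2.natAbs ∈ P) (E : Finset ℕ) (off : ℕ → ℤ) (hE : E ⊆ P)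
    (hc : E.card + W.length ≤ um) :
    ∑ n ∈ NS S E off, |psi β W n| ≤ 2 ^ W.length * A * wt (E ∪ pW W) := by
  induction W generalizing E off with
  | nil =>
    simp only [psi, List.map_nil, List.prod_nil, abs_one, Finset.sum_const, nsmul_eq_mul, mul_one,
      List.length_nil, pow_zero, one_mul, pW, List.toFinset_nil, Finset.union_empty]
    exact hS E off hE (by simpa using hc)
  | cons a W ih =>
    set p := a.2.natAbs with hp
    have hpP : p ∈ P := hW a (by simp)
    have hW' : ∀ a ∈ W, a.2.natAbs ∈ P := fun a ha => hW a (by simp [ha])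
    simp only [List.length_cons] at hc ⊢
    have h1 : ∑ n ∈ NS S E off, |psi β (a :: W) n| ≤
        (∑ n ∈ (NS S E off).filter (fun n => (p:ℤ) ∣ n + a.1), |psi β W n|) +
        1 / (p:ℝ) * ∑ n ∈ NS S E off, |psi β W n| := by
      rw [Finset.sum_filter, Finset.mul_sum, ← Finset.sum_add_distrib]
      refine Finset.sum_le_sum fun n _ => ?_
      simp only [psi, List.map_cons, List.prod_cons, abs_mul]
      have := mul_le_mul_of_nonneg_right (x0_le β hβ (n + a.1) a.2) (abs_nonneg (W.map fun a => x0 β (n + a.1) a.2).prod)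
      refine this.trans (le_of_eq ?_)
      simp only [ye, ← hp]
      split_ifs <;> ring
    have h2 : 1 / (p:ℝ) * ∑ n ∈ NS S E off, |psi β W n| ≤ 2 ^ W.length * A * wt (E ∪ pW (a :: W)) := by
      have i := ih hW' E off hE (by omega)
      have hA : 0 ≤ 2 ^ W.length * A ∨ 2 ^ W.length * A < 0 := le_or_gt _ _
      have hA : 0 ≤ A := by
        have := hS ∅ off (by simp) (by simp)
        simp [wt] at this
        exact (Nat.cast_nonneg _).trans this
      calc 1 / (p:ℝ) * ∑ n ∈ NS S E off, |psi β W n| ≤ 1 / (p:ℝ) * (2 ^ W.length * A * wt (E ∪ pW W)) :=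
            mul_le_mul_of_nonneg_left i (by positivity)
        _ = 2 ^ W.length * A * (1 / (p:ℝ) * wt (E ∪ pW W)) := by ring
        _ ≤ 2 ^ W.length * A * wt (insert p (E ∪ pW W)) :=
            mul_le_mul_of_nonneg_left (wt_insert_le p (hP p hpP) _) (by positivity)
        _ = _ := by rw [pW_cons, Finset.union_insert]
    have h3 : (∑ n ∈ (NS S E off).filter (fun n => (p:ℤ) ∣ n + a.1), |psi β W n|) ≤
        2 ^ W.length * A * wt (E ∪ pW (a :: W)) := by
      by_cases hpE : p ∈ E
      · have i := ih hW' E off hE (by omega)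
        have : E ∪ pW (a :: W) = E ∪ pW W := by
          rw [pW_cons, Finset.union_insert, ← hp, Finset.insert_eq_of_mem (Finset.mem_union_left _ hpE)]
        rw [this]
        exact (Finset.sum_le_sum_of_subset_of_nonneg (Finset.filter_subset _ _) (fun _ _ _ => abs_nonneg _)).trans i
      · rw [NS_insert _ _ _ _ hpE]
        have i := ih hW' (insert p E) (Function.update off p a.1) (Finset.insert_subset hpP hE)
          (by rw [Finset.card_insert_of_notMem hpE]; omega)
        have : E ∪ pW (a :: W) = insert p E ∪ pW W := by
          rw [pW_cons, Finset.union_insert, Finset.insert_union]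
        rw [this]; exact i
    rw [pow_succ]
    linarith

theorem psi_append (β : ℤ → ℤ → ℝ) (W1 W2 : List (ℤ × ℤ)) (n : ℤ) :
    psi β (W1 ++ W2) n = psi β W1 n * psi β W2 n := by simp [psi]

theorem psi_le_one (β : ℤ → ℤ → ℝ) (hβ : ∀ n d, |β n d| ≤ 1) (W : List (ℤ × ℤ)) (n : ℤ) :
    |psi β W n| ≤ 1 := by
  induction W with
  | nil => simp [psi]
  | cons a W ih =>
    have : psi β (a :: W) n = x0 β (n + a.1) a.2 * psi β W n := by simp [psi]
    rw [this, abs_mul]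
    exact mul_le_one₀ (x0_le_one β hβ _ _) (abs_nonneg _) ih

theorem psi_per (β : ℤ → ℤ → ℝ) (q : ℤ) (hβ : ∀ n d, β (n + q) d = β n d) (W : List (ℤ × ℤ))
    (hW : ∀ r ∈ pW W, (r:ℤ) ∣ q) (n : ℤ) : psi β W (n + q) = psi β W n := by
  induction W with
  | nil => simp [psi]
  | cons a W ih =>
    have : ∀ n, psi β (a :: W) n = x0 β (n + a.1) a.2 * psi β W n := by simp [psi]
    rw [pW_cons] at hW
    rw [this, this, ih fun r hr => hW r (Finset.mem_insert_of_mem hr)]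
    congr 1
    unfold x0
    have h := hW a.2.natAbs (Finset.mem_insert_self _ _)
    have : (a.2.natAbs:ℤ) ∣ n + q + a.1 ↔ (a.2.natAbs:ℤ) ∣ n + a.1 := by
      rw [show n + q + a.1 = n + a.1 + q by ring]
      exact Int.dvd_add_left h
    rw [show n + q + a.1 = n + a.1 + q by ring] at this ⊢
    simp only [hβ, this]

theorem err_bound (P : Finset ℕ) (hP : ∀ p ∈ P, p.Prime) (β : ℤ → ℤ → ℝ) (hβ : ∀ n d, |β n d| ≤ 1)
    (M : ℕ) (hM : 0 < M) (hMp : ∀ p ∈ P, Nat.Coprime M p) (hper : ∀ n d, β (n + M) d = β n d)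
    (a b : ℤ) (hab : a ≤ b) (H : ℝ) (hH1 : 1 ≤ H) (hH : ∀ p ∈ P, (p:ℝ) ≤ H) (r : ℕ)
    (W : List (ℤ × ℤ)) (hW : ∀ a ∈ W, a.2.natAbs ∈ P) (E : Finset ℕ) (off : ℕ → ℤ) (hE : E ⊆ P)
    (hr : E.card + W.length ≤ r)
    (p : ℕ) (hpE : p ∉ E) (hpc : (W.map fun a => a.2.natAbs).count p = 1) :
    |∑ n ∈ NS (Finset.Ioc a b) E off, psi β W n| ≤ 2 * (M * H ^ r) := by
  have hpm : p ∈ W.map fun a => a.2.natAbs := by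
    rw [← List.count_pos_iff]; omega
  obtain ⟨a0, ha0, hap⟩ := List.mem_map.1 hpm
  obtain ⟨W1, W2, rfl⟩ := List.append_of_mem ha0
  simp only [List.map_append, List.map_cons, List.count_append, List.count_cons, hap, beq_self_eq_true, if_true] at hpc
  have hn1 : p ∉ pW W1 := by
    simp only [pW, List.mem_toFinset]; intro h
    have := List.count_pos_iff.2 h; omega
  have hn2 : p ∉ pW W2 := by
    simp only [pW, List.mem_toFinset]; intro h
    have := List.count_pos_iff.2 h; omega
  have hpP : p ∈ P := hap ▸ hW a0 ha0
  set U := E ∪ pW W1 ∪ pW W2 with hU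
  have hUP : U ⊆ P := by
    intro z hz
    simp only [hU, Finset.mem_union, pW, List.mem_toFinset, List.mem_map] at hz
    rcases hz with (hz | ⟨y, hy, rfl⟩) | ⟨y, hy, rfl⟩
    · exact hE hz
    · exact hW y (by simp [hy])
    · exact hW y (by simp [hy])
  have hpU : p ∉ U := by simp only [hU, Finset.mem_union]; tauto
  have hUc : U.card ≤ r := by
    have h1 : (pW W1).card ≤ W1.length := by
      refine (List.toFinset_card_le _).trans ?_; simp
    have h2 : (pW W2).card ≤ W2.length := by
      refine (List.toFinset_card_le _).trans ?_; simp
    have h3 := Finset.card_union_le (E ∪ pW W1) (pW W2)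
    have h4 := Finset.card_union_le E (pW W1)
    simp at hr
    rw [hU]; omega
  set q := M * ∏ z ∈ U, z with hq
  have hq0 : 0 < q := Nat.mul_pos hM (Finset.prod_pos fun z hz => (hP z (hUP hz)).pos)
  have hcop : Nat.Coprime q p := by
    refine Nat.Coprime.mul_left (hMp p hpP) ?_
    refine Nat.Coprime.prod_left fun z hz => ?_
    exact (Nat.coprime_primes (hP z (hUP hz)) (hP p hpP)).2 (fun h => hpU (h ▸ hz))
  have hdv : ∀ z ∈ U, (z:ℤ) ∣ (q:ℤ) := by
    intro z hz
    have h : z ∣ q := Dvd.dvd.mul_left (Finset.dvd_prod_of_mem (fun z : ℕ => z) hz) M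
    exact_mod_cast h
  have hβq : ∀ n d, β (n + q) d = β n d := by
    intro n d
    have hp : Function.Periodic (fun n => β n d) (M:ℤ) := fun n => hper n d
    have := hp.nat_mul (∏ z ∈ U, z) n
    rw [← this, hq]; push_cast; ring_nf
  set F : ℤ → ℝ := fun n => (if ∀ z ∈ E, (z:ℤ) ∣ n + off z then 1 else 0) *
    (psi β W1 n * β (n + a0.1) a0.2 * psi β W2 n) with hF
  have hFper : ∀ n, F (n + q) = F n := by
    intro n
    simp only [hF]
    rw [psi_per β q hβq W1 (fun z hz => hdv z (by simp [hU, hz])),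
      psi_per β q hβq W2 (fun z hz => hdv z (by simp [hU, hz])),
      show n + (q:ℤ) + a0.1 = n + a0.1 + q by ring, hβq]
    congr 1
    refine if_congr (forall₂_congr fun z hz => ?_) rfl rfl
    rw [show n + (q:ℤ) + off z = n + off z + q by ring]
    exact Int.dvd_add_left (hdv z (by simp [hU, hz]))
  have hF1 : ∀ n, |F n| ≤ 1 := by
    intro n
    simp only [hF, abs_mul]
    refine mul_le_one₀ ?_ (by positivity) ?_
    · split_ifs <;> simp
    · exact mul_le_one₀ (mul_le_one₀ (psi_le_one β hβ _ _) (abs_nonneg _) (hβ _ _)) (abs_nonneg _) (psi_le_one β hβ _ _)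
  have key := mean_zero F q p hq0 (hP p hpP).pos hcop hFper hF1 a b a0.1 hab
  have e : ∑ n ∈ NS (Finset.Ioc a b) E off, psi β (W1 ++ a0 :: W2) n =
      ∑ n ∈ Finset.Ioc a b, F n * ((if (p:ℤ) ∣ n + a0.1 then 1 else 0) - 1 / (p:ℝ)) := by
    rw [NS, Finset.sum_filter]
    refine Finset.sum_congr rfl fun n _ => ?_
    have : psi β (W1 ++ a0 :: W2) n = psi β W1 n * (x0 β (n + a0.1) a0.2 * psi β W2 n) := by
      simp [psi]
    simp only [hF]
    rw [this]
    unfold x0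
    rw [hap]
    by_cases hc : ∀ z ∈ E, (z:ℤ) ∣ n + off z
    · rw [if_pos hc, if_pos hc]; ring
    · rw [if_neg hc, if_neg hc]; ring
  rw [e]
  refine key.trans ?_
  have : ((∏ z ∈ U, z : ℕ) : ℝ) ≤ H ^ r := by
    push_cast
    calc ∏ z ∈ U, (z:ℝ) ≤ ∏ z ∈ U, H := Finset.prod_le_prod (fun _ _ => by positivity) (fun z hz => hH z (hUP hz))
      _ = H ^ U.card := by simp
      _ ≤ H ^ r := pow_le_pow_right₀ hH1 hUc
  rw [hq, Nat.cast_mul]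
  gcongr

theorem lone_count (l : List ℕ) : 2 * l.toFinset.card ≤ l.length +
    (l.toFinset.filter (fun p => l.count p = 1)).card := by
  rw [← List.sum_toFinset_count_eq_length l, Finset.card_filter, ← Finset.sum_add_distrib, mul_comm,
    ← smul_eq_mul, ← Finset.sum_const]
  refine Finset.sum_le_sum fun p hp => ?_
  have := List.count_pos_iff.2 (List.mem_toFinset.1 hp)
  split_ifs <;> omega
end PartFourB

section PartFourC
open scoped Classical

abbrev Ev := Finset ℕ × (ℕ → ℤ)

noncomputable def xQ (Q : Ev) (n : ℤ) : ℝ := if ∀ p ∈ Q.1, (p:ℤ) ∣ n + Q.2 p then 1 else 0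

noncomputable def FF (S : Finset ℤ) (ψ : ℤ → ℝ) (E : Finset ℕ) (off : ℕ → ℤ) (l : List Ev) : ℝ :=
  ∑ n ∈ NS S E off, ψ n * (l.map fun Q => 1 - xQ Q n).prod

theorem FF_cons_sub (S : Finset ℤ) (ψ : ℤ → ℝ) (E : Finset ℕ) (off : ℕ → ℤ) (Q : Ev) (l : List Ev)
    (h : Q.1 ⊆ E) : |FF S ψ E off (Q :: l)| ≤ |FF S ψ E off l| := by
  rcases Finset.eq_empty_or_nonempty (NS S E off) with he | ⟨n0, hn0⟩
  · simp [FF, he]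
  have hc : ∀ n ∈ NS S E off, xQ Q n = xQ Q n0 := by
    intro n hn
    unfold xQ
    refine if_congr (forall₂_congr fun p hp => ?_) rfl rfl
    rw [NS, Finset.mem_filter] at hn hn0
    have := dvd_sub (hn.2 p (h hp)) (hn0.2 p (h hp))
    rw [show n + off p - (n0 + off p) = n - n0 by ring] at this
    rw [show n + Q.2 p = (n0 + Q.2 p) + (n - n0) by ring]
    exact Int.dvd_add_left this
  have : FF S ψ E off (Q :: l) = (1 - xQ Q n0) * FF S ψ E off l := by
    unfold FF
    rw [Finset.mul_sum]
    refine Finset.sum_congr rfl fun n hn => ?_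
    rw [List.map_cons, List.prod_cons, hc n hn]; ring
  rw [this, abs_mul]
  have h1 : |1 - xQ Q n0| ≤ 1 := by unfold xQ; split_ifs <;> simp
  nlinarith [abs_nonneg (FF S ψ E off l)]

theorem FF_cons (S : Finset ℤ) (ψ : ℤ → ℝ) (E : Finset ℕ) (off : ℕ → ℤ) (Q : Ev) (l : List Ev) :
    ∃ off', |FF S ψ E off (Q :: l)| ≤ |FF S ψ E off l| + |FF S ψ (E ∪ Q.1) off' l| := by
  set off' : ℕ → ℤ := fun p => if p ∈ E then off p else Q.2 p with hoff
  refine ⟨off', ?_⟩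
  have e1 : FF S ψ E off (Q :: l) = FF S ψ E off l -
      ∑ n ∈ (NS S E off).filter (fun n => ∀ p ∈ Q.1, (p:ℤ) ∣ n + Q.2 p), ψ n * (l.map fun Q => 1 - xQ Q n).prod := by
    unfold FF
    rw [Finset.sum_filter, ← Finset.sum_sub_distrib]
    refine Finset.sum_congr rfl fun n _ => ?_
    rw [List.map_cons, List.prod_cons, xQ]
    split_ifs <;> ring
  have hoE : ∀ p ∈ E, off' p = off p := fun p hp => by simp [hoff, hp]
  by_cases hcomp : ∀ p ∈ E, p ∈ Q.1 → (p:ℤ) ∣ off p - Q.2 p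
  · have : (NS S E off).filter (fun n => ∀ p ∈ Q.1, (p:ℤ) ∣ n + Q.2 p) = NS S (E ∪ Q.1) off' := by
      ext n
      simp only [NS, Finset.mem_filter, Finset.mem_union, and_assoc]
      refine and_congr_right fun _ => ⟨?_, ?_⟩
      · rintro ⟨h1, h2⟩ p hp
        by_cases hpE : p ∈ E
        · rw [hoE p hpE]; exact h1 p hpE
        · simp only [hoff, hpE, if_false]; exact h2 p (by tauto)
      · intro h
        refine ⟨fun p hp => by rw [← hoE p hp]; exact h p (Or.inl hp), fun p hp => ?_⟩
        have h1 := h p (Or.inr hp)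
        by_cases hpE : p ∈ E
        · rw [hoE p hpE] at h1
          have := dvd_sub h1 (hcomp p hpE hp)
          rwa [show n + off p - (off p - Q.2 p) = n + Q.2 p by ring] at this
        · simpa only [hoff, hpE, if_false] using h1
    rw [e1, this]
    exact abs_sub _ _
  · have : (NS S E off).filter (fun n => ∀ p ∈ Q.1, (p:ℤ) ∣ n + Q.2 p) = ∅ := by
      rw [Finset.filter_eq_empty_iff]
      intro n hn h
      apply hcomp
      intro p hpE hpQ
      have h1 := (Finset.mem_filter.1 hn).2 p hpE
      have := dvd_sub h1 (h p hpQ)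
      rwa [show n + off p - (n + Q.2 p) = off p - Q.2 p by ring] at this
    rw [e1, this]
    simp

theorem FF_expand (S : Finset ℤ) (ψ : ℤ → ℝ) (E : Finset ℕ) (off : ℕ → ℤ) (l0 : List Ev)
    (Bd : Finset ℕ → ℝ) (hBd : ∀ E, 0 ≤ Bd E)
    (hB : ∀ Q ∈ l0, ¬ Q.1 ⊆ E → ∀ off' l', l'.Sublist l0 → |FF S ψ (E ∪ Q.1) off' l'| ≤ Bd (E ∪ Q.1))
    (l : List Ev) (hl : l.Sublist l0) :
    |FF S ψ E off l| ≤ |FF S ψ E off []| + (l0.map fun Q => if Q.1 ⊆ E then 0 else Bd (E ∪ Q.1)).sum := by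
  have key : |FF S ψ E off l| ≤ |FF S ψ E off []| + (l.map fun Q => if Q.1 ⊆ E then 0 else Bd (E ∪ Q.1)).sum := by
    induction l with
    | nil => simp
    | cons Q l ih =>
      have hl' : l.Sublist l0 := (List.sublist_cons_self Q l).trans hl
      have i := ih hl'
      rw [List.map_cons, List.sum_cons]
      by_cases h : Q.1 ⊆ E
      · rw [if_pos h]
        have := FF_cons_sub S ψ E off Q l h
        linarith
      · rw [if_neg h]
        obtain ⟨off', h1⟩ := FF_cons S ψ E off Q l
        have := hB Q (hl.subset (by simp)) h off' l hl'
        linarith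
  refine key.trans ?_
  gcongr
  refine List.Sublist.sum_le_sum (hl.map _) ?_
  intro a ha
  obtain ⟨Q, _, rfl⟩ := List.mem_map.1 ha
  split_ifs
  · exact le_rfl
  · exact hBd _

noncomputable def Xi {ι : Type*} (wd : Finset ι) (Eq : ι → Finset ℕ) (m err : ℝ) (lf : Finset ℕ → ℝ) :
    ℕ → Finset ℕ → ℝ
  | 0, E => lf E
  | i + 1, E => err + m * ∑ q ∈ wd, if Eq q ⊆ E then 0 else Xi wd Eq m err lf i (E ∪ Eq q)

theorem Xi_nonneg {ι : Type*} (wd : Finset ι) (Eq : ι → Finset ℕ) (m err : ℝ) (lf : Finset ℕ → ℝ)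
    (hm : 0 ≤ m) (he : 0 ≤ err) (hlf : ∀ E, 0 ≤ lf E) (i : ℕ) (E : Finset ℕ) :
    0 ≤ Xi wd Eq m err lf i E := by
  induction i generalizing E with
  | zero => exact hlf E
  | succ i ih =>
    have : 0 ≤ ∑ q ∈ wd, if Eq q ⊆ E then 0 else Xi wd Eq m err lf i (E ∪ Eq q) :=
      Finset.sum_nonneg fun q _ => by split_ifs; exacts [le_rfl, ih _]
    simp only [Xi]; positivity

theorem FF_Xi {ι : Type*} (wd : Finset ι) (Eq : ι → Finset ℕ) (m err : ℝ) (lf : Finset ℕ → ℝ)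
    (hm : 0 ≤ m) (he : 0 ≤ err) (hlf : ∀ E, 0 ≤ lf E) (P : Finset ℕ) (G1 J : ℕ) (hG1 : 1 ≤ G1)
    (hEq : ∀ q ∈ wd, Eq q ⊆ P ∧ (Eq q).card ≤ G1)
    (S : Finset ℤ) (ψ : ℤ → ℝ) (l0 : List Ev) (hl0 : ∀ Q ∈ l0, ∃ q ∈ wd, Q.1 = Eq q)
    (hl0s : ∀ f : Finset ℕ → ℝ, (∀ E, 0 ≤ f E) → (l0.map fun Q => f Q.1).sum ≤ m * ∑ q ∈ wd, f (Eq q))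
    (hleaf : ∀ E off, E ⊆ P → E.card ≤ J → ∑ n ∈ NS S E off, |ψ n| ≤ lf E)
    (herr : ∀ E off, E ⊆ P → E.card < J → |∑ n ∈ NS S E off, ψ n| ≤ err)
    (i : ℕ) (E : Finset ℕ) (off : ℕ → ℤ) (hE : E ⊆ P) (hc : E.card + i * G1 ≤ J) (l : List Ev)
    (hl : l.Sublist l0) : |FF S ψ E off l| ≤ Xi wd Eq m err lf i E := by
  induction i generalizing E off l with
  | zero =>
    simp only [Xi]
    refine le_trans ?_ (hleaf E off hE (by omega))
    refine (Finset.abs_sum_le_sum_abs _ _).trans ?_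
    refine Finset.sum_le_sum fun n _ => ?_
    rw [abs_mul]
    have : |(l.map fun Q => 1 - xQ Q n).prod| ≤ 1 := by
      clear hl
      induction l with
      | nil => simp
      | cons Q l ih =>
        rw [List.map_cons, List.prod_cons, abs_mul]
        refine mul_le_one₀ ?_ (abs_nonneg _) ih
        unfold xQ; split_ifs <;> simp
    nlinarith [abs_nonneg (ψ n)]
  | succ i ih =>
    simp only [Xi]
    have hcs : E.card + i * G1 + G1 ≤ J := by rw [add_mul, one_mul] at hc; omega
    have h1 := FF_expand S ψ E off l0 (Xi wd Eq m err lf i) (Xi_nonneg wd Eq m err lf hm he hlf i) (by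
      intro Q hQ hQE off' l' hl'
      obtain ⟨q, hq, hqe⟩ := hl0 Q hQ
      have h2 := hEq q hq
      refine ih (E ∪ Q.1) off' (Finset.union_subset hE (hqe ▸ h2.1)) ?_ l' hl'
      have := Finset.card_union_le E Q.1
      rw [← hqe] at h2
      omega) l hl
    have h2 := hl0s (fun E' => if E' ⊆ E then 0 else Xi wd Eq m err lf i (E ∪ E')) (by
      intro E'; split_ifs; exacts [le_rfl, Xi_nonneg wd Eq m err lf hm he hlf i _])
    have h3 : |FF S ψ E off []| ≤ err := by
      have : FF S ψ E off [] = ∑ n ∈ NS S E off, ψ n := by simp [FF]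
      rw [this]
      exact herr E off hE (by omega)
    linarith

/-- summed version -/
theorem Xi_sum {ι κ : Type*} (wd : Finset ι) (Eq : ι → Finset ℕ) (m err : ℝ) (lf : κ → Finset ℕ → ℝ)
    (WW : Finset κ) (hm : 0 ≤ m) (he : 0 ≤ err) (P : Finset ℕ) (G1 J : ℕ)
    (hEq : ∀ q ∈ wd, Eq q ⊆ P ∧ (Eq q).card ≤ G1) (c η Hg : ℝ) (hc : 0 ≤ c) (hη0 : 0 ≤ η) (hHg : 0 ≤ Hg)
    (hleaf : ∀ E, E ⊆ P → E.card ≤ J → ∑ W ∈ WW, lf W E ≤ c * wt E)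
    (hη : ∀ E, E ⊆ P → E.card ≤ J → m * ∑ q ∈ wd, (if Eq q ⊆ E then 0 else wt (Eq q \ E)) ≤ η)
    (hcnt : ∀ E, E ⊆ P → E.card ≤ J → m * ∑ q ∈ wd, (if Eq q ⊆ E then 0 else (1:ℝ)) ≤ Hg)
    (i : ℕ) (E : Finset ℕ) (hE : E ⊆ P) (hc' : E.card + i * G1 ≤ J) :
    ∑ W ∈ WW, Xi wd Eq m err (lf W) i E ≤ WW.card * err * (1 + Hg) ^ i + c * η ^ i * wt E := by
  induction i generalizing E with
  | zero =>
    simp only [Xi, pow_zero, mul_one]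
    have := hleaf E hE (by omega)
    have : 0 ≤ WW.card * err := by positivity
    linarith
  | succ i ih =>
    have hcs : E.card + i * G1 + G1 ≤ J := by rw [add_mul, one_mul] at hc'; omega
    simp only [Xi]
    rw [Finset.sum_add_distrib, ← Finset.mul_sum, Finset.sum_comm]
    have h1 : ∑ q ∈ wd, ∑ W ∈ WW, (if Eq q ⊆ E then 0 else Xi wd Eq m err (lf W) i (E ∪ Eq q)) ≤
        ∑ q ∈ wd, ((WW.card * err * (1 + Hg) ^ i) * (if Eq q ⊆ E then 0 else (1:ℝ)) +
          (c * η ^ i * wt E) * (if Eq q ⊆ E then 0 else wt (Eq q \ E))) := by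
      refine Finset.sum_le_sum fun q hq => ?_
      by_cases h : Eq q ⊆ E
      · simp [h]
      · simp only [h, if_false]
        have hq' := hEq q hq
        have := ih (E ∪ Eq q) (Finset.union_subset hE hq'.1) (by
          have := Finset.card_union_le E (Eq q); omega)
        refine this.trans (le_of_eq ?_)
        have : wt (E ∪ Eq q) = wt E * wt (Eq q \ E) := by
          unfold wt
          rw [← Finset.union_sdiff_self_eq_union, Finset.prod_union Finset.disjoint_sdiff]
        rw [this]; ring
    rw [Finset.sum_add_distrib, ← Finset.mul_sum, ← Finset.mul_sum] at h1
    have h2 := mul_le_mul_of_nonneg_left h1 hm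
    have h3 := mul_le_mul_of_nonneg_left (hη E hE (by omega)) (mul_nonneg (mul_nonneg hc (pow_nonneg hη0 i)) (wt_nonneg E))
    have h4 := mul_le_mul_of_nonneg_left (hcnt E hE (by omega))
      (mul_nonneg (mul_nonneg (Nat.cast_nonneg WW.card) he) (pow_nonneg (by linarith : 0 ≤ 1 + Hg) i))
    have h5 : (WW.card : ℝ) * err ≤ WW.card * err * (1 + Hg) ^ i := by
      have : 1 ≤ (1 + Hg) ^ i := one_le_pow₀ (by linarith)
      nlinarith [mul_nonneg (Nat.cast_nonneg (α := ℝ) WW.card) he]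
    rw [Finset.sum_const, nsmul_eq_mul, pow_succ, pow_succ]
    nlinarith
end PartFourC

section PartFourD
open scoped Classical

noncomputable def lets (P : Finset ℕ) (g : ℕ) : Finset (ℕ × ℤ) := P ×ˢ (Finset.Icc (-(g:ℤ)) g).erase 0

theorem mem_lets {P : Finset ℕ} {g : ℕ} {a : ℕ × ℤ} : a ∈ lets P g ↔ a.1 ∈ P ∧ a.2 ≠ 0 ∧ |a.2| ≤ g := by
  simp [lets, abs_le]

noncomputable def wdata (P : Finset ℕ) (g : ℕ) : Finset (ℕ × List (ℕ × ℤ)) :=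
  (P ×ˢ (Finset.range (g+1)).biUnion (fun m => words (lets P g) m)).filter (IsWit P g)

def Eqs (q : ℕ × List (ℕ × ℤ)) : Finset ℕ := insert q.1 (q.2.map Prod.fst).toFinset

theorem mem_wdata {P : Finset ℕ} {g : ℕ} {q : ℕ × List (ℕ × ℤ)} : q ∈ wdata P g ↔ IsWit P g q := by
  unfold wdata
  rw [Finset.mem_filter, Finset.mem_product, Finset.mem_biUnion]
  refine ⟨fun h => h.2, fun h => ⟨⟨h.1, q.2.length, ?_, ?_⟩, h⟩⟩
  · have := h.2.1
    simp; omega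
  · rw [mem_words]
    exact ⟨rfl, fun a ha => mem_lets.2 (h.2.2.1 a ha)⟩

theorem Eqs_sub {P : Finset ℕ} {g : ℕ} {q : ℕ × List (ℕ × ℤ)} (h : IsWit P g q) :
    Eqs q ⊆ P ∧ (Eqs q).card ≤ g + 1 := by
  constructor
  · intro p hp
    rw [Eqs, Finset.mem_insert, List.mem_toFinset, List.mem_map] at hp
    rcases hp with rfl | ⟨a, ha, rfl⟩
    · exact h.1
    · exact (h.2.2.1 a ha).1
  · refine (Finset.card_insert_le _ _).trans ?_
    have := List.toFinset_card_le (q.2.map Prod.fst)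
    rw [List.length_map] at this
    have := h.2.1
    omega

theorem path_off (l : List (ℕ × ℤ)) (hl : (l.map Prod.fst).Nodup) (v : ℤ) :
    ∃ off : ℕ → ℤ, ∀ n : ℤ, pathR (fun p v => (p:ℤ) ∣ v) (n + v) l ↔
      ∀ p ∈ (l.map Prod.fst).toFinset, (p:ℤ) ∣ n + off p := by
  induction l generalizing v with
  | nil => exact ⟨fun _ => 0, fun n => by simp [pathR]⟩
  | cons a l ih =>
    rw [List.map_cons, List.nodup_cons] at hl
    obtain ⟨off, ho⟩ := ih hl.2 (v + a.2 * a.1)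
    refine ⟨Function.update off a.1 v, fun n => ?_⟩
    simp only [pathR]
    rw [add_assoc, ho]
    simp only [List.map_cons, List.toFinset_cons, Finset.forall_mem_insert, Function.update_self]
    refine and_congr_right fun _ => forall₂_congr fun p hp => ?_
    rw [Function.update_of_ne]
    rintro rfl
    exact hl.1 (List.mem_toFinset.1 hp)

theorem ev_off (P : Finset ℕ) (g : ℕ) (q : ℕ × List (ℕ × ℤ)) (hq : IsWit P g q) (v : ℤ) :
    ∃ off : ℕ → ℤ, ∀ n : ℤ, ((q.1:ℤ) ∣ n + v ∧ pathR (fun p v => (p:ℤ) ∣ v) (n + v) q.2) ↔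
      ∀ p ∈ Eqs q, (p:ℤ) ∣ n + off p := by
  have := path_off ((q.1, 0) :: q.2) (by
    rw [List.map_cons, List.nodup_cons]
    exact ⟨hq.2.2.2.2.1, hq.2.2.2.1⟩) v
  obtain ⟨off, ho⟩ := this
  refine ⟨off, fun n => ?_⟩
  have := ho n
  simp only [pathR, zero_mul, add_zero] at this
  rw [this]; simp [Eqs]

noncomputable def om (E : Finset ℕ) (p : ℕ) : ℝ := if p ∈ E then 1 else 1 / (p:ℝ)

theorem om_nonneg (E : Finset ℕ) (p : ℕ) : 0 ≤ om E p := by unfold om; split_ifs <;> positivity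

theorem om_le_one (E : Finset ℕ) (p : ℕ) : om E p ≤ 1 := by
  unfold om; split_ifs
  · exact le_rfl
  · rcases Nat.eq_zero_or_pos p with h | h
    · simp [h]
    · rw [div_le_one (by exact_mod_cast h)]; exact_mod_cast h

theorem om_sum (P E : Finset ℕ) (L : ℝ) (hL : ∑ p ∈ P, 1 / (p:ℝ) = L) :
    ∑ p ∈ P, om E p ≤ E.card + L := by
  have : ∀ p ∈ P, om E p ≤ (if p ∈ E then 1 else 0) + 1 / (p:ℝ) := by
    intro p _; unfold om
    have : 0 ≤ 1 / (p:ℝ) := by positivity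
    split_ifs <;> linarith
  refine (Finset.sum_le_sum this).trans ?_
  rw [Finset.sum_add_distrib, hL, ← Finset.sum_filter, Finset.sum_const, nsmul_eq_mul, mul_one]
  gcongr
  intro p hp; exact (Finset.mem_filter.1 hp).2

theorem wt_sdiff (E K : Finset ℕ) : wt (K \ E) = ∏ p ∈ K, om E p := by
  unfold wt om
  rw [Finset.sdiff_eq_filter, Finset.prod_filter]
  refine Finset.prod_congr rfl fun p _ => ?_
  by_cases h : p ∈ E <;> simp [h]

noncomputable def oml (E : Finset ℕ) (l : List (ℕ × ℤ)) : ℝ := (l.map fun a => om E a.1).prod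

theorem oml_nonneg (E : Finset ℕ) (l : List (ℕ × ℤ)) : 0 ≤ oml E l := by
  unfold oml
  refine List.prod_nonneg fun a ha => ?_
  obtain ⟨b, _, rfl⟩ := List.mem_map.1 ha
  exact om_nonneg _ _

theorem wt_Eqs {P : Finset ℕ} {g : ℕ} (E : Finset ℕ) {q : ℕ × List (ℕ × ℤ)} (h : IsWit P g q) :
    wt (Eqs q \ E) = om E q.1 * oml E q.2 := by
  rw [wt_sdiff, Eqs, Finset.prod_insert (by rw [List.mem_toFinset]; exact h.2.2.2.2.1)]
  congr 1
  rw [List.prod_toFinset _ h.2.2.2.1, List.map_map]; rfl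

theorem lets_om (P E : Finset ℕ) (g : ℕ) (L R : ℝ) (hL : ∑ p ∈ P, 1 / (p:ℝ) = L) (hR : 2 * g * (E.card + L) ≤ R) :
    ∑ a ∈ lets P g, om E a.1 ≤ R := by
  unfold lets
  rw [Finset.sum_product]
  simp only [Finset.sum_const, nsmul_eq_mul]
  rw [← Finset.mul_sum]
  have : ((Finset.Icc (-(g:ℤ)) g).erase 0).card = 2 * g := by
    rw [Finset.card_erase_of_mem (by simp), Int.card_Icc]; omega
  rw [this]; push_cast
  have := om_sum P E L hL
  refine le_trans ?_ hR
  gcongr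

theorem sum_oml (P E : Finset ℕ) (g : ℕ) (L R : ℝ) (hL : ∑ p ∈ P, 1 / (p:ℝ) = L) (hR : 2 * g * (E.card + L) ≤ R)
    (m : ℕ) : ∑ l ∈ words (lets P g) m, oml E l ≤ R ^ m := by
  induction m with
  | zero => rw [sum_words_zero]; simp [oml]
  | succ m ih =>
    rw [sum_words_succ]
    have : ∀ a ∈ lets P g, ∑ w ∈ words (lets P g) m, oml E (a :: w) ≤ om E a.1 * R ^ m := by
      intro a _
      simp only [oml, List.map_cons, List.prod_cons]
      rw [← Finset.mul_sum]
      exact mul_le_mul_of_nonneg_left ih (om_nonneg _ _)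
    refine (Finset.sum_le_sum this).trans ?_
    rw [← Finset.sum_mul, pow_succ, mul_comm]
    have h0 : 0 ≤ R := le_trans (Finset.sum_nonneg fun a _ => om_nonneg E a.1) (lets_om P E g L R hL hR)
    exact mul_le_mul_of_nonneg_left (lets_om P E g L R hL hR) (by positivity)

theorem fresh_sum (P E : Finset ℕ) (g : ℕ) (L R ε : ℝ) (hL : ∑ p ∈ P, 1 / (p:ℝ) = L) (hR : 2 * g * (E.card + L) ≤ R)
    (hR1 : 1 ≤ R) (hε0 : 0 ≤ ε) (p0 : ℕ)
    (hε : ∀ b m : ℤ, m ≠ 0 → |m| ≤ g → ∑ q ∈ P.filter (fun q => q ≠ p0 ∧ (p0:ℤ) ∣ b + m * q), 1 / (q:ℝ) ≤ ε)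
    (m : ℕ) (b : ℤ) :
    ∑ l ∈ words (lets P g) m, (if p0 ∉ l.map Prod.fst ∧ (p0:ℤ) ∣ b + runSum l ∧ (∃ a ∈ l, a.1 ∉ E) then oml E l else 0)
      ≤ m * (2 * g * ε) * R ^ m := by
  induction m generalizing b with
  | zero => rw [sum_words_zero]; simp
  | succ m ih =>
    rw [sum_words_succ]
    have h1 : ∀ a ∈ lets P g, ∀ l ∈ words (lets P g) m,
        (if p0 ∉ (a :: l).map Prod.fst ∧ (p0:ℤ) ∣ b + runSum (a :: l) ∧ (∃ a' ∈ a :: l, a'.1 ∉ E) then oml E (a :: l) else 0) ≤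
        om E a.1 * (if p0 ∉ l.map Prod.fst ∧ (p0:ℤ) ∣ (b + a.2 * a.1) + runSum l ∧ (∃ a ∈ l, a.1 ∉ E) then oml E l else 0)
        + oml E l * (if a.1 ≠ p0 ∧ (p0:ℤ) ∣ (b + runSum l) + a.2 * a.1 then 1 / (a.1:ℝ) else 0) := by
      intro a ha l hl
      have n1 := om_nonneg E a.1
      have n2 := oml_nonneg E l
      have n3 : 0 ≤ 1 / (a.1:ℝ) := by positivity
      have e1 : oml E (a :: l) = om E a.1 * oml E l := by simp [oml]
      have r1 : 0 ≤ om E a.1 * (if p0 ∉ l.map Prod.fst ∧ (p0:ℤ) ∣ (b + a.2 * a.1) + runSum l ∧ (∃ a ∈ l, a.1 ∉ E) then oml E l else 0) := by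
        split_ifs <;> positivity
      have r2 : 0 ≤ oml E l * (if a.1 ≠ p0 ∧ (p0:ℤ) ∣ (b + runSum l) + a.2 * a.1 then 1 / (a.1:ℝ) else 0) := by
        split_ifs <;> positivity
      by_cases hc : p0 ∉ (a :: l).map Prod.fst ∧ (p0:ℤ) ∣ b + runSum (a :: l) ∧ (∃ a' ∈ a :: l, a'.1 ∉ E)
      · rw [if_pos hc, e1]
        obtain ⟨c1, c2, a', ha', hf⟩ := hc
        rw [List.map_cons, List.mem_cons, not_or] at c1
        rw [runSum_cons] at c2
        rcases List.mem_cons.1 ha' with rfl | ha'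
        · have : om E a'.1 = 1 / (a'.1:ℝ) := by simp [om, hf]
          rw [this] at r1 ⊢
          rw [if_pos (c := a'.1 ≠ p0 ∧ _) ⟨Ne.symm c1.1, by convert c2 using 1; ring⟩]
          linarith
        · rw [if_pos (c := p0 ∉ l.map Prod.fst ∧ _) ⟨c1.2, by convert c2 using 1; ring, a', ha', hf⟩]
          linarith
      · rw [if_neg hc]; linarith
    refine (Finset.sum_le_sum fun a ha => Finset.sum_le_sum fun l hl => h1 a ha l hl).trans ?_
    simp only [Finset.sum_add_distrib]
    have hR0 : 0 ≤ R := by linarith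
    have h2 : ∑ a ∈ lets P g, ∑ l ∈ words (lets P g) m, om E a.1 * (if p0 ∉ l.map Prod.fst ∧ (p0:ℤ) ∣ (b + a.2 * a.1) + runSum l ∧ (∃ a ∈ l, a.1 ∉ E) then oml E l else 0)
        ≤ R * (m * (2 * g * ε) * R ^ m) := by
      calc _ ≤ ∑ a ∈ lets P g, om E a.1 * (m * (2 * g * ε) * R ^ m) := by
            refine Finset.sum_le_sum fun a _ => ?_
            rw [← Finset.mul_sum]
            exact mul_le_mul_of_nonneg_left (ih _) (om_nonneg _ _)
        _ ≤ _ := by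
            rw [← Finset.sum_mul]
            exact mul_le_mul_of_nonneg_right (lets_om P E g L R hL hR) (by positivity)
    have h3 : ∑ a ∈ lets P g, ∑ l ∈ words (lets P g) m, oml E l * (if a.1 ≠ p0 ∧ (p0:ℤ) ∣ (b + runSum l) + a.2 * a.1 then 1 / (a.1:ℝ) else 0)
        ≤ R ^ m * (2 * g * ε) := by
      rw [Finset.sum_comm]
      calc _ ≤ ∑ l ∈ words (lets P g) m, oml E l * (2 * g * ε) := by
            refine Finset.sum_le_sum fun l _ => ?_
            rw [← Finset.mul_sum]
            refine mul_le_mul_of_nonneg_left ?_ (oml_nonneg _ _)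
            unfold lets
            rw [Finset.sum_product_right]
            have hcard : ((Finset.Icc (-(g:ℤ)) g).erase 0).card = 2 * g := by
              rw [Finset.card_erase_of_mem (by simp), Int.card_Icc]; omega
            calc _ ≤ ∑ y ∈ (Finset.Icc (-(g:ℤ)) g).erase 0, ε := by
                  refine Finset.sum_le_sum fun y hy => ?_
                  rw [← Finset.sum_filter]
                  rw [Finset.mem_erase, Finset.mem_Icc] at hy
                  exact hε _ y hy.1 (abs_le.2 hy.2)
              _ = _ := by rw [Finset.sum_const, hcard, nsmul_eq_mul]; push_cast; ring
        _ ≤ _ := by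
            rw [← Finset.sum_mul]
            exact mul_le_mul_of_nonneg_right (sum_oml P E g L R hL hR m) (by positivity)
    refine (add_le_add h2 h3).trans ?_
    push_cast
    have : R ^ m * (2 * g * ε) ≤ R ^ (m+1) * (2 * g * ε) := by
      have : R ^ m ≤ R ^ (m+1) := pow_le_pow_right₀ hR1 (by omega)
      gcongr
    rw [pow_succ] at *
    nlinarith

theorem runSum_le (P : Finset ℕ) (g Hn : ℕ) (hHn : ∀ p ∈ P, p ≤ Hn) (l : List (ℕ × ℤ)) (hl : ∀ a ∈ l, a ∈ lets P g) :
    |runSum l| ≤ l.length * (g * Hn) := by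
  induction l with
  | nil => simp [runSum]
  | cons a l ih =>
    rw [runSum_cons]
    have h1 := ih fun b hb => hl b (by simp [hb])
    have h2 := mem_lets.1 (hl a (by simp))
    have h3 : |a.2 * (a.1:ℤ)| ≤ g * Hn := by
      rw [abs_mul]
      have : |(a.1:ℤ)| ≤ Hn := by rw [Nat.abs_cast]; exact_mod_cast hHn _ h2.1
      exact mul_le_mul h2.2.2 this (abs_nonneg _) (by positivity)
    have := abs_add_le (a.2 * (a.1:ℤ)) (runSum l)
    rw [List.length_cons]; push_cast
    linarith

theorem eta_bound (P E : Finset ℕ) (g Hn : ℕ) (L R ε δ : ℝ) (hHn : ∀ p ∈ P, p ≤ Hn)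
    (hL : ∑ p ∈ P, 1 / (p:ℝ) = L) (hR : 2 * g * (E.card + L) ≤ R) (hg : 1 ≤ g)
    (hR1 : 1 ≤ R) (hε0 : 0 ≤ ε) (hδ0 : 0 ≤ δ)
    (hε : ∀ p0 ∈ P, ∀ b m : ℤ, m ≠ 0 → |m| ≤ g → ∑ q ∈ P.filter (fun q => q ≠ p0 ∧ (p0:ℤ) ∣ b + m * q), 1 / (q:ℝ) ≤ ε)
    (hδ : ∀ s : ℤ, s ≠ 0 → |s| ≤ g * (g * Hn) → ∑ p ∈ P.filter (fun p : ℕ => (p:ℤ) ∣ s), 1 / (p:ℝ) ≤ δ) :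
    ∑ q ∈ wdata P g, (if Eqs q ⊆ E then 0 else wt (Eqs q \ E)) ≤ (g+1) * R ^ (g+1) * (2 * g ^ 2 * ε + δ) := by
  set A1 : ℕ × List (ℕ × ℤ) → ℝ := fun q => om E q.1 *
    (if q.1 ∉ q.2.map Prod.fst ∧ (q.1:ℤ) ∣ 0 + runSum q.2 ∧ (∃ a ∈ q.2, a.1 ∉ E) then oml E q.2 else 0) with hA1
  set A2 : ℕ × List (ℕ × ℤ) → ℝ := fun q => oml E q.2 *
    (if runSum q.2 ≠ 0 ∧ (q.1:ℤ) ∣ runSum q.2 then 1 / (q.1:ℝ) else 0) with hA2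
  have n1 : ∀ q, 0 ≤ A1 q := fun q => by
    simp only [hA1]
    have := om_nonneg E q.1
    have := oml_nonneg E q.2
    split_ifs <;> positivity
  have n2 : ∀ q, 0 ≤ A2 q := fun q => by
    simp only [hA2]
    have := oml_nonneg E q.2
    split_ifs <;> positivity
  have hR0 : 0 ≤ R := by linarith
  have s1 : ∑ q ∈ wdata P g, (if Eqs q ⊆ E then 0 else wt (Eqs q \ E)) ≤ ∑ q ∈ wdata P g, (A1 q + A2 q) := by
    refine Finset.sum_le_sum fun q hq => ?_
    rw [mem_wdata] at hq
    have m1 := n1 q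
    have m2 := n2 q
    split_ifs with hs
    · linarith
    · rw [wt_Eqs E hq]
      obtain ⟨w1, w2, w3, w4, w5, w6, w7⟩ := hq
      by_cases hf : ∃ a ∈ q.2, a.1 ∉ E
      · have : A1 q = om E q.1 * oml E q.2 := by
          simp only [hA1]; rw [if_pos ⟨w5, by rwa [zero_add], hf⟩]
        linarith
      · have hq1 : q.1 ∉ E := by
          intro h1
          apply hs
          intro p hp
          rw [Eqs, Finset.mem_insert, List.mem_toFinset, List.mem_map] at hp
          rcases hp with rfl | ⟨a, ha, rfl⟩
          · exact h1
          · by_contra h; exact hf ⟨a, ha, h⟩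
        have : A2 q = om E q.1 * oml E q.2 := by
          simp only [hA2, om]; rw [if_pos ⟨w6, w7⟩, if_neg hq1]; ring
        linarith
  refine s1.trans ?_
  have s2 : ∑ q ∈ wdata P g, (A1 q + A2 q) ≤ ∑ q ∈ P ×ˢ (Finset.range (g+1)).biUnion (fun m => words (lets P g) m), (A1 q + A2 q) :=
    Finset.sum_le_sum_of_subset_of_nonneg (Finset.filter_subset _ _) fun q _ _ => add_nonneg (n1 q) (n2 q)
  refine s2.trans ?_
  have hdisj : ∀ f : List (ℕ × ℤ) → ℝ, ∑ l ∈ (Finset.range (g+1)).biUnion (fun m => words (lets P g) m), f l =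
      ∑ m ∈ Finset.range (g+1), ∑ l ∈ words (lets P g) m, f l := by
    intro f
    refine Finset.sum_biUnion ?_
    intro i _ j _ hij
    refine Finset.disjoint_left.2 fun l h1 h2 => hij ?_
    rw [mem_words] at h1 h2
    exact h1.1.symm.trans h2.1
  rw [Finset.sum_product, Finset.sum_comm, hdisj]
  have hPs : ∑ p ∈ P, om E p ≤ R := by
    refine (om_sum P E L hL).trans (le_trans ?_ hR)
    have : 0 ≤ L := by rw [← hL]; exact Finset.sum_nonneg fun p _ => by positivity
    have h1 : (1:ℝ) ≤ g := by exact_mod_cast hg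
    nlinarith [Nat.cast_nonneg (α := ℝ) E.card]
  have s3 : ∀ m ∈ Finset.range (g+1), ∑ l ∈ words (lets P g) m, ∑ p ∈ P, (A1 (p, l) + A2 (p, l)) ≤
      R ^ (g+1) * (2 * g ^ 2 * ε + δ) := by
    intro m hm
    rw [Finset.mem_range] at hm
    simp only [Finset.sum_add_distrib]
    have t1 : ∑ l ∈ words (lets P g) m, ∑ p ∈ P, A1 (p, l) ≤ R * (m * (2 * g * ε) * R ^ m) := by
      rw [Finset.sum_comm]
      calc _ ≤ ∑ p ∈ P, om E p * (m * (2 * g * ε) * R ^ m) := by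
            refine Finset.sum_le_sum fun p hp => ?_
            simp only [hA1]
            rw [← Finset.mul_sum]
            refine mul_le_mul_of_nonneg_left ?_ (om_nonneg _ _)
            exact fresh_sum P E g L R ε hL hR hR1 hε0 p (hε p hp) m 0
        _ ≤ _ := by
            rw [← Finset.sum_mul]
            exact mul_le_mul_of_nonneg_right hPs (by positivity)
    have t2 : ∑ l ∈ words (lets P g) m, ∑ p ∈ P, A2 (p, l) ≤ R ^ m * δ := by
      calc _ ≤ ∑ l ∈ words (lets P g) m, oml E l * δ := by
            refine Finset.sum_le_sum fun l hl => ?_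
            simp only [hA2]
            rw [← Finset.mul_sum]
            refine mul_le_mul_of_nonneg_left ?_ (oml_nonneg _ _)
            by_cases h0 : runSum l = 0
            · simp [h0, hδ0]
            · simp only [ne_eq, h0, not_false_eq_true, true_and]
              rw [← Finset.sum_filter]
              refine hδ _ h0 ?_
              rw [mem_words] at hl
              refine (runSum_le P g Hn hHn l hl.2).trans ?_
              rw [hl.1]
              have : (m:ℤ) ≤ g := by omega
              gcongr
        _ ≤ _ := by
            rw [← Finset.sum_mul]
            exact mul_le_mul_of_nonneg_right (sum_oml P E g L R hL hR m) hδ0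
    have t3 : R ^ m ≤ R ^ (g+1) := pow_le_pow_right₀ hR1 (by omega)
    have t4 : R ^ (m+1) ≤ R ^ (g+1) := pow_le_pow_right₀ hR1 (by omega)
    have t5 : (m:ℝ) ≤ g := by exact_mod_cast (by omega : m ≤ g)
    calc _ ≤ R * (m * (2 * g * ε) * R ^ m) + R ^ m * δ := add_le_add t1 t2
      _ = R ^ (m+1) * (2 * (m * g) * ε) + R ^ m * δ := by ring
      _ ≤ R ^ (g+1) * (2 * (g * g) * ε) + R ^ (g+1) * δ := by gcongr
      _ = _ := by ring
  refine (Finset.sum_le_sum s3).trans ?_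
  rw [Finset.sum_const, Finset.card_range, nsmul_eq_mul]
  push_cast
  exact le_of_eq (by ring)

/-- counting the witnesses not contained in `E` -/
theorem eta_count (P E : Finset ℕ) (g : ℕ) (H η : ℝ) (hH : 1 ≤ H) (hP0 : ∀ p ∈ P, 0 < p) (hPH : ∀ p ∈ P, (p:ℝ) ≤ H)
    (hη : ∑ q ∈ wdata P g, (if Eqs q ⊆ E then 0 else wt (Eqs q \ E)) ≤ η) :
    ∑ q ∈ wdata P g, (if Eqs q ⊆ E then 0 else (1:ℝ)) ≤ H ^ (g+1) * η := by
  refine le_trans ?_ (mul_le_mul_of_nonneg_left hη (by positivity))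
  rw [Finset.mul_sum]
  refine Finset.sum_le_sum fun q hq => ?_
  rw [mem_wdata] at hq
  split_ifs with h
  · simp
  · have hs := Eqs_sub hq
    have h1 : (1 / H) ^ (Eqs q \ E).card ≤ wt (Eqs q \ E) := by
      unfold wt
      rw [← Finset.prod_const]
      refine Finset.prod_le_prod (fun _ _ => by positivity) fun p hp => ?_
      have hp' := hs.1 (Finset.mem_sdiff.1 hp).1
      have := hP0 p hp'
      exact one_div_le_one_div_of_le (by exact_mod_cast this) (hPH p hp')
    have h2 : (Eqs q \ E).card ≤ g + 1 := (Finset.card_le_card Finset.sdiff_subset).trans hs.2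
    have h3 : (1 / H) ^ (g+1) ≤ (1 / H) ^ (Eqs q \ E).card :=
      pow_le_pow_of_le_one (by positivity) (by rw [div_le_one (by linarith)]; exact hH) h2
    have h4 : H ^ (g+1) * (1 / H) ^ (g+1) = 1 := by
      rw [← mul_pow, mul_one_div_cancel (by linarith), one_pow]
    have : 0 < H ^ (g+1) := by positivity
    nlinarith
end PartFourD

section PartFourE
open scoped Classical

noncomputable def x1 (P : Finset ℕ) (g : ℕ) (β : ℤ → ℤ → ℝ) (n d : ℤ) : ℝ :=
  if Yb P g n ∨ Yb P g (n + d) then 0 else x0 β n d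

noncomputable def offc (P : Finset ℕ) (g : ℕ) (v : ℤ) (q : ℕ × List (ℕ × ℤ)) : ℕ → ℤ :=
  if h : IsWit P g q then (ev_off P g q h v).choose else fun _ => 0

theorem offc_spec (P : Finset ℕ) (g : ℕ) (v : ℤ) (q : ℕ × List (ℕ × ℤ)) (h : IsWit P g q) (n : ℤ) :
    ((q.1:ℤ) ∣ n + v ∧ pathR (fun p v => (p:ℤ) ∣ v) (n + v) q.2) ↔
      ∀ p ∈ Eqs q, (p:ℤ) ∣ n + offc P g v q p := by
  unfold offc; rw [dif_pos h]
  exact (ev_off P g q h v).choose_spec n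

noncomputable def evs (P : Finset ℕ) (g : ℕ) (v : ℤ) : List Ev :=
  (wdata P g).toList.map fun q => (Eqs q, offc P g v q)

theorem evs_prod (P : Finset ℕ) (g : ℕ) (v n : ℤ) :
    ((evs P g v).map fun Q => 1 - xQ Q n).prod = if Yb P g (n + v) then 0 else 1 := by
  unfold evs
  rw [List.map_map, Finset.prod_map_toList]
  split_ifs with h
  · obtain ⟨q, hq, h1, h2⟩ := h
    refine Finset.prod_eq_zero (mem_wdata.2 hq) ?_
    simp only [Function.comp, xQ]
    rw [if_pos ((offc_spec P g v q hq n).1 ⟨h1, h2⟩)]; simp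
  · refine Finset.prod_eq_one fun q hq => ?_
    rw [mem_wdata] at hq
    simp only [Function.comp, xQ]
    rw [if_neg]
    · simp
    · intro h3
      have := (offc_spec P g v q hq n).2 h3
      exact h ⟨q, hq, this.1, this.2⟩

noncomputable def l0s (P : Finset ℕ) (g : ℕ) (W : List (ℤ × ℤ)) : List Ev :=
  W.flatMap fun a => evs P g a.1 ++ evs P g (a.1 + a.2)

theorem x1_prod (P : Finset ℕ) (g : ℕ) (β : ℤ → ℤ → ℝ) (W : List (ℤ × ℤ)) (n : ℤ) :
    (W.map fun a => x1 P g β (n + a.1) a.2).prod = psi β W n * ((l0s P g W).map fun Q => 1 - xQ Q n).prod := by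
  induction W with
  | nil => simp [psi, l0s]
  | cons a W ih =>
    have e : l0s P g (a :: W) = (evs P g a.1 ++ evs P g (a.1 + a.2)) ++ l0s P g W := by simp [l0s]
    rw [e, List.map_append, List.prod_append, List.map_append, List.prod_append, evs_prod, evs_prod,
      List.map_cons, List.prod_cons, ih]
    simp only [psi, List.map_cons, List.prod_cons, x1, add_assoc]
    by_cases h1 : Yb P g (n + a.1) <;> by_cases h2 : Yb P g (n + (a.1 + a.2)) <;> simp [h1, h2] <;> ring

theorem l0s_mem (P : Finset ℕ) (g : ℕ) (W : List (ℤ × ℤ)) : ∀ Q ∈ l0s P g W, ∃ q ∈ wdata P g, Q.1 = Eqs q := by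
  intro Q hQ
  simp only [l0s, evs, List.mem_flatMap, List.mem_append, List.mem_map, Finset.mem_toList] at hQ
  obtain ⟨a, _, ⟨q, hq, rfl⟩ | ⟨q, hq, rfl⟩⟩ := hQ <;> exact ⟨q, hq, rfl⟩

theorem l0s_sum (P : Finset ℕ) (g : ℕ) (W : List (ℤ × ℤ)) (f : Finset ℕ → ℝ) :
    ((l0s P g W).map fun Q => f Q.1).sum = (2 * W.length : ℝ) * ∑ q ∈ wdata P g, f (Eqs q) := by
  have h : ∀ v, ((evs P g v).map fun Q => f Q.1).sum = ∑ q ∈ wdata P g, f (Eqs q) := by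
    intro v
    unfold evs
    rw [List.map_map]
    exact Finset.sum_map_toList _ _
  induction W with
  | nil => simp [l0s]
  | cons a W ih =>
    have e : l0s P g (a :: W) = (evs P g a.1 ++ evs P g (a.1 + a.2)) ++ l0s P g W := by simp [l0s]
    rw [e, List.map_append, List.sum_append, List.map_append, List.sum_append, h, h, ih]
    push_cast [List.length_cons]; ring

theorem wt_ins (E K : Finset ℕ) (a : ℕ) : wt (insert a K \ E) = om E a * wt (K \ insert a E) := by
  by_cases ha : a ∈ E
  · simp only [om, ha, if_true, one_mul, Finset.insert_sdiff_of_mem, Finset.insert_eq_of_mem]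
  · have : insert a K \ E = insert a (K \ insert a E) := by ext; simp; grind
    rw [this]
    unfold wt
    rw [Finset.prod_insert (by simp)]
    simp [om, ha]

theorem steps_om (P E : Finset ℕ) (hP : ∀ p ∈ P, 0 < p) (L : ℝ) (hL : ∑ p ∈ P, 1 / (p:ℝ) = L) :
    ∑ d ∈ steps P, om E d.natAbs ≤ 2 * (E.card + L) := by
  rw [sum_steps hP]
  simp only [Int.natAbs_natCast, Int.natAbs_neg]
  have := om_sum P E L hL
  rw [Finset.sum_add_distrib]; linarith

theorem words_wt (P E : Finset ℕ) (hP : ∀ p ∈ P, 0 < p) (L R : ℝ) (hL : ∑ p ∈ P, 1 / (p:ℝ) = L) (j : ℕ)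
    (hR : 2 * (E.card + j + L) ≤ R) :
    ∑ w ∈ words (steps P) j, wt (primesOf w \ E) ≤ R ^ j := by
  have hL0 : 0 ≤ L := by rw [← hL]; exact Finset.sum_nonneg fun p _ => by positivity
  have hR0 : 0 ≤ R := le_trans (by positivity) hR
  induction j generalizing E with
  | zero => rw [sum_words_zero]; simp [primesOf, wt]
  | succ j ih =>
    rw [sum_words_succ]
    calc _ ≤ ∑ d ∈ steps P, om E d.natAbs * R ^ j := by
          refine Finset.sum_le_sum fun d _ => ?_
          have : ∀ w ∈ words (steps P) j, wt (primesOf (d :: w) \ E) = om E d.natAbs * wt (primesOf w \ insert d.natAbs E) := by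
            intro w _
            rw [← wt_ins]; simp [primesOf]
          rw [Finset.sum_congr rfl this, ← Finset.mul_sum]
          refine mul_le_mul_of_nonneg_left (ih _ ?_) (om_nonneg _ _)
          refine le_trans ?_ hR
          have : ((insert d.natAbs E).card : ℝ) ≤ E.card + 1 := by exact_mod_cast Finset.card_insert_le _ _
          push_cast; linarith
      _ ≤ _ := by
          rw [← Finset.sum_mul, pow_succ, mul_comm]
          refine mul_le_mul_of_nonneg_left ?_ (by positivity)
          refine (steps_om P E hP L hL).trans (le_trans ?_ hR)
          push_cast
          linarith [Nat.cast_nonneg (α := ℝ) j]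

theorem pair_wt (P E : Finset ℕ) (hP : ∀ p ∈ P, 0 < p) (L R : ℝ) (hL : ∑ p ∈ P, 1 / (p:ℝ) = L) (k : ℕ)
    (hR : 2 * (E.card + 2 * k + L) ≤ R) :
    ∑ w ∈ words (steps P) k, ∑ w' ∈ words (steps P) k, wt (E ∪ (primesOf w ∪ primesOf w')) ≤ R ^ (2*k) * wt E := by
  have hL0 : 0 ≤ L := by rw [← hL]; exact Finset.sum_nonneg fun p _ => by positivity
  have hR0 : 0 ≤ R := le_trans (by positivity) hR
  have key : ∀ A B : Finset ℕ, wt (A ∪ B) = wt A * wt (B \ A) := by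
    intro A B
    unfold wt
    rw [← Finset.union_sdiff_self_eq_union, Finset.prod_union Finset.disjoint_sdiff]
  calc _ ≤ ∑ w ∈ words (steps P) k, wt E * wt (primesOf w \ E) * R ^ k := by
        refine Finset.sum_le_sum fun w hw => ?_
        simp only [← Finset.union_assoc]
        simp only [key (E ∪ primesOf w), key E]
        rw [← Finset.mul_sum]
        refine mul_le_mul_of_nonneg_left ?_ (mul_nonneg (wt_nonneg _) (wt_nonneg _))
        refine words_wt P _ hP L R hL k (le_trans ?_ hR)
        have h1 : (E ∪ primesOf w).card ≤ E.card + k := by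
          refine (Finset.card_union_le _ _).trans ?_
          gcongr
          refine (List.toFinset_card_le _).trans ?_
          rw [List.length_map, (mem_words _ _ _).1 hw |>.1]
        have : ((E ∪ primesOf w).card : ℝ) ≤ E.card + k := by exact_mod_cast h1
        linarith
    _ ≤ _ := by
        rw [← Finset.sum_mul, ← Finset.mul_sum, two_mul, pow_add]
        have := words_wt P E hP L R hL k (by linarith [Nat.cast_nonneg (α := ℝ) k])
        have h2 : wt E * ∑ w ∈ words (steps P) k, wt (primesOf w \ E) ≤ wt E * R ^ k :=
          mul_le_mul_of_nonneg_left this (wt_nonneg _)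
        have h3 := mul_le_mul_of_nonneg_right h2 (by positivity : 0 ≤ R ^ k)
        linarith

theorem card_steps (P : Finset ℕ) (hP : ∀ p ∈ P, 0 < p) : ((steps P).card : ℝ) = 2 * P.card := by
  have := sum_steps hP (fun _ => 1)
  simp at this
  rw [this]; ring

theorem card_words {α : Type*} (A : Finset α) (k : ℕ) : ((words A k).card : ℝ) = (A.card : ℝ) ^ k := by
  induction k with
  | zero => simp [words]
  | succ k ih =>
    have := sum_words_succ A k (fun _ => 1)
    simp only [Finset.sum_const, nsmul_eq_mul, mul_one] at this
    rw [this, ih]; ring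

theorem pW_edges (w w' : List ℤ) : pW (edges 0 w ++ edges 0 w') = primesOf w ∪ primesOf w' := by
  have h : ∀ w, (edges 0 w).map (fun a => a.2.natAbs) = w.map Int.natAbs := by
    intro w
    conv_rhs => rw [← edges_snd 0 w]
    rw [List.map_map]; rfl
  unfold pW primesOf
  rw [List.map_append, h, h, List.toFinset_append]

theorem edges_len (u : ℤ) (w : List ℤ) : (edges u w).length = w.length := by
  conv_rhs => rw [← edges_snd u w]
  rw [List.length_map]

theorem caseB_total (P : Finset ℕ) (hP : ∀ p ∈ P, p.Prime) (g k um j J : ℕ) (β : ℤ → ℤ → ℝ) (hβ : ∀ n d, |β n d| ≤ 1)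
    (M : ℕ) (hM : 0 < M) (hMp : ∀ p ∈ P, Nat.Coprime M p) (hper : ∀ n d, β (n + M) d = β n d)
    (a b : ℤ) (hab : a ≤ b) (H : ℝ) (hH1 : 1 ≤ H) (hH : ∀ p ∈ P, (p:ℝ) ≤ H)
    (A : ℝ) (hA : 0 ≤ A)
    (hS : ∀ K off, K ⊆ P → K.card ≤ J + 2 * k → ((NS (Finset.Ioc a b) K off).card : ℝ) ≤ A * wt K)
    (L R : ℝ) (hL : ∑ p ∈ P, 1 / (p:ℝ) = L) (hR : 2 * (J + 2 * k + L) ≤ R)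
    (hJ : j * (g+1) ≤ J) (hJu : J + 2 * k ≤ 2 * um + 2) (η : ℝ) (hη0 : 0 ≤ η)
    (hη : ∀ E, E ⊆ P → E.card ≤ J → (4 * k : ℝ) * ∑ q ∈ wdata P g, (if Eqs q ⊆ E then 0 else wt (Eqs q \ E)) ≤ η) :
    ∑ w ∈ words (steps P) k, ∑ w' ∈ words (steps P) k,
      (if (primesOf w ∪ primesOf w').card ≤ um then 0 else
        |∑ n ∈ Finset.Ioc a b, Hw (x1 P g β) n w * Hw (x1 P g β) n w'|) ≤
    (2 * P.card) ^ (2*k) * (2 * (M * H ^ (J + 2*k))) * (1 + H ^ (g+1) * η) ^ j + (4 ^ k * A * R ^ (2*k)) * η ^ j := by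
  have hP0 : ∀ p ∈ P, 0 < p := fun p hp => (hP p hp).pos
  set WW : Finset (List ℤ × List ℤ) := (words (steps P) k ×ˢ words (steps P) k).filter
    (fun w => ¬ (primesOf w.1 ∪ primesOf w.2).card ≤ um) with hWW
  set Wf : List ℤ × List ℤ → List (ℤ × ℤ) := fun w => edges 0 w.1 ++ edges 0 w.2 with hWf
  set lf : List ℤ × List ℤ → Finset ℕ → ℝ := fun w E => 4 ^ k * A * wt (E ∪ (primesOf w.1 ∪ primesOf w.2)) with hlf
  set err : ℝ := 2 * (M * H ^ (J + 2*k)) with herr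
  have he0 : 0 ≤ err := by positivity
  have hEq : ∀ q ∈ wdata P g, Eqs q ⊆ P ∧ (Eqs q).card ≤ g + 1 := fun q hq => Eqs_sub (mem_wdata.1 hq)
  rw [← Finset.sum_product']
  have e1 : ∀ w : List ℤ × List ℤ, (if (primesOf w.1 ∪ primesOf w.2).card ≤ um then (0:ℝ) else
        |∑ n ∈ Finset.Ioc a b, Hw (x1 P g β) n w.1 * Hw (x1 P g β) n w.2|) =
      if ¬ (primesOf w.1 ∪ primesOf w.2).card ≤ um then 
        |∑ n ∈ Finset.Ioc a b, Hw (x1 P g β) n w.1 * Hw (x1 P g β) n w.2| else 0 := by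
    intro w; rw [ite_not]
  rw [Finset.sum_congr rfl fun w _ => e1 w, ← Finset.sum_filter, ← hWW]
  have e2 : ∀ w ∈ WW, |∑ n ∈ Finset.Ioc a b, Hw (x1 P g β) n w.1 * Hw (x1 P g β) n w.2| ≤
      Xi (wdata P g) Eqs (4 * k) err (lf w) j ∅ := by
    intro w hw
    rw [hWW, Finset.mem_filter, Finset.mem_product, mem_words, mem_words] at hw
    obtain ⟨⟨⟨l1, m1⟩, l2, m2⟩, hcard⟩ := hw
    have hlen : (Wf w).length = 2 * k := by simp only [hWf, List.length_append, edges_len, l1, l2]; ring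
    have hmem : ∀ a ∈ Wf w, a.2.natAbs ∈ P := by
      intro a ha
      simp only [hWf, List.mem_append] at ha
      rcases ha with ha | ha
      · have : a.2 ∈ w.1 := by rw [← edges_snd 0 w.1]; exact List.mem_map_of_mem ha
        exact mem_steps.1 (m1 _ this)
      · have : a.2 ∈ w.2 := by rw [← edges_snd 0 w.2]; exact List.mem_map_of_mem ha
        exact mem_steps.1 (m2 _ this)
    have hpW : pW (Wf w) = primesOf w.1 ∪ primesOf w.2 := pW_edges _ _
    have e3 : ∑ n ∈ Finset.Ioc a b, Hw (x1 P g β) n w.1 * Hw (x1 P g β) n w.2 =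
        FF (Finset.Ioc a b) (psi β (Wf w)) ∅ (fun _ => 0) (l0s P g (Wf w)) := by
      unfold FF
      have : NS (Finset.Ioc a b) ∅ (fun _ => 0) = Finset.Ioc a b := by simp [NS]
      rw [this]
      refine Finset.sum_congr rfl fun n _ => ?_
      have h1 := Hw_edges (x1 P g β) n 0 w.1
      have h2 := Hw_edges (x1 P g β) n 0 w.2
      rw [add_zero] at h1 h2
      rw [h1, h2, ← List.prod_append, ← List.map_append]
      exact x1_prod P g β (Wf w) n
    rw [e3]
    refine FF_Xi (wdata P g) Eqs (4 * k) err (lf w) (by positivity) he0 ?_ P (g+1) J (by omega) hEq _ _ (l0s P g (Wf w))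
      (l0s_mem P g _) ?_ ?_ ?_ j ∅ _ (by simp) (by simpa using hJ) _ (List.Sublist.refl _)
    · intro E; simp only [hlf]; have := wt_nonneg (E ∪ (primesOf w.1 ∪ primesOf w.2)); positivity
    · intro f _
      rw [l0s_sum, hlen]; push_cast
      exact le_of_eq (by ring)
    · intro E off hE hEc
      have := leaf P hP0 β hβ (Finset.Ioc a b) (J + 2*k) A hS (Wf w) hmem E off hE (by omega)
      rw [hlen, hpW] at this
      refine this.trans (le_of_eq ?_)
      simp only [hlf]; rw [pow_mul]; norm_num
    · intro E off hE hEc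
      have h1 := lone_count ((Wf w).map fun a => a.2.natAbs)
      rw [List.length_map, hlen] at h1
      change 2 * (pW (Wf w)).card ≤ _ + ((pW (Wf w)).filter _).card at h1
      rw [hpW] at h1
      have h2 : E.card < ((primesOf w.1 ∪ primesOf w.2).filter fun p => ((Wf w).map fun a => a.2.natAbs).count p = 1).card := by omega
      obtain ⟨p, hp, hpE⟩ := Finset.exists_mem_notMem_of_card_lt_card h2
      rw [Finset.mem_filter] at hp
      exact err_bound P hP β hβ M hM hMp hper a b hab H hH1 hH (J + 2*k) (Wf w) hmem E off hE (by omega) p hpE hp.2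
  refine (Finset.sum_le_sum e2).trans ?_
  have e4 := Xi_sum (wdata P g) Eqs (4 * k) err lf WW (by positivity) he0 P (g+1) J hEq (4 ^ k * A * R ^ (2*k)) η
    (H ^ (g+1) * η) ?_ hη0 (by positivity) ?_ hη ?_ j ∅ (by simp) (by simpa using hJ)
  · refine e4.trans ?_
    have : wt ∅ = 1 := by simp [wt]
    rw [this, mul_one]
    have hc : (WW.card : ℝ) ≤ (2 * P.card) ^ (2*k) := by
      have : (WW.card : ℝ) ≤ (words (steps P) k ×ˢ words (steps P) k).card := by
        exact_mod_cast Finset.card_filter_le _ _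
      refine this.trans (le_of_eq ?_)
      rw [Finset.card_product]; push_cast
      rw [card_words, card_steps P hP0, ← pow_add, two_mul k]
    gcongr
  · have hL0 : 0 ≤ L := by rw [← hL]; exact Finset.sum_nonneg fun p _ => by positivity
    have hR0 : 0 ≤ R := le_trans (by positivity) hR
    positivity
  · intro E hE hEc
    have hEc' : (E.card : ℝ) ≤ J := by exact_mod_cast hEc
    have h1 := pair_wt P E hP0 L R hL k (by linarith)
    simp only [hlf]
    rw [← Finset.mul_sum]
    have h2 : ∑ w ∈ WW, wt (E ∪ (primesOf w.1 ∪ primesOf w.2)) ≤ R ^ (2*k) * wt E := by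
      refine le_trans ?_ h1
      rw [← Finset.sum_product']
      exact Finset.sum_le_sum_of_subset_of_nonneg (Finset.filter_subset _ _) fun w _ _ => wt_nonneg _
    have := mul_le_mul_of_nonneg_left h2 (by positivity : 0 ≤ 4 ^ k * A)
    linarith
  · intro E hE hEc
    have := eta_count P E g H _ hH1 hP0 hH le_rfl
    have h2 := mul_le_mul_of_nonneg_left this (by positivity : (0:ℝ) ≤ 4 * k)
    have h3 := mul_le_mul_of_nonneg_left (hη E hE hEc) (by positivity : 0 ≤ H ^ (g+1))
    linarith
end PartFourE

section PartFive
open scoped Classical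

theorem harm_le (n : ℕ) : ∑ i ∈ Finset.Icc 1 n, 1 / (i:ℝ) ≤ 1 + Real.log n := by
  have := harmonic_le_one_add_log n
  rw [harmonic_eq_sum_Icc] at this
  push_cast at this
  simpa [one_div] using this

theorem L_le (P : Finset ℕ) (hP : ∀ p ∈ P, 0 < p) (Hn : ℕ) (hHn : ∀ p ∈ P, p ≤ Hn) :
    ∑ p ∈ P, 1 / (p:ℝ) ≤ 1 + Real.log Hn := by
  refine le_trans ?_ (harm_le Hn)
  refine Finset.sum_le_sum_of_subset_of_nonneg ?_ fun p _ _ => by positivity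
  intro p hp
  rw [Finset.mem_Icc]; exact ⟨hP p hp, hHn p hp⟩

theorem res_sum (P : Finset ℕ) (hP : ∀ p ∈ P, p.Prime) (H0 : ℝ) (hH0 : 0 < H0) (hp0 : ∀ p ∈ P, H0 ≤ p)
    (Hn : ℕ) (hHn : ∀ p ∈ P, p ≤ Hn) (p : ℕ) (hp : p ∈ P) (b m : ℤ) (hm : m ≠ 0) (hmp : (m.natAbs : ℝ) < H0) :
    ∑ q ∈ P.filter (fun q : ℕ => q ≠ p ∧ (p:ℤ) ∣ b + m * q), 1 / (q:ℝ) ≤ (2 + Real.log Hn) / H0 := by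
  set T := P.filter (fun q : ℕ => q ≠ p ∧ (p:ℤ) ∣ b + m * q) with hT
  set f : ℕ → ℝ := fun i => if i = 0 then 1 / H0 else 1 / (i * H0) with hf
  have hpp := hP p hp
  have hpr : Prime (p:ℤ) := Nat.prime_iff_prime_int.1 hpp
  have hndvd : ¬ (p:ℤ) ∣ m := by
    intro h
    have h1 := Int.natAbs_dvd_natAbs.2 h
    rw [Int.natAbs_natCast] at h1
    have h2 := Nat.le_of_dvd (by omega) h1
    have h3 := hp0 p hp
    have h4 : (p:ℝ) ≤ m.natAbs := by exact_mod_cast h2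
    linarith
  have h1 : ∀ q ∈ T, 1 / (q:ℝ) ≤ f (q / p) := by
    intro q hq
    rw [hT, Finset.mem_filter] at hq
    simp only [hf]
    split_ifs with h0
    · exact one_div_le_one_div_of_le hH0 (hp0 q hq.1)
    · have : 0 < q / p := Nat.pos_of_ne_zero h0
      have h2 : (((q / p : ℕ)) : ℝ) * p ≤ q := by exact_mod_cast Nat.div_mul_le_self q p
      have h3 : (0:ℝ) < ((q / p : ℕ) : ℝ) := by exact_mod_cast this
      refine one_div_le_one_div_of_le (by positivity) (le_trans ?_ h2)
      have := hp0 p hp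
      gcongr
  have hinj : Set.InjOn (fun q => q / p) (T : Set ℕ) := by
    intro q hq q' hq' h
    rw [Finset.mem_coe, hT, Finset.mem_filter] at hq hq'
    have := dvd_sub hq.2.2 hq'.2.2
    rw [show b + m * (q:ℤ) - (b + m * q') = m * (q - q') by ring] at this
    have h2 := (hpr.dvd_or_dvd this).resolve_left hndvd
    have h3 : q ≡ q' [MOD p] := ((Nat.modEq_iff_dvd).2 (by rw [← Int.dvd_neg]; simpa using h2))
    have h4 : q % p = q' % p := h3
    have h5 : q / p = q' / p := h
    rw [← Nat.div_add_mod q p, ← Nat.div_add_mod q' p, h4, h5]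
  have hf0 : ∀ i, 0 ≤ f i := fun i => by simp only [hf]; split_ifs <;> positivity
  calc _ ≤ ∑ q ∈ T, f (q / p) := Finset.sum_le_sum h1
    _ = ∑ i ∈ T.image (fun q => q / p), f i := (Finset.sum_image hinj).symm
    _ ≤ ∑ i ∈ insert 0 (Finset.Icc 1 Hn), f i := by
        refine Finset.sum_le_sum_of_subset_of_nonneg ?_ fun i _ _ => hf0 i
        intro i hi
        obtain ⟨q, hq, rfl⟩ := Finset.mem_image.1 hi
        rw [hT, Finset.mem_filter] at hq
        have := Nat.div_le_self q p
        have := hHn q hq.1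
        simp only [Finset.mem_insert, Finset.mem_Icc]
        generalize q / p = i at *
        omega
    _ = 1 / H0 + (∑ i ∈ Finset.Icc 1 Hn, 1 / (i:ℝ)) / H0 := by
        rw [Finset.sum_insert (by simp), Finset.sum_div]
        congr 1
        · refine Finset.sum_congr rfl fun i hi => ?_
          rw [Finset.mem_Icc] at hi
          simp only [hf]
          rw [if_neg (by omega), div_div]
    _ ≤ _ := by
        rw [← add_div]
        have := harm_le Hn
        exact div_le_div_of_nonneg_right (by linarith) hH0.le

theorem div_sum (P : Finset ℕ) (hP : ∀ p ∈ P, p.Prime) (H0 : ℝ) (hH0 : 0 < H0) (hp0 : ∀ p ∈ P, H0 ≤ p)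
    (s : ℤ) (hs : s ≠ 0) :
    ∑ p ∈ P.filter (fun p : ℕ => (p:ℤ) ∣ s), 1 / (p:ℝ) ≤ Nat.log 2 s.natAbs / H0 := by
  set T := P.filter (fun p : ℕ => (p:ℤ) ∣ s) with hT
  have h1 : ∏ p ∈ T, p ∣ s.natAbs := by
    refine Finset.prod_primes_dvd _ ?_ ?_
    · intro p hp
      rw [hT, Finset.mem_filter] at hp
      exact (hP p hp.1).prime
    · intro p hp
      rw [hT, Finset.mem_filter] at hp
      exact Int.natCast_dvd.1 hp.2
  have h2 : 2 ^ T.card ≤ s.natAbs := by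
    refine le_trans ?_ (Nat.le_of_dvd (by omega) h1)
    rw [← Finset.prod_const]
    refine Finset.prod_le_prod' fun p hp => ?_
    rw [hT, Finset.mem_filter] at hp
    exact (hP p hp.1).two_le
  have h3 : T.card ≤ Nat.log 2 s.natAbs := Nat.le_log_of_pow_le (by norm_num) h2
  have h3' : (T.card : ℝ) ≤ Nat.log 2 s.natAbs := by exact_mod_cast h3
  calc _ ≤ ∑ p ∈ T, 1 / H0 := by
        refine Finset.sum_le_sum fun p hp => ?_
        rw [hT, Finset.mem_filter] at hp
        exact one_div_le_one_div_of_le hH0 (hp0 p hp.1)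
    _ = T.card / H0 := by rw [Finset.sum_const, nsmul_eq_mul]; ring
    _ ≤ _ := by gcongr

theorem esymm_aux (s f : ℝ) (hs : 0 ≤ s) (hf : 0 ≤ f) (j : ℕ) :
    s ^ (j+1) + (j+1) * f * s ^ j ≤ (s + f) ^ (j+1) := by
  induction j with
  | zero => simp
  | succ j ih =>
    rw [pow_succ (s + f)]
    have h1 : s ^ (j+1) + (j+1) * f * s ^ j ≤ (s+f) ^ (j+1) := ih
    have h2 := mul_le_mul_of_nonneg_right h1 (by linarith : 0 ≤ s + f)
    refine le_trans ?_ h2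
    have : 0 ≤ (j+1) * f * s ^ j * f := by positivity
    push_cast
    have e : (s ^ (j+1) + (j+1) * f * s ^ j) * (s + f) = s ^ (j+1+1) + ((j:ℝ)+1+1) * f * s ^ (j+1) + (j+1) * f * s ^ j * f := by ring
    rw [e]; linarith

theorem esymm_le (P : Finset ℕ) (f : ℕ → ℝ) (hf : ∀ p, 0 ≤ f p) (j : ℕ) :
    (j.factorial : ℝ) * ∑ K ∈ P.powersetCard j, ∏ p ∈ K, f p ≤ (∑ p ∈ P, f p) ^ j := by
  induction P using Finset.induction_on generalizing j with
  | empty =>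
    cases j with
    | zero => simp
    | succ j => rw [Finset.powersetCard_eq_empty.2 (by simp)]; simp
  | insert p P hp ih =>
    cases j with
    | zero => simp
    | succ j =>
      rw [Finset.powersetCard_succ_insert hp, Finset.sum_union, Finset.sum_image, Finset.sum_insert hp, add_comm (f p)]
      · have h1 : ∑ K ∈ P.powersetCard j, ∏ q ∈ insert p K, f q = f p * ∑ K ∈ P.powersetCard j, ∏ q ∈ K, f q := by
          rw [Finset.mul_sum]
          refine Finset.sum_congr rfl fun K hK => ?_
          rw [Finset.prod_insert fun h => hp ((Finset.mem_powersetCard.1 hK).1 h)]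
        rw [h1]
        refine le_trans ?_ (esymm_aux _ _ (Finset.sum_nonneg fun q _ => hf q) (hf p) j)
        have h2 := ih (j+1)
        have h3 := mul_le_mul_of_nonneg_left (ih j) (by have := hf p; positivity : 0 ≤ ((j:ℝ)+1) * f p)
        rw [Nat.factorial_succ] at h2 ⊢
        push_cast at h2 ⊢
        linarith
      · intro K hK K' hK' h
        have h1 : p ∉ K := fun h => hp ((Finset.mem_powersetCard.1 hK).1 h)
        have h2 : p ∉ K' := fun h => hp ((Finset.mem_powersetCard.1 hK').1 h)
        rw [← Finset.erase_insert h1, ← Finset.erase_insert h2]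
        exact congrArg (fun A => Finset.erase A p) h
      · refine Finset.disjoint_left.2 fun K hK hK' => ?_
        obtain ⟨K', _, rfl⟩ := Finset.mem_image.1 hK'
        exact hp ((Finset.mem_powersetCard.1 hK).1 (by simp))

theorem omega_count (P : Finset ℕ) (S : Finset ℤ) (A L : ℝ) (hA : 0 ≤ A) (j : ℕ)
    (hL : ∑ p ∈ P, 1 / (p:ℝ) = L)
    (hS : ∀ K off, K ⊆ P → K.card ≤ j → ((NS S K off).card : ℝ) ≤ A * wt K) :
    ((S.filter fun n => j ≤ (P.filter fun p : ℕ => (p:ℤ) ∣ n).card).card : ℝ) ≤ A * (L ^ j / j.factorial) := by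
  have h1 : ((S.filter fun n => j ≤ (P.filter fun p : ℕ => (p:ℤ) ∣ n).card).card : ℝ) ≤
      ∑ n ∈ S, ∑ K ∈ P.powersetCard j, (if ∀ p ∈ K, (p:ℤ) ∣ n + 0 then (1:ℝ) else 0) := by
    rw [Finset.card_filter]; push_cast
    refine Finset.sum_le_sum fun n _ => ?_
    have nn : ∀ K ∈ P.powersetCard j, (0:ℝ) ≤ (if ∀ p ∈ K, (p:ℤ) ∣ n + 0 then (1:ℝ) else 0) := by
      intro K _; split_ifs <;> norm_num
    split_ifs with h
    · obtain ⟨K, hK, hKc⟩ := Finset.exists_subset_card_eq h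
      have hm : K ∈ P.powersetCard j := Finset.mem_powersetCard.2 ⟨hK.trans (Finset.filter_subset _ _), hKc⟩
      refine le_trans ?_ (Finset.single_le_sum nn hm)
      rw [if_pos]
      intro p hp
      rw [add_zero]; exact (Finset.mem_filter.1 (hK hp)).2
    · exact Finset.sum_nonneg nn
  refine h1.trans ?_
  rw [Finset.sum_comm]
  have h2 : ∀ K ∈ P.powersetCard j, ∑ n ∈ S, (if ∀ p ∈ K, (p:ℤ) ∣ n + 0 then (1:ℝ) else 0) ≤ A * wt K := by
    intro K hK
    rw [Finset.mem_powersetCard] at hK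
    refine le_trans (le_of_eq ?_) (hS K (fun _ => 0) hK.1 hK.2.le)
    rw [NS, Finset.card_filter]; push_cast
    refine Finset.sum_congr rfl fun n _ => ?_
    congr
  refine (Finset.sum_le_sum h2).trans ?_
  rw [← Finset.mul_sum]
  refine mul_le_mul_of_nonneg_left ?_ hA
  rw [le_div_iff₀ (by positivity), mul_comm]
  have := esymm_le P (fun p => 1 / (p:ℝ)) (fun p => by positivity) j
  rw [hL] at this
  exact this

theorem Qs_nonneg (x : ℤ → ℤ → ℝ) (D : Finset ℤ) (k : ℕ) (n : ℤ) : 0 ≤ Qs x D k n := by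
  unfold Qs
  refine Finset.sum_nonneg fun d' _ => ?_
  set c : List ℤ → Prop := fun w => nb 0 w ∧ d' ≠ - lastS 0 w with hc
  set I : Finset ℤ := (words D k).image List.sum with hI
  have : ∑ w ∈ words D k, ∑ w' ∈ words D k,
    (if (nb 0 w ∧ d' ≠ - lastS 0 w) ∧ (nb 0 w' ∧ d' ≠ - lastS 0 w') ∧ w.sum = w'.sum
    then Hw x n w * Hw x n w' else 0) = ∑ s ∈ I, (∑ w ∈ words D k, if c w ∧ w.sum = s then Hw x n w else 0) ^ 2 := by
    simp only [sq, Finset.sum_mul_sum]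
    rw [Finset.sum_comm (s := I)]
    refine Finset.sum_congr rfl fun w hw => ?_
    rw [Finset.sum_comm (s := I)]
    refine Finset.sum_congr rfl fun w' hw' => ?_
    rw [Finset.sum_eq_single w.sum]
    · by_cases h1 : c w <;> by_cases h2 : c w' <;> by_cases h3 : w.sum = w'.sum
      all_goals
        have h3' : w'.sum = w.sum ↔ w.sum = w'.sum := eq_comm
        simp only [hc] at h1 h2
        simp [hc, h1, h2, h3, h3']
    · intro s _ hs
      rw [if_neg (fun h => hs h.2.symm), zero_mul]
    · intro h; exact absurd (Finset.mem_image_of_mem _ hw) h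
  rw [this]
  positivity
end PartFive

section PartSixA
open scoped Classical

noncomputable def bet (M : ℕ) (n d : ℤ) : ℝ := if n / (M:ℤ) = (n + d) / M then 1 else 0

theorem bet_abs (M : ℕ) (n d : ℤ) : |bet M n d| ≤ 1 := by unfold bet; split_ifs <;> simp

theorem bet_per (M : ℕ) (hM : 0 < M) (n d : ℤ) : bet M (n + M) d = bet M n d := by
  unfold bet
  have h : (M:ℤ) ≠ 0 := by omega
  rw [show n + (M:ℤ) + d = n + d + M by ring, Int.add_ediv_of_dvd_right (dvd_refl _),
    Int.add_ediv_of_dvd_right (dvd_refl _)]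
  simp

noncomputable def blk (M : ℕ) (c : ℤ) : Finset ℤ := Finset.Ico (c * M) ((c+1) * M)

theorem mem_blk {M : ℕ} (hM : 0 < M) {c n : ℤ} : n ∈ blk M c ↔ n / M = c := by
  unfold blk
  rw [Finset.mem_Ico]
  have h : (0:ℤ) < M := by omega
  constructor
  · rintro ⟨h1, h2⟩
    apply le_antisymm
    · exact Int.lt_add_one_iff.1 ((Int.ediv_lt_iff_lt_mul h).2 h2)
    · exact (Int.le_ediv_iff_mul_le h).2 h1
  · rintro rfl
    exact ⟨Int.ediv_mul_le n (by omega), Int.lt_ediv_add_one_mul_self n h⟩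

theorem x1_sym (P : Finset ℕ) (g M : ℕ) (n d : ℤ) :
    x1 P g (bet M) (n + d) (-d) = x1 P g (bet M) n d := by
  unfold x1 x0 bet
  rw [show n + d + -d = n by ring, Int.natAbs_neg]
  have h1 : ((d.natAbs:ℤ) ∣ n + d) ↔ ((d.natAbs:ℤ) ∣ n) :=
    (Int.dvd_add_left (Int.natAbs_dvd.2 (dvd_refl d)))
  simp only [h1, or_comm (a := Yb P g (n + d)), eq_comm (a := (n+d) / (M:ℤ))]

theorem x1_le_one (P : Finset ℕ) (g M : ℕ) (n d : ℤ) : |x1 P g (bet M) n d| ≤ 1 := by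
  unfold x1; split_ifs
  · simp
  · exact x0_le_one _ (bet_abs M) _ _

theorem x1_le_ye (P : Finset ℕ) (g M : ℕ) (n d : ℤ) : |x1 P g (bet M) n d| ≤ ye n d := by
  unfold x1; split_ifs
  · simpa using ye_nonneg n d
  · exact x0_le _ (bet_abs M) _ _

theorem x1_ne (P : Finset ℕ) (g M : ℕ) (n d : ℤ) (h : x1 P g (bet M) n d ≠ 0) :
    ¬ Yb P g n ∧ ¬ Yb P g (n + d) ∧ n / M = (n + d) / M := by
  unfold x1 at h
  split_ifs at h with h1
  · exact absurd rfl h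
  · rw [not_or] at h1
    refine ⟨h1.1, h1.2, ?_⟩
    by_contra h2
    apply h
    simp [x0, bet, h2]

theorem quad_bound (P : Finset ℕ) (hP : ∀ p ∈ P, 0 < p) (g M k : ℕ) (hM : 0 < M) (X : Finset ℤ) (t R : ℝ)
    (ht0 : 0 < t) (ht : t ≤ 1/2)
    (hXω : ∀ n ∈ X, ∑ d ∈ steps P, |x1 P g (bet M) n d| ≤ R)
    (hgood : ∀ n ∈ X, 4 * (steps P).card * t^(2*k) * (∑ m ∈ blk M (n / M), Qs (x1 P g (bet M)) (steps P) k m) < 1)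
    (u : ℤ → ℝ) (hu : ∀ n, n ∉ X → u n = 0) :
    |∑ n ∈ X, ∑ d ∈ steps P, x1 P g (bet M) n d * u (n + d) * u n| ≤ (1 / t + 2 * t * R) * ∑ n ∈ X, u n ^ 2 := by
  have hmaps : ∀ n ∈ X, n / (M:ℤ) ∈ X.image (fun n => n / (M:ℤ)) := fun n hn => Finset.mem_image_of_mem _ hn
  rw [← Finset.sum_fiberwise_of_maps_to hmaps, ← Finset.sum_fiberwise_of_maps_to (g := fun n => n / (M:ℤ)) hmaps, Finset.mul_sum]
  refine (Finset.abs_sum_le_sum_abs _ _).trans (Finset.sum_le_sum fun c hc => ?_)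
  obtain ⟨n0, hn0, hc0⟩ := Finset.mem_image.1 hc
  set v : ℤ → ℝ := fun n => if n / (M:ℤ) = c then u n else 0 with hv
  have hXX : ∀ F : ℤ → ℝ, (∀ n, u n = 0 → F n = 0) → ∑ n ∈ X.filter (fun n => n / (M:ℤ) = c), F n = ∑ n ∈ blk M c, F n := by
    intro F hF
    have : ∑ n ∈ blk M c, F n = ∑ n ∈ (blk M c).filter (fun n => n ∈ X), F n := by
      rw [Finset.sum_filter]
      refine Finset.sum_congr rfl fun n _ => ?_
      split_ifs with h
      · rfl
      · exact hF n (hu n h)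
    rw [this]
    refine Finset.sum_congr ?_ fun _ _ => rfl
    ext n
    rw [Finset.mem_filter, Finset.mem_filter, mem_blk hM, and_comm]
  have key := block_bound (x1 P g (bet M)) (steps P) (blk M c) k t R
    (fun d hd => by rw [mem_steps, Int.natAbs_neg]; exact mem_steps.1 hd)
    (fun h => by have := hP _ (mem_steps.1 h); simp at this)
    (x1_le_one P g M) (fun n d _ => x1_sym P g M n d)
    (fun n hn d _ h => by
      rw [mem_blk hM] at hn ⊢
      rw [← (x1_ne P g M n d h).2.2, hn]) ht0 ht
    (by have := hgood n0 hn0; rwa [hc0] at this) v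
    (fun n hn => by
      rw [mem_blk hM] at hn
      simp [hv, hn])
    (fun n hn => by
      refine hXω n ?_
      by_contra h
      apply hn
      simp [hv, hu n h])
  rw [hXX (fun n => ∑ d ∈ steps P, x1 P g (bet M) n d * u (n + d) * u n) (fun n h => by simp [h]),
    hXX (fun n => u n ^ 2) (fun n h => by simp [h])]
  have e1 : ∑ n ∈ blk M c, ∑ d ∈ steps P, x1 P g (bet M) n d * u (n + d) * u n = ∑ n ∈ blk M c, ∑ d ∈ steps P, x1 P g (bet M) n d * v (n + d) * v n := by
    refine Finset.sum_congr rfl fun n hn => Finset.sum_congr rfl fun d _ => ?_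
    rw [mem_blk hM] at hn
    by_cases h : x1 P g (bet M) n d = 0
    · simp [h]
    · have := (x1_ne P g M n d h).2.2
      have h2 : (n + d) / (M:ℤ) = c := by rw [← this, hn]
      simp only [hv, hn, h2, if_true]
  have e2 : ∑ n ∈ blk M c, u n ^ 2 = ∑ n ∈ blk M c, v n ^ 2 := by
    refine Finset.sum_congr rfl fun n hn => ?_
    rw [mem_blk hM] at hn
    simp only [hv, hn, if_true]
  rw [e1, e2]; exact key

theorem opA_re (N : ℕ) (P : Finset ℕ) (hP : ∀ p ∈ P, 0 < p) (f : ℤ → ℂ)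
    (hf : ∀ n, n ∉ Finset.Ioc (N:ℤ) (2 * N) → f n = 0) (n : ℤ) :
    opA N P f n = ((∑ d ∈ steps P, ((if (d.natAbs : ℤ) ∣ n then 1 else 0) - 1 / (d.natAbs : ℝ)) * (f (n + d)).re : ℝ) : ℂ) +
     ((∑ d ∈ steps P, ((if (d.natAbs : ℤ) ∣ n then 1 else 0) - 1 / (d.natAbs : ℝ)) * (f (n + d)).im : ℝ) : ℂ) * Complex.I := by
  have key : opA N P f n = ∑ p ∈ P, (((if (p : ℤ) ∣ n then 1 else 0) - 1 / (p : ℂ)) * f (n + p) +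
      ((if (p : ℤ) ∣ n then 1 else 0) - 1 / (p : ℂ)) * f (n + -p)) := by
    unfold opA
    rw [Finset.sum_pair (by norm_num), Finset.sum_pair (by norm_num), ← Finset.sum_add_distrib, ← Finset.sum_add_distrib,
      ← Finset.sum_sub_distrib]
    refine Finset.sum_congr rfl fun p _ => ?_
    have e1 : ∀ m, (if (p:ℤ) ∣ n ∧ m ∈ Finset.Ioc (N:ℤ) (2 * N) then f m else 0) = (if (p : ℤ) ∣ n then 1 else 0) * f m := by
      intro m
      by_cases h1 : (p:ℤ) ∣ n <;> by_cases h2 : m ∈ Finset.Ioc (N:ℤ) (2 * N) 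
      · rw [if_pos ⟨h1, h2⟩, if_pos h1, one_mul]
      · rw [if_neg (fun h => h2 h.2), hf m h2, mul_zero]
      · rw [if_neg (fun h => h1 h.1), if_neg h1, zero_mul]
      · rw [if_neg (fun h => h1 h.1), if_neg h1, zero_mul]
    have e2 : ∀ m, (if m ∈ Finset.Ioc (N:ℤ) (2 * N) then f m / (p:ℂ) else 0) = 1 / (p:ℂ) * f m := by
      intro m
      split_ifs with h
      · ring
      · rw [hf m h, mul_zero]
    rw [e1, e1, e2, e2, one_mul, neg_one_mul]; ring
  rw [key, sum_steps hP, sum_steps hP]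
  simp only [Int.natAbs_natCast, Int.natAbs_neg]
  push_cast
  rw [Finset.sum_mul, ← Finset.sum_add_distrib]
  refine Finset.sum_congr rfl fun p _ => ?_
  conv_lhs => rw [← Complex.re_add_im (f (n + p)), ← Complex.re_add_im (f (n + -p))]
  by_cases h : (p:ℤ) ∣ n
  · simp only [h, if_true]; push_cast; ring
  · simp only [h, if_false]; push_cast; ring

theorem eig (N : ℕ) (P : Finset ℕ) (hP : ∀ p ∈ P, 0 < p) (g M k : ℕ) (hM : 0 < M) (X : Finset ℤ) (t R : ℝ)
    (ht0 : 0 < t) (ht : t ≤ 1/2) (hR0 : 0 ≤ R)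
    (hXN : X ⊆ Finset.Ioc (N:ℤ) (2 * N)) (hXY : ∀ n ∈ X, ¬ Yb P g n)
    (hXb : ∀ n ∈ X, ∀ d ∈ steps P, n + d ∈ X → n / (M:ℤ) = (n + d) / M)
    (hXω : ∀ n ∈ X, ∑ d ∈ steps P, |x1 P g (bet M) n d| ≤ R)
    (hgood : ∀ n ∈ X, 4 * (steps P).card * t^(2*k) * (∑ m ∈ blk M (n / M), Qs (x1 P g (bet M)) (steps P) k m) < 1)
    (μ : ℂ) (f : ℤ → ℂ) (hf : f ≠ 0) (hμ : ∀ n, opARestrict N P X f n = μ * f n) :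
    ‖μ‖ ≤ 1 / t + 2 * t * R := by
  by_cases hμ0 : μ = 0
  · rw [hμ0, norm_zero]; positivity
  have hfX : ∀ n, n ∉ X → f n = 0 := by
    intro n hn
    have := hμ n
    rw [opARestrict, if_neg hn] at this
    rcases mul_eq_zero.1 this.symm with h | h
    · exact absurd h hμ0
    · exact h
  have hff : (fun m => if m ∈ X then f m else 0) = f := by
    funext m; split_ifs with h
    · rfl
    · exact (hfX m h).symm
  set u : ℤ → ℝ := fun n => (f n).re with hu
  set v : ℤ → ℝ := fun n => (f n).im with hv
  have huX : ∀ n, n ∉ X → u n = 0 := fun n hn => by simp [hu, hfX n hn]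
  have hvX : ∀ n, n ∉ X → v n = 0 := fun n hn => by simp [hv, hfX n hn]
  have hcoef : ∀ w : ℤ → ℝ, (∀ n, n ∉ X → w n = 0) → ∀ n ∈ X,
      ∑ d ∈ steps P, ((if (d.natAbs : ℤ) ∣ n then 1 else 0) - 1 / (d.natAbs : ℝ)) * w (n + d) =
      ∑ d ∈ steps P, x1 P g (bet M) n d * w (n + d) := by
    intro w hw n hn
    refine Finset.sum_congr rfl fun d hd => ?_
    by_cases h : n + d ∈ X
    · have h1 := hXb n hn d hd h
      simp only [x1, x0, bet, hXY n hn, hXY _ h, or_self, if_false]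
      rw [if_pos h1, one_mul]
    · rw [hw _ h]; simp
  have hmain : ∀ n ∈ X, (∑ d ∈ steps P, x1 P g (bet M) n d * u (n + d) = μ.re * u n - μ.im * v n) ∧
      (∑ d ∈ steps P, x1 P g (bet M) n d * v (n + d) = μ.re * v n + μ.im * u n) := by
    intro n hn
    have h := hμ n
    rw [opARestrict, if_pos hn, hff, opA_re N P hP f (fun n h => hfX n fun h' => h (hXN h'))] at h
    have h1 := congrArg Complex.re h
    have h2 := congrArg Complex.im h
    simp only [Complex.add_re, Complex.add_im, Complex.mul_re, Complex.mul_im, Complex.ofReal_re, Complex.ofReal_im,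
      Complex.I_re, Complex.I_im, mul_zero, mul_one, sub_zero, add_zero, zero_add, zero_mul] at h1 h2
    rw [← hcoef u huX n hn, ← hcoef v hvX n hn]
    exact ⟨h1, h2⟩
  set S2 : ℝ := ∑ n ∈ X, (u n ^ 2 + v n ^ 2) with hS2
  have hpos : 0 < S2 := by
    obtain ⟨n, hn⟩ := Function.ne_iff.1 hf
    have hnX : n ∈ X := by by_contra h; exact hn (hfX n h)
    refine Finset.sum_pos' (fun _ _ => by positivity) ⟨n, hnX, ?_⟩
    by_contra h
    have h1 : u n = 0 := by nlinarith [sq_nonneg (u n), sq_nonneg (v n)]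
    have h2 : v n = 0 := by nlinarith [sq_nonneg (u n), sq_nonneg (v n)]
    exact hn (Complex.ext h1 h2)
  have hre := reindex_sym (x1 P g (bet M)) (steps P) X
    (fun d hd => by rw [mem_steps, Int.natAbs_neg]; exact mem_steps.1 hd) (fun n d _ => x1_sym P g M n d) v u hvX huX
  have e1 : ∀ w z : ℤ → ℝ, ∑ n ∈ X, ∑ d ∈ steps P, x1 P g (bet M) n d * w (n + d) * z n =
      ∑ n ∈ X, (∑ d ∈ steps P, x1 P g (bet M) n d * w (n + d)) * z n := by
    intro w z
    exact Finset.sum_congr rfl fun n _ => (Finset.sum_mul _ _ _).symm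
  have him : μ.im = 0 := by
    rw [e1, e1, ← sub_eq_zero, ← Finset.sum_sub_distrib] at hre
    have : μ.im * S2 = 0 := by
      rw [← hre, hS2, Finset.mul_sum]
      refine Finset.sum_congr rfl fun n hn => ?_
      rw [(hmain n hn).1, (hmain n hn).2]; ring
    exact (mul_eq_zero.1 this).resolve_right hpos.ne'
  have q1 := quad_bound P hP g M k hM X t R ht0 ht hXω hgood u huX
  have q2 := quad_bound P hP g M k hM X t R ht0 ht hXω hgood v hvX
  have q3 : μ.re * S2 = (∑ n ∈ X, ∑ d ∈ steps P, x1 P g (bet M) n d * u (n + d) * u n) +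
      ∑ n ∈ X, ∑ d ∈ steps P, x1 P g (bet M) n d * v (n + d) * v n := by
    rw [e1, e1, ← Finset.sum_add_distrib, hS2, Finset.mul_sum]
    refine Finset.sum_congr rfl fun n hn => ?_
    rw [(hmain n hn).1, (hmain n hn).2]; ring
  have q4 : |μ.re| * S2 ≤ (1 / t + 2 * t * R) * S2 := by
    have : |μ.re| * S2 = |μ.re * S2| := by rw [abs_mul, abs_of_pos hpos]
    rw [this, q3]
    refine (abs_add_le _ _).trans ((add_le_add q1 q2).trans (le_of_eq ?_))
    rw [hS2, Finset.sum_add_distrib]; ring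
  have hn : ‖μ‖ = |μ.re| := by
    have : μ = (μ.re : ℂ) := Complex.ext (by simp) (by simp [him])
    rw [this, Complex.norm_real]; simp
  rw [hn]
  exact le_of_mul_le_mul_right q4 hpos
end PartSixA

section PartSixB
open scoped Classical

theorem Qsum_le (x : ℤ → ℤ → ℝ) (D S : Finset ℤ) (k um : ℕ) :
    ∑ n ∈ S, Qs x D k n ≤ (D.card : ℝ) * ((∑ n ∈ S, ∑ w ∈ words D k, ∑ w' ∈ words D k,
        if nb 0 w ∧ nb 0 w' ∧ (primesOf w ∪ primesOf w').card ≤ um then |Hw x n w| * |Hw x n w'| else 0) +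
      ∑ w ∈ words D k, ∑ w' ∈ words D k, if (primesOf w ∪ primesOf w').card ≤ um then 0 else
        |∑ n ∈ S, Hw x n w * Hw x n w'|) := by
  unfold Qs
  rw [Finset.sum_comm, ← nsmul_eq_mul]
  refine Finset.sum_le_card_nsmul _ _ _ fun d' _ => ?_
  have swap : ∀ F : ℤ → List ℤ → List ℤ → ℝ, ∑ n ∈ S, ∑ w ∈ words D k, ∑ w' ∈ words D k, F n w w' =
      ∑ w ∈ words D k, ∑ w' ∈ words D k, ∑ n ∈ S, F n w w' := by
    intro F
    rw [Finset.sum_comm]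
    exact Finset.sum_congr rfl fun w _ => Finset.sum_comm
  rw [swap, swap, ← Finset.sum_add_distrib]
  refine Finset.sum_le_sum fun w _ => ?_
  rw [← Finset.sum_add_distrib]
  refine Finset.sum_le_sum fun w' _ => ?_
  by_cases hc : (nb 0 w ∧ d' ≠ -lastS 0 w) ∧ (nb 0 w' ∧ d' ≠ -lastS 0 w') ∧ w.sum = w'.sum
  · simp only [if_pos hc]
    by_cases hu : (primesOf w ∪ primesOf w').card ≤ um
    · simp only [if_pos hu, add_zero, if_pos (And.intro hc.1.1 (And.intro hc.2.1.1 hu))]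
      refine Finset.sum_le_sum fun n _ => ?_
      rw [← abs_mul]; exact le_abs_self _
    · simp only [if_neg hu]
      have : 0 ≤ ∑ n ∈ S, (if nb 0 w ∧ nb 0 w' ∧ (primesOf w ∪ primesOf w').card ≤ um then |Hw x n w| * |Hw x n w'| else 0) := by
        refine Finset.sum_nonneg fun n _ => ?_
        split_ifs <;> positivity
      linarith [le_abs_self (∑ n ∈ S, Hw x n w * Hw x n w')]
  · simp only [if_neg hc, Finset.sum_const_zero]
    refine add_nonneg (Finset.sum_nonneg fun n _ => ?_) ?_
    · split_ifs <;> positivity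
    · split_ifs <;> positivity

theorem Yb_count (P : Finset ℕ) (g : ℕ) (S : Finset ℤ) (A η : ℝ) (hA : 0 ≤ A)
    (hS : ∀ (K : Finset ℕ) (off : ℕ → ℤ), K ⊆ P → K.card ≤ g + 1 → ((NS S K off).card : ℝ) ≤ A * wt K)
    (hη : (∑ q ∈ wdata P g, if Eqs q ⊆ ∅ then 0 else wt (Eqs q \ ∅)) ≤ η) :
    ((S.filter fun n => Yb P g n).card : ℝ) ≤ A * η := by
  have h1 : S.filter (fun n => Yb P g n) ⊆ (wdata P g).biUnion fun q => NS S (Eqs q) (offc P g 0 q) := by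
    intro n hn
    rw [Finset.mem_filter] at hn
    obtain ⟨hn, q, hq, h2, h3⟩ := hn
    rw [Finset.mem_biUnion]
    refine ⟨q, mem_wdata.2 hq, ?_⟩
    unfold NS
    rw [Finset.mem_filter]
    refine ⟨hn, (offc_spec P g 0 q hq n).1 ?_⟩
    rw [add_zero]
    exact ⟨h2, h3⟩
  have h2 : ((S.filter fun n => Yb P g n).card : ℝ) ≤ ∑ q ∈ wdata P g, ((NS S (Eqs q) (offc P g 0 q)).card : ℝ) := by
    exact_mod_cast (Finset.card_le_card h1).trans Finset.card_biUnion_le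
  refine h2.trans (le_trans ?_ (mul_le_mul_of_nonneg_left hη hA))
  rw [Finset.mul_sum]
  refine Finset.sum_le_sum fun q hq => ?_
  have hq' := Eqs_sub (mem_wdata.1 hq)
  rw [if_neg, Finset.sdiff_empty]
  · exact hS _ _ hq'.1 hq'.2
  · rw [Finset.subset_empty]
    exact (Finset.insert_nonempty _ _).ne_empty

theorem omega_R (P : Finset ℕ) (hP : ∀ p ∈ P, 0 < p) (g M : ℕ) (L : ℝ) (hL : ∑ p ∈ P, 1 / (p:ℝ) = L) (n : ℤ) (D : ℕ)
    (h : (P.filter fun p : ℕ => (p:ℤ) ∣ n).card ≤ D) :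
    ∑ d ∈ steps P, |x1 P g (bet M) n d| ≤ 2 * D + 2 * L := by
  refine (Finset.sum_le_sum fun d _ => x1_le_ye P g M n d).trans ?_
  rw [sum_steps hP]
  have : ∀ p ∈ P, ye n (p:ℤ) + ye n (-(p:ℤ)) = 2 * (if (p:ℤ) ∣ n then (1:ℝ) else 0) + 2 * (1 / (p:ℝ)) := by
    intro p _
    unfold ye
    rw [Int.natAbs_neg, Int.natAbs_natCast]; ring
  rw [Finset.sum_congr rfl this, Finset.sum_add_distrib, ← Finset.mul_sum, ← Finset.mul_sum, hL, Finset.sum_boole]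
  have : ((P.filter fun p : ℕ => (p:ℤ) ∣ n).card:ℝ) ≤ D := by exact_mod_cast h
  linarith
end PartSixB

section PartSixC
open scoped Classical

noncomputable def SS (N M : ℕ) : Finset ℤ :=
  Finset.Ioc (((N:ℤ) / M + 1) * M - 1) ((2 * (N:ℤ) + 1) / M * M - 1)

theorem SS_le {N M : ℕ} (hM : 0 < M) (hN : 2 * M ≤ N) :
    ((N:ℤ) < ((N:ℤ) / M + 1) * M ∧ ((N:ℤ) / M + 1) * M ≤ N + M) ∧
    (2 * (N:ℤ) + 1 - M < (2 * (N:ℤ) + 1) / M * M ∧ (2 * (N:ℤ) + 1) / M * M ≤ 2 * (N:ℤ) + 1) := by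
  have h : (0:ℤ) < M := by omega
  have h1 := Int.lt_ediv_add_one_mul_self (N:ℤ) h
  have h2 := Int.ediv_mul_le (N:ℤ) h.ne'
  have h3 := Int.lt_ediv_add_one_mul_self (2 * (N:ℤ) + 1) h
  have h4 := Int.ediv_mul_le (2 * (N:ℤ) + 1) h.ne'
  refine ⟨⟨h1, by nlinarith⟩, ⟨by nlinarith, h4⟩⟩

theorem SS_sub {N M : ℕ} (hM : 0 < M) (hN : 2 * M ≤ N) : SS N M ⊆ Finset.Ioc (N:ℤ) (2 * N) := by
  intro n hn
  unfold SS at hn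
  rw [Finset.mem_Ioc] at hn ⊢
  have := SS_le hM hN
  omega

theorem SS_compl {N M : ℕ} (hM : 0 < M) (hN : 2 * M ≤ N) : (Finset.Ioc (N:ℤ) (2 * N) \ SS N M).card ≤ 2 * M := by
  rw [Finset.card_sdiff_of_subset (SS_sub hM hN)]
  unfold SS
  rw [Int.card_Ioc, Int.card_Ioc]
  have := SS_le hM hN
  omega

theorem mem_SS {N M : ℕ} (hM : 0 < M) {n : ℤ} : n ∈ SS N M ↔ n / (M:ℤ) ∈ Finset.Ico ((N:ℤ) / M + 1) ((2 * (N:ℤ) + 1) / M) := by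
  unfold SS
  have h : (0:ℤ) < M := by omega
  rw [Finset.mem_Ioc, Finset.mem_Ico, Int.le_ediv_iff_mul_le h, Int.ediv_lt_iff_lt_mul h]
  omega

theorem c_card {N M : ℕ} (hM : 0 < M) (hN : 2 * M ≤ N) :
    (M:ℝ) * ((Finset.Ico ((N:ℤ) / M + 1) ((2 * (N:ℤ) + 1) / M)).card : ℝ) ≤ N := by
  have h : (0:ℤ) < M := by omega
  have := SS_le hM hN
  have h0 : (N:ℤ) / M + 1 ≤ (2 * (N:ℤ) + 1) / M := by
    rw [Int.le_ediv_iff_mul_le h]; omega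
  have : (M:ℤ) * ((Finset.Ico ((N:ℤ) / M + 1) ((2 * (N:ℤ) + 1) / M)).card : ℤ) ≤ N := by
    rw [Int.card_Ico, Int.toNat_of_nonneg (by omega)]
    nlinarith
  exact_mod_cast this

/-- counting by (quotient, remainder) -/
theorem qr_card {M : ℕ} (S : Finset ℤ) (C R : Finset ℤ) (h : ∀ n ∈ S, n / (M:ℤ) ∈ C ∧ n % (M:ℤ) ∈ R) :
    S.card ≤ C.card * R.card := by
  rw [← Finset.card_product]
  refine Finset.card_le_card_of_injOn (fun n => (n / (M:ℤ), n % (M:ℤ))) (fun n hn => ?_) (fun a _ b _ hab => ?_)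
  · rw [Finset.mem_coe, Finset.mem_product]; exact h n hn
  · rw [Prod.mk.injEq] at hab
    rw [← Int.mul_ediv_add_emod a M, ← Int.mul_ediv_add_emod b M, hab.1, hab.2]

theorem construct (N : ℕ) (P : Finset ℕ) (hP : ∀ p ∈ P, 0 < p) (g M k D Hn : ℕ) (hM : 0 < M) (hN : 2 * M ≤ N)
    (hHn : ∀ p ∈ P, p ≤ Hn) (t L : ℝ) (ht0 : 0 < t) (ht : t ≤ 1/2) (hL : ∑ p ∈ P, 1 / (p:ℝ) = L) :
    ∃ X : Finset ℤ, X ⊆ Finset.Ioc (N:ℤ) (2 * N) ∧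
      ((Finset.Ioc (N:ℤ) (2 * N) \ X).card : ℝ) ≤ 2 * M + (((SS N M).filter fun n => D ≤ (P.filter fun p : ℕ => (p:ℤ) ∣ n).card).card : ℝ)
        + (((SS N M).filter fun n => Yb P g n).card : ℝ) + N / M * (2 * Hn) +
        M * (4 * (steps P).card * t^(2*k) * ∑ n ∈ SS N M, Qs (x1 P g (bet M)) (steps P) k n) ∧
      ∀ (μ : ℂ) (f : ℤ → ℂ), f ≠ 0 → (∀ n, opARestrict N P X f n = μ * f n) →
        ‖μ‖ ≤ 1 / t + 2 * t * (2 * D + 2 * L) := by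
  have hM' : (0:ℤ) < M := by omega
  have hMr : (0:ℝ) < M := by exact_mod_cast hM
  set Q : ℤ → ℝ := fun c => 4 * (steps P).card * t^(2*k) * ∑ m ∈ blk M c, Qs (x1 P g (bet M)) (steps P) k m with hQ
  set C := Finset.Ico ((N:ℤ) / M + 1) ((2 * (N:ℤ) + 1) / M) with hC
  set Bad := C.filter fun c => 1 ≤ Q c with hBad
  set F1 := (SS N M).filter fun n => D ≤ (P.filter fun p : ℕ => (p:ℤ) ∣ n).card with hF1
  set F2 := (SS N M).filter fun n => Yb P g n with hF2
  set F3 := (SS N M).filter fun n => ¬ ((Hn:ℤ) ≤ n % M ∧ n % M < M - Hn) with hF3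
  set F4 := (SS N M).filter fun n => n / (M:ℤ) ∈ Bad with hF4
  set X := SS N M \ (F1 ∪ F2 ∪ F3 ∪ F4) with hX
  have hXS : X ⊆ SS N M := Finset.sdiff_subset
  have hQ0 : ∀ c, 0 ≤ Q c := fun c => mul_nonneg (by positivity) (Finset.sum_nonneg fun m _ => Qs_nonneg _ _ _ _)
  have hXp : ∀ n ∈ X, (P.filter fun p : ℕ => (p:ℤ) ∣ n).card ≤ D ∧ ¬ Yb P g n ∧ ((Hn:ℤ) ≤ n % M ∧ n % M < M - Hn) ∧ Q (n / M) < 1 := by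
    intro n hn
    rw [hX, Finset.mem_sdiff, Finset.mem_union, Finset.mem_union, Finset.mem_union, hF1, hF2, hF3, hF4,
      Finset.mem_filter, Finset.mem_filter, Finset.mem_filter, Finset.mem_filter] at hn
    obtain ⟨hs, hn⟩ := hn
    simp only [hs, true_and] at hn
    push Not at hn
    obtain ⟨⟨⟨h1, h2⟩, h3⟩, h4⟩ := hn
    refine ⟨h1.le, h2, h3, ?_⟩
    by_contra h5
    exact h4 (Finset.mem_filter.2 ⟨(mem_SS hM).1 hs, not_lt.1 h5⟩)
  refine ⟨X, hXS.trans (SS_sub hM hN), ?_, ?_⟩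
  · have hsub : Finset.Ioc (N:ℤ) (2 * N) \ X ⊆ (Finset.Ioc (N:ℤ) (2 * N) \ SS N M) ∪ (F1 ∪ F2 ∪ F3 ∪ F4) := by
      intro n hn
      rw [Finset.mem_sdiff] at hn
      rw [Finset.mem_union, Finset.mem_sdiff]
      by_contra h
      rw [not_or] at h
      apply hn.2
      rw [hX, Finset.mem_sdiff]
      refine ⟨?_, h.2⟩
      by_contra h'
      exact h.1 ⟨hn.1, h'⟩
    have c0 : (Finset.Ioc (N:ℤ) (2 * N) \ X).card ≤ 2 * M + (F1.card + F2.card + F3.card + F4.card) := by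
      refine (Finset.card_le_card hsub).trans ((Finset.card_union_le _ _).trans (add_le_add (SS_compl hM hN) ?_))
      refine (Finset.card_union_le _ _).trans (add_le_add ?_ le_rfl)
      refine (Finset.card_union_le _ _).trans (add_le_add ?_ le_rfl)
      exact Finset.card_union_le _ _
    have c3 : (F3.card : ℝ) ≤ N / M * (2 * Hn) := by
      have : F3.card ≤ C.card * (Finset.Ico (0:ℤ) Hn ∪ Finset.Ico ((M:ℤ) - Hn) M).card := by
        refine qr_card (M := M) _ _ _ fun n hn => ?_
        rw [hF3, Finset.mem_filter] at hn
        refine ⟨(mem_SS hM).1 hn.1, ?_⟩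
        have h1 := Int.emod_nonneg n hM'.ne'
        have h2 := Int.emod_lt_of_pos n hM'
        rw [Finset.mem_union, Finset.mem_Ico, Finset.mem_Ico]
        omega
      have h2 : (Finset.Ico (0:ℤ) Hn ∪ Finset.Ico ((M:ℤ) - Hn) M).card ≤ 2 * Hn := by
        refine (Finset.card_union_le _ _).trans ?_
        rw [Int.card_Ico, Int.card_Ico]; omega
      have h3 : (F3.card : ℝ) ≤ C.card * (2 * Hn) := by exact_mod_cast this.trans (Nat.mul_le_mul_left _ h2)
      refine h3.trans (mul_le_mul_of_nonneg_right ?_ (by positivity))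
      rw [le_div_iff₀ hMr, mul_comm]
      exact c_card hM hN
    have c4 : (F4.card : ℝ) ≤ M * (4 * (steps P).card * t^(2*k) * ∑ n ∈ SS N M, Qs (x1 P g (bet M)) (steps P) k n) := by
      have : F4.card ≤ Bad.card * (Finset.Ico (0:ℤ) M).card := by
        refine qr_card (M := M) _ _ _ fun n hn => ?_
        rw [hF4, Finset.mem_filter] at hn
        refine ⟨hn.2, ?_⟩
        rw [Finset.mem_Ico]
        exact ⟨Int.emod_nonneg n hM'.ne', Int.emod_lt_of_pos n hM'⟩
      rw [Int.card_Ico, sub_zero, Int.toNat_natCast] at this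
      have h2 : (F4.card : ℝ) ≤ M * Bad.card := by rw [mul_comm]; exact_mod_cast this
      refine h2.trans (mul_le_mul_of_nonneg_left ?_ hMr.le)
      calc (Bad.card : ℝ) = ∑ c ∈ Bad, (1:ℝ) := by simp
        _ ≤ ∑ c ∈ Bad, Q c := Finset.sum_le_sum fun c hc => (Finset.mem_filter.1 hc).2
        _ ≤ ∑ c ∈ C, Q c := Finset.sum_le_sum_of_subset_of_nonneg (Finset.filter_subset _ _) fun c _ _ => hQ0 c
        _ = _ := by
          rw [hQ, ← Finset.mul_sum]
          congr 1
          rw [← Finset.sum_fiberwise_of_maps_to (s := SS N M) (t := C) (g := fun n => n / (M:ℤ)) (fun n hn => (mem_SS hM).1 hn)]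
          refine Finset.sum_congr rfl fun c hc => Finset.sum_congr ?_ fun _ _ => rfl
          ext n
          rw [Finset.mem_filter, mem_blk hM]
          constructor
          · intro h; exact ⟨(mem_SS hM).2 (h ▸ hc), h⟩
          · exact fun h => h.2
    have c0' : ((Finset.Ioc (N:ℤ) (2 * N) \ X).card : ℝ) ≤ 2 * M + (F1.card + F2.card + F3.card + F4.card) := by exact_mod_cast c0
    linarith
  · intro μ f hf hμ
    have hL0 : 0 ≤ L := by rw [← hL]; exact Finset.sum_nonneg fun p _ => by positivity
    refine eig N P hP g M k hM X t _ ht0 ht (by positivity) (hXS.trans (SS_sub hM hN)) (fun n hn => (hXp n hn).2.1) ?_ ?_ ?_ μ f hf hμ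
    · intro n hn d hd _
      have h1 := (hXp n hn).2.2.1
      have h2 := hHn _ (mem_steps.1 hd)
      have h3 := Int.mul_ediv_add_emod n M
      symm
      rw [← mem_blk hM]
      unfold blk
      rw [Finset.mem_Ico]
      have h4 : n / (M:ℤ) * M = M * (n / M) := mul_comm _ _
      have h5 : (n / (M:ℤ) + 1) * M = M * (n / M) + M := by ring
      omega
    · intro n hn
      exact omega_R P hP g M L hL n D (hXp n hn).1
    · intro n hn
      exact (hXp n hn).2.2.2
end PartSixC

section PartSixD
open scoped Classical

theorem assembled (N : ℕ) (P : Finset ℕ) (hP : ∀ p ∈ P, p.Prime) (H0 H : ℝ) (hH0 : 0 < H0) (hH1 : 1 ≤ H)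
    (hp0 : ∀ p ∈ P, H0 ≤ (p:ℝ)) (hpH : ∀ p ∈ P, (p:ℝ) ≤ H) (L : ℝ) (hL : ∑ p ∈ P, 1 / (p:ℝ) = L) (hL1 : 1 ≤ L)
    (k h j M D : ℕ) (hk : 1 ≤ k) (hh : 1 ≤ h) (h8 : (8:ℝ) * k ≤ 8 ^ h) (hhk : h ≤ k) (hj : 1 ≤ j)
    (hM : 0 < M) (hMp : ∀ p ∈ P, M.Coprime p) (hN : 2 * M ≤ N)
    (hpow : H ^ (j * (2 * h + 1) + 2 * k) ≤ N) (hpowD : H ^ D ≤ N)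
    (hkH0 : (2 * k : ℝ) < H0)
    (hsmall : (4 * (2 * k) / H0 + 4 * (2 * k) ^ 2 * ((2 + Real.log H) / H0)) * (3 * (4 * k)) ≤ 3)
    (η : ℝ)
    (hη : 4 * k * (((2 * h : ℝ) + 1) * (2 * (2 * h) * ((j * (2 * h + 1) : ℝ) + L)) ^ (2 * h + 1) *
      (2 * (2 * h) ^ 2 * ((2 + Real.log H) / H0) + (Nat.log 2 ((2 * h) * ((2 * h) * ⌊H⌋₊)) : ℝ) / H0)) ≤ η)
    (t : ℝ) (ht0 : 0 < t) (ht : t ≤ 1/2) :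
    ∃ X : Finset ℤ, X ⊆ Finset.Ioc (N:ℤ) (2 * N) ∧
      ((Finset.Ioc (N:ℤ) (2 * N) \ X).card : ℝ) ≤ 2 * M + 2 * N * (L ^ D / D.factorial) + 2 * N * η + N / M * (2 * H) +
        M * (4 * (2 * H) * t^(2*k) * ((2 * H) * (2 * N * L ^ (k + j * (2 * h + 1)) * (3 * (4 * k) * 8 ^ k) ^ 2 +
          ((2 * H) ^ (2 * k) * (2 * (M * H ^ (j * (2 * h + 1) + 2 * k))) * (1 + H ^ (2 * h + 1) * η) ^ j +
            4 ^ k * (2 * N) * (2 * ((j * (2 * h + 1) : ℝ) + 2 * k + L)) ^ (2 * k) * η ^ j)))) ∧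
      ∀ (μ : ℂ) (f : ℤ → ℂ), f ≠ 0 → (∀ n, opARestrict N P X f n = μ * f n) →
        ‖μ‖ ≤ 1 / t + 2 * t * (2 * D + 2 * L) := by
  have hPp : ∀ p ∈ P, 0 < p := fun p hp => (hP p hp).pos
  have hHn : ∀ p ∈ P, p ≤ ⌊H⌋₊ := fun p hp => Nat.le_floor (hpH p hp)
  have hHn1 : 1 ≤ ⌊H⌋₊ := Nat.le_floor (by exact_mod_cast hH1)
  have hHnH : ((⌊H⌋₊ : ℕ) : ℝ) ≤ H := Nat.floor_le (by linarith)
  have hlog : Real.log (⌊H⌋₊ : ℕ) ≤ Real.log H := Real.log_le_log (by exact_mod_cast hHn1) hHnH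
  have hlog0 : 0 ≤ Real.log H := Real.log_nonneg hH1
  set ε : ℝ := (2 + Real.log H) / H0 with hεd
  set δ : ℝ := (Nat.log 2 ((2 * h) * ((2 * h) * ⌊H⌋₊)) : ℝ) / H0 with hδd
  have hε0 : 0 ≤ ε := by positivity
  have hδ0 : 0 ≤ δ := by positivity
  have hk1 : (1:ℝ) ≤ k := by exact_mod_cast hk
  have hh1 : (1:ℝ) ≤ h := by exact_mod_cast hh
  have hhk' : (h:ℝ) ≤ k := by exact_mod_cast hhk
  have hres : ∀ p ∈ P, ∀ (b m : ℤ), m ≠ 0 → m.natAbs ≤ 2 * k →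
      ∑ q ∈ P.filter (fun q : ℕ => q ≠ p ∧ (p:ℤ) ∣ b + m * q), 1 / (q:ℝ) ≤ ε := by
    intro p hp b m hm hmk
    have h1 : ((m.natAbs : ℕ) : ℝ) ≤ 2 * k := by exact_mod_cast hmk
    refine (res_sum P hP H0 hH0 hp0 _ hHn p hp b m hm (lt_of_le_of_lt h1 hkH0)).trans ?_
    rw [hεd]; gcongr
  have hdiv : ∀ (s : ℤ), s ≠ 0 → |s| ≤ ((2 * h : ℕ) : ℤ) * (((2 * h : ℕ) : ℤ) * ((⌊H⌋₊ : ℕ):ℤ)) →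
      ∑ p ∈ P.filter (fun p : ℕ => (p:ℤ) ∣ s), 1 / (p:ℝ) ≤ δ := by
    intro s hs hsb
    refine (div_sum P hP H0 hH0 hp0 s hs).trans ?_
    rw [hδd]
    have : s.natAbs ≤ (2 * h) * ((2 * h) * ⌊H⌋₊) := by
      rw [← Int.natCast_natAbs] at hsb
      exact_mod_cast hsb
    have h2 := Nat.log_mono_right (b := 2) this
    gcongr
  set J := j * (2 * h + 1) with hJ
  have hJr : (J:ℝ) = j * (2 * h + 1) := by rw [hJ]; push_cast; ring
  rw [← hJr] at hη ⊢
  have hηE : ∀ E ⊆ P, E.card ≤ J → (4 * (k:ℝ) * ∑ q ∈ wdata P (2 * h), if Eqs q ⊆ E then 0 else wt (Eqs q \ E)) ≤ η := by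
    intro E hE hEc
    refine le_trans (mul_le_mul_of_nonneg_left ?_ (by positivity)) hη
    have hEr : (E.card : ℝ) ≤ J := by exact_mod_cast hEc
    have := eta_bound P E (2 * h) ⌊H⌋₊ L (2 * (2 * h) * ((J:ℝ) + L)) ε δ hHn hL (by push_cast; gcongr) (by omega)
      (by nlinarith [Nat.cast_nonneg (α := ℝ) J]) hε0 hδ0
      (fun p0 hp b m hm hmg => hres p0 hp b m hm (by rw [← Int.natCast_natAbs] at hmg; omega)) hdiv
    push_cast at this ⊢
    exact this
  have hη0 : 0 ≤ η := by
    refine le_trans ?_ hη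
    positivity
  have hηe : (∑ q ∈ wdata P (2 * h), if Eqs q ⊆ ∅ then 0 else wt (Eqs q \ ∅)) ≤ η := by
    refine le_trans ?_ (hηE ∅ (Finset.empty_subset _) (by simp))
    refine le_mul_of_one_le_left (Finset.sum_nonneg fun q _ => ?_) (by linarith)
    split_ifs
    · exact le_rfl
    · exact wt_nonneg _
  -- counting
  have hprod : ∀ K : Finset ℕ, K ⊆ P → ∀ m, K.card ≤ m → H ^ m ≤ N → ((∏ p ∈ K, p : ℕ) : ℝ) ≤ N := by
    intro K hK m hm hmN
    push_cast
    refine le_trans ?_ hmN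
    calc (∏ p ∈ K, (p:ℝ)) ≤ ∏ p ∈ K, H := Finset.prod_le_prod (fun _ _ => by positivity) fun p hp => hpH p (hK hp)
      _ = H ^ K.card := by simp
      _ ≤ H ^ m := pow_le_pow_right₀ hH1 hm
  have hab : ((N:ℤ) / M + 1) * M - 1 ≤ (2 * (N:ℤ) + 1) / M * M - 1 := by have := SS_le hM hN; omega
  have hlen : ((((2 * (N:ℤ) + 1) / M * M - 1) - (((N:ℤ) / M + 1) * M - 1) : ℤ) : ℝ) ≤ N := by
    have := SS_le hM hN
    have : ((2 * (N:ℤ) + 1) / M * M - 1) - (((N:ℤ) / M + 1) * M - 1) ≤ N := by omega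
    exact_mod_cast this
  have hNS : ∀ m, H ^ m ≤ N → ∀ (K : Finset ℕ) (off : ℕ → ℤ), K ⊆ P → K.card ≤ m → ((NS (SS N M) K off).card : ℝ) ≤ 2 * N * wt K := by
    intro m hm K off hK hKm
    exact ns_card K (fun p hp => hP p (hK hp)) off _ _ hab N hlen (hprod K hK m hKm hm)
  have hmono : ∀ m, m ≤ J + 2 * k → H ^ m ≤ N := fun m hm => (pow_le_pow_right₀ hH1 hm).trans hpow
  obtain ⟨X, hX1, hX2, hX3⟩ := construct N P hPp (2 * h) M k D ⌊H⌋₊ hM hN hHn t L ht0 ht hL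
  refine ⟨X, hX1, hX2.trans ?_, hX3⟩
  have hN0 : (0:ℝ) ≤ 2 * N := by positivity
  have d1 := omega_count P (SS N M) (2 * N) L hN0 D hL (hNS D hpowD)
  have hg1 : 2 * h + 1 ≤ J := by rw [hJ]; exact Nat.le_mul_of_pos_left _ hj
  have d2 := Yb_count P (2 * h) (SS N M) (2 * N) η hN0 (hNS _ (hmono _ (by omega))) hηe
  have d3 : (N:ℝ) / M * (2 * (⌊H⌋₊ : ℕ)) ≤ N / M * (2 * H) := by gcongr
  have hPc : (P.card : ℝ) ≤ H := by
    have : P.card ≤ ⌊H⌋₊ := by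
      have h1 : P ⊆ Finset.Icc 1 ⌊H⌋₊ := fun p hp => Finset.mem_Icc.2 ⟨hPp p hp, hHn p hp⟩
      simpa using Finset.card_le_card h1
    exact le_trans (by exact_mod_cast this) hHnH
  have dA := caseA_total (P := P) (g := 2 * h) (h := h) (k := k) (L := L) (H0 := H0) (B := 4 * k) (ε := ε) hk
    { hP := hPp, hL := hL1, hsum := hL, hH0 := hH0, hp := hp0, hB := by push_cast; linarith, hB1 := by linarith,
      hg := rfl, hh := hh, h8 := by linarith, hε0 := hε0, hε := hres, hsmall := by push_cast; exact hsmall }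
    (x1 P (2 * h) (bet M)) (fun u d _ => x1_le_ye P (2 * h) M u d)
    (fun u d hne => ⟨(x1_ne P (2 * h) M u d hne).1, (x1_ne P (2 * h) M u d hne).2.1⟩) (SS N M) (k + J) (2 * N) hN0
    (hNS _ (hmono _ (by omega)))
  have dB := caseB_total P hP (2 * h) k (k + J) j J (bet M) (bet_abs M) M hM hMp (bet_per M hM) _ _ hab H hH1 hpH (2 * N) hN0
    (hNS _ hpow) L (2 * ((J:ℝ) + 2 * k + L)) hL le_rfl le_rfl (by omega) η hη0 hηE
  have dQ := Qsum_le (x1 P (2 * h) (bet M)) (steps P) (SS N M) k (k + J)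
  have d4 : (M:ℝ) * (4 * (steps P).card * t^(2*k) * ∑ n ∈ SS N M, Qs (x1 P (2 * h) (bet M)) (steps P) k n) ≤
     M * (4 * (2 * H) * t^(2*k) * ((2 * H) * (2 * N * L ^ (k + J) * (3 * (4 * k) * 8 ^ k) ^ 2 +
          ((2 * H) ^ (2 * k) * (2 * (M * H ^ (J + 2 * k))) * (1 + H ^ (2 * h + 1) * η) ^ j +
            4 ^ k * (2 * N) * (2 * ((J:ℝ) + 2 * k + L)) ^ (2 * k) * η ^ j)))) := by
    rw [card_steps P hPp] at dQ ⊢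
    have hL0 : 0 ≤ L := by linarith
    have dB' : (2 * (P.card:ℝ)) ^ (2 * k) * (2 * (M * H ^ (J + 2 * k))) * (1 + H ^ (2 * h + 1) * η) ^ j +
            4 ^ k * (2 * N) * (2 * ((J:ℝ) + 2 * k + L)) ^ (2 * k) * η ^ j ≤ (2 * H) ^ (2 * k) * (2 * (M * H ^ (J + 2 * k))) * (1 + H ^ (2 * h + 1) * η) ^ j +
            4 ^ k * (2 * N) * (2 * ((J:ℝ) + 2 * k + L)) ^ (2 * k) * η ^ j := by
      have h0 : 0 ≤ 1 + H ^ (2 * h + 1) * η := by positivity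
      gcongr
    have dQ' := dQ.trans (mul_le_mul_of_nonneg_left (add_le_add dA (dB.trans dB')) (by positivity))
    refine mul_le_mul_of_nonneg_left ?_ (by positivity)
    have h0 : 0 ≤ 1 + H ^ (2 * h + 1) * η := by positivity
    refine mul_le_mul (by gcongr) (dQ'.trans ?_) (Finset.sum_nonneg fun n _ => Qs_nonneg _ _ _ _) (by positivity)
    gcongr
  linarith
end PartSixD

section PartSevenA
open scoped Classical

theorem kfacts : ∃ k0 : ℕ, ∀ k : ℕ, k0 ≤ k → ∃ z : ℝ, 100 ≤ z ∧ (k:ℝ) = z ^ 24 ∧ Real.log k ≤ z ∧ (k:ℝ) ^ ((2:ℝ)/3) = z ^ 16 := by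
  have h1 : ∀ᶠ x : ℝ in Filter.atTop, Real.log x ≤ x ^ ((1:ℝ)/24) := by
    have := (isLittleO_log_rpow_atTop (r := (1:ℝ)/24) (by norm_num)).bound (c := 1) (by norm_num)
    filter_upwards [this, Filter.eventually_ge_atTop 1] with x hx h1
    rw [one_mul, Real.norm_of_nonneg (Real.rpow_nonneg (by linarith : (0:ℝ) ≤ x) _), Real.norm_eq_abs] at hx
    exact (le_abs_self _).trans hx
  have h2 : ∀ᶠ x : ℝ in Filter.atTop, 100 ≤ x ^ ((1:ℝ)/24) :=
    (tendsto_rpow_atTop (by norm_num : (0:ℝ) < 1/24)).eventually_ge_atTop 100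
  have h3 := tendsto_natCast_atTop_atTop (R := ℝ) |>.eventually (h1.and h2)
  obtain ⟨k0, hk0⟩ := Filter.eventually_atTop.1 h3
  refine ⟨k0, fun k hk => ⟨(k:ℝ) ^ ((1:ℝ)/24), (hk0 k hk).2, ?_, (hk0 k hk).1, ?_⟩⟩
  · rw [← Real.rpow_natCast, ← Real.rpow_mul (by positivity)]; norm_num
  · rw [← Real.rpow_natCast, ← Real.rpow_mul (by positivity)]; norm_num

structure KF (k h j : ℕ) (z : ℝ) : Prop where
  hz : 100 ≤ z
  hk : (k:ℝ) = z ^ 24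
  he : (k:ℝ) ≤ Real.exp z
  hh3 : (h:ℝ) ≤ 3 * z
  hh1 : 1 ≤ h
  h8 : (8:ℝ) * k ≤ 8 ^ h
  hj1 : z ^ 12 / 2 ≤ j
  hj2 : (j:ℝ) ≤ z ^ 12

theorem pow_mono_z {z : ℝ} (hz : 100 ≤ z) {a b : ℕ} (h : a ≤ b) : z ^ a ≤ z ^ b :=
  pow_le_pow_right₀ (by linarith) h

theorem KF.mk' (k : ℕ) (z : ℝ) (hz : 100 ≤ z) (hk : (k:ℝ) = z ^ 24) (hl : Real.log k ≤ z) :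
    KF k (Nat.log 2 k + 2) (Nat.sqrt k) z := by
  have hk1 : (1:ℝ) ≤ k := by rw [hk]; exact one_le_pow₀ (by linarith)
  have hk0 : k ≠ 0 := by rintro rfl; norm_num at hk1
  have h12 : (100:ℝ) ≤ z ^ 12 := by
    have := pow_mono_z hz (show 1 ≤ 12 by norm_num)
    rw [pow_one] at this; linarith
  refine ⟨hz, hk, ?_, ?_, by omega, ?_, ?_, ?_⟩
  · rw [← Real.exp_log (by linarith : (0:ℝ) < k)]; exact Real.exp_le_exp.2 hl
  · have h1 : (2:ℝ) ^ Nat.log 2 k ≤ k := by exact_mod_cast Nat.pow_log_le_self 2 hk0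
    have h2 := Real.log_le_log (by positivity) h1
    rw [Real.log_pow] at h2
    have h3 := Real.log_two_gt_d9
    push_cast
    nlinarith [Nat.cast_nonneg (α := ℝ) (Nat.log 2 k)]
  · have h1 : k < 2 ^ (Nat.log 2 k + 1) := Nat.lt_pow_succ_log_self (by norm_num) k
    have h2 : k ≤ 8 ^ (Nat.log 2 k + 1) := h1.le.trans (Nat.pow_le_pow_left (by norm_num) _)
    have h3 : 8 * k ≤ 8 ^ (Nat.log 2 k + 2) := by rw [pow_succ 8 (Nat.log 2 k + 1)]; omega
    exact_mod_cast h3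
  · have h1 : k < (Nat.sqrt k + 1) ^ 2 := Nat.lt_succ_sqrt' k
    have h2 : (k:ℝ) < ((Nat.sqrt k : ℝ) + 1) ^ 2 := by exact_mod_cast h1
    rw [hk, show z ^ 24 = (z ^ 12) ^ 2 by ring] at h2
    have := lt_of_pow_lt_pow_left₀ 2 (by positivity) h2
    linarith
  · have h1 : (Nat.sqrt k) ^ 2 ≤ k := Nat.sqrt_le' k
    have h2 : ((Nat.sqrt k : ℝ)) ^ 2 ≤ k := by exact_mod_cast h1
    rw [hk, show z ^ 24 = (z ^ 12) ^ 2 by ring] at h2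
    exact le_of_pow_le_pow_left₀ (by norm_num) (by positivity) h2
end PartSevenA

section PartSevenB
open scoped Classical
namespace KF
variable {k h j : ℕ} {z : ℝ}

theorem k100 (c : KF k h j z) : (1000:ℝ) ≤ k := by
  rw [c.hk]
  have h1 := pow_mono_z c.hz (show 2 ≤ 24 by norm_num)
  nlinarith [c.hz]

theorem kpow (c : KF k h j z) (m : ℕ) : (k:ℝ) ^ m ≤ Real.exp (m * z) := by
  rw [Real.exp_nat_mul]
  exact pow_le_pow_left₀ (by positivity) c.he m

theorem g_le (c : KF k h j z) : 2 * (h:ℝ) + 1 ≤ 7 * z := by linarith [c.hh3, c.hz]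

theorem J_le (c : KF k h j z) : (j:ℝ) * (2 * h + 1) ≤ z ^ 14 := by
  have hz := c.hz
  calc (j:ℝ) * (2 * h + 1) ≤ z ^ 12 * (7 * z) := by
        have := c.g_le; have := c.hj2
        gcongr
    _ ≤ z ^ 12 * (z * z) := by gcongr; linarith
    _ = z ^ 14 := by ring

theorem z14k (c : KF k h j z) : z ^ 14 ≤ k := by rw [c.hk]; exact pow_mono_z c.hz (by norm_num)

theorem zk (c : KF k h j z) : z ^ 2 ≤ k := by rw [c.hk]; exact pow_mono_z c.hz (by norm_num)

theorem h_le (c : KF k h j z) : (h:ℝ) ≤ k := by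
  have := c.zk; have := c.hh3; have := c.hz
  nlinarith

theorem j_le (c : KF k h j z) : (j:ℝ) ≤ k := by
  have := c.hj2
  refine this.trans ?_
  rw [c.hk]; exact pow_mono_z c.hz (by norm_num)

theorem LJ (c : KF k h j z) {L : ℝ} (h0 : 1 ≤ L) (h1 : L ≤ 1 + k) : L ^ (j * (2 * h + 1)) ≤ Real.exp k := by
  have hk := c.k100
  have hz := c.hz
  have h2 : L ≤ Real.exp (2 * z) := by
    have := c.kpow 2
    push_cast at this
    refine le_trans ?_ this
    nlinarith
  calc L ^ (j * (2 * h + 1)) ≤ (Real.exp (2 * z)) ^ (j * (2 * h + 1)) := pow_le_pow_left₀ (by linarith) h2 _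
    _ = Real.exp (((j * (2 * h + 1) : ℕ) : ℝ) * (2 * z)) := by rw [← Real.exp_nat_mul]
    _ ≤ Real.exp (k:ℝ) := by
      apply Real.exp_le_exp.2
      have := c.J_le
      push_cast
      calc (j:ℝ) * (2 * h + 1) * (2 * z) ≤ z ^ 14 * (2 * z) := by gcongr
        _ ≤ z ^ 14 * (z * z) := by gcongr; linarith
        _ = z ^ 16 := by ring
        _ ≤ (k:ℝ) := by rw [c.hk]; exact pow_mono_z hz (by norm_num)

theorem e16 (c : KF k h j z) (m : ℕ) (hm : m ≤ 100) {H0 : ℝ} (hH0 : Real.exp (z ^ 16) ≤ H0) : (k:ℝ) ^ m ≤ H0 := by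
  refine (c.kpow m).trans (le_trans (Real.exp_le_exp.2 ?_) hH0)
  have hz := c.hz
  have : (m:ℝ) ≤ 100 := by exact_mod_cast hm
  calc (m:ℝ) * z ≤ z * z := by gcongr; linarith
    _ = z ^ 2 := by ring
    _ ≤ z ^ 16 := pow_mono_z hz (by norm_num)

theorem kH0 (c : KF k h j z) {H0 : ℝ} (hH0 : Real.exp (z ^ 16) ≤ H0) : 2 * (k:ℝ) < H0 := by
  have := c.e16 2 (by norm_num) hH0
  have := c.k100
  nlinarith

theorem small (c : KF k h j z) {H0 l : ℝ} (hH0 : Real.exp (z ^ 16) ≤ H0) (hl : l ≤ k) :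
    (4 * (2 * k) / H0 + 4 * (2 * (k:ℝ)) ^ 2 * ((2 + l) / H0)) * (3 * (4 * k)) ≤ 3 := by
  have hp : 0 < H0 := (Real.exp_pos _).trans_le hH0
  have h6 := c.e16 6 (by norm_num) hH0
  have hk := c.k100
  have e : (4 * (2 * k) / H0 + 4 * (2 * (k:ℝ)) ^ 2 * ((2 + l) / H0)) * (3 * (4 * k)) =
     ((8 * k + 16 * (k:ℝ) ^ 2 * (2 + l)) * (12 * k)) / H0 := by field_simp; ring
  rw [e, div_le_iff₀ hp]
  have h1 : 8 * k + 16 * (k:ℝ) ^ 2 * (2 + l) ≤ k ^ 4 := by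
    calc 8 * (k:ℝ) + 16 * (k:ℝ) ^ 2 * (2 + l) ≤ 8 * (k:ℝ) + 16 * (k:ℝ) ^ 2 * ((k:ℝ) + (k:ℝ)) := by gcongr; linarith
      _ = 8 * (k:ℝ) * 1 + 32 * (k:ℝ) ^ 3 := by ring
      _ ≤ 8 * (k:ℝ) * ((k:ℝ) * (k:ℝ)) + 32 * (k:ℝ) ^ 3 := by gcongr; nlinarith
      _ = 40 * (k:ℝ) ^ 3 := by ring
      _ ≤ (k:ℝ) * (k:ℝ) ^ 3 := by gcongr; linarith
      _ = (k:ℝ) ^ 4 := by ring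
  calc (8 * (k:ℝ) + 16 * (k:ℝ) ^ 2 * (2 + l)) * (12 * (k:ℝ)) ≤ (k:ℝ) ^ 4 * ((k:ℝ) * (k:ℝ)) := by gcongr; linarith
    _ = (k:ℝ) ^ 6 := by ring
    _ ≤ 3 * H0 := by linarith

theorem eta (c : KF k h j z) {H0 l L : ℝ} (hH0 : Real.exp (z ^ 16) ≤ H0) (hl0 : 0 ≤ l) (hl : l ≤ k) (hL0 : 1 ≤ L) (hL : L ≤ 1 + k) (q : ℕ)
    (hq : (q:ℝ) ≤ 8 * k) :
    4 * k * (((2 * h : ℝ) + 1) * (2 * (2 * h) * ((j * (2 * h + 1) : ℝ) + L)) ^ (2 * h + 1) *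
      (2 * (2 * h) ^ 2 * ((2 + l) / H0) + (q : ℝ) / H0)) ≤ 1 / Real.sqrt H0 := by
  have hp : 0 < H0 := (Real.exp_pos _).trans_le hH0
  have hk := c.k100
  have hz := c.hz
  have hJ := c.J_le.trans c.z14k
  have hh := c.h_le
  have hsq : Real.exp (z ^ 16 / 2) ≤ Real.sqrt H0 := by
    apply Real.le_sqrt_of_sq_le
    rw [← Real.exp_nat_mul]
    refine le_trans (le_of_eq ?_) hH0
    congr 1; push_cast; ring
  have hs0 : 0 < Real.sqrt H0 := Real.sqrt_pos.2 hp
  have e : 4 * k * (((2 * h : ℝ) + 1) * (2 * (2 * h) * ((j * (2 * h + 1) : ℝ) + L)) ^ (2 * h + 1) *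
      (2 * (2 * h) ^ 2 * ((2 + l) / H0) + (q : ℝ) / H0)) =
      (4 * k * ((2 * h : ℝ) + 1) * (2 * (2 * h) * ((j * (2 * h + 1) : ℝ) + L)) ^ (2 * h + 1) * (8 * h ^ 2 * (2 + l) + q)) / H0 := by
    field_simp; ring
  rw [e]
  have b1 : 4 * (k:ℝ) ≤ k ^ 2 := by nlinarith
  have b2 : (2 * h : ℝ) + 1 ≤ k ^ 2 := by nlinarith
  have b3 : 2 * (2 * h) * ((j * (2 * h + 1) : ℝ) + L) ≤ k ^ 3 := by
    calc 2 * (2 * h) * ((j * (2 * h + 1) : ℝ) + L) ≤ 2 * (2 * (k:ℝ)) * ((k:ℝ) + ((k:ℝ) + (k:ℝ))) := by gcongr; linarith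
      _ = 12 * (k:ℝ) ^ 2 := by ring
      _ ≤ (k:ℝ) * (k:ℝ) ^ 2 := by gcongr; linarith
      _ = (k:ℝ) ^ 3 := by ring
  have b4 : 8 * (h:ℝ) ^ 2 * (2 + l) + q ≤ k ^ 4 := by
    calc 8 * (h:ℝ) ^ 2 * (2 + l) + q ≤ 8 * (k:ℝ) ^ 2 * ((k:ℝ) + (k:ℝ)) + 8 * (k:ℝ) * 1 := by gcongr; linarith; linarith
      _ ≤ 8 * (k:ℝ) ^ 2 * ((k:ℝ) + (k:ℝ)) + 8 * (k:ℝ) * ((k:ℝ) * (k:ℝ)) := by gcongr; nlinarith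
      _ = 24 * (k:ℝ) ^ 3 := by ring
      _ ≤ (k:ℝ) * (k:ℝ) ^ 3 := by gcongr; linarith
      _ = (k:ℝ) ^ 4 := by ring
  have b5 : ((k:ℝ) ^ 3) ^ (2 * h + 1) ≤ Real.exp (21 * z ^ 2) := by
    rw [← pow_mul]
    refine (c.kpow _).trans (Real.exp_le_exp.2 ?_)
    push_cast
    have := c.g_le
    nlinarith
  have b6 : 4 * k * ((2 * h : ℝ) + 1) * (2 * (2 * h) * ((j * (2 * h + 1) : ℝ) + L)) ^ (2 * h + 1) * (8 * h ^ 2 * (2 + l) + q) ≤ Real.sqrt H0 := by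
    calc 4 * k * ((2 * h : ℝ) + 1) * (2 * (2 * h) * ((j * (2 * h + 1) : ℝ) + L)) ^ (2 * h + 1) * (8 * h ^ 2 * (2 + l) + q)
        ≤ (k:ℝ) ^ 2 * (k:ℝ) ^ 2 * ((k:ℝ) ^ 3) ^ (2 * h + 1) * (k:ℝ) ^ 4 := by
          gcongr
      _ = (k:ℝ) ^ 8 * ((k:ℝ) ^ 3) ^ (2 * h + 1) := by ring
      _ ≤ Real.exp ((8:ℕ) * z) * Real.exp (21 * z ^ 2) := mul_le_mul (c.kpow 8) b5 (by positivity) (by positivity)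
      _ = Real.exp (8 * z + 21 * z ^ 2) := by rw [← Real.exp_add]; norm_num
      _ ≤ Real.exp (z ^ 16 / 2) := by
        apply Real.exp_le_exp.2
        have := pow_mono_z hz (show 3 ≤ 16 by norm_num)
        nlinarith
      _ ≤ _ := hsq
  rw [div_le_div_iff₀ hp hs0, one_mul]
  calc _ ≤ Real.sqrt H0 * Real.sqrt H0 := mul_le_mul_of_nonneg_right b6 hs0.le
    _ = H0 := Real.mul_self_sqrt hp.le
end KF
end PartSevenB

section PartSevenC
open scoped Classical

theorem pow_le_exp (a : ℝ) (m k : ℕ) (ha : 0 ≤ a) (h : a ≤ 2.7 ^ m) : a ^ k ≤ Real.exp (m * k) := by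
  have h1 : (2.7:ℝ) ≤ Real.exp 1 := by have := Real.exp_one_gt_d9; linarith
  have h2 : a ≤ Real.exp m := by
    refine h.trans ((pow_le_pow_left₀ (by norm_num) h1 m).trans (le_of_eq ?_))
    rw [← Real.exp_nat_mul, mul_one]
  calc a ^ k ≤ (Real.exp m) ^ k := pow_le_pow_left₀ ha h2 k
    _ = Real.exp (m * k) := by rw [← Real.exp_nat_mul, mul_comm]

namespace KF
variable {k h j : ℕ} {z : ℝ}

theorem const_le (c : KF k h j z) {a : ℝ} (ha : a ≤ 10000) : a ≤ Real.exp k := by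
  have h1 := Real.quadratic_le_exp_of_nonneg (by positivity : (0:ℝ) ≤ k)
  have := c.k100
  nlinarith

theorem sqrt_le (c : KF k h j z) {H0 H : ℝ} (hH1 : 1 ≤ H0) (h1 : H0 ≤ H) (hH : H ≤ Real.exp k) : Real.sqrt H0 ≤ Real.exp k := by
  refine le_trans ?_ (h1.trans hH)
  rw [Real.sqrt_le_left (by linarith)]
  nlinarith

theorem sqrt_ge {H0 : ℝ} (hH0 : Real.exp (z ^ 16) ≤ H0) : Real.exp (z ^ 16 / 2) ≤ Real.sqrt H0 := by
  apply Real.le_sqrt_of_sq_le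
  rw [← Real.exp_nat_mul]
  refine le_trans (le_of_eq ?_) hH0
  congr 1; push_cast; ring

theorem termA (c : KF k h j z) {H0 H L t : ℝ} (N : ℕ) (hH1 : 1 ≤ H0) (h01 : H0 ≤ H) (hH : H ≤ Real.exp k)
    (hL1 : 1 ≤ L) (hL : L ≤ 1 + k) (ht0 : 0 < t) (ht : t ^ 2 * L ≤ Real.exp (-24)) :
    (8 ^ k : ℝ) * (4 * (2 * H) * t^(2*k) * ((2 * H) * (2 * N * L ^ (k + j * (2 * h + 1)) * (3 * (4 * k) * 8 ^ k) ^ 2))) ≤ N / Real.sqrt H0 := by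
  have hs0 : 0 < Real.sqrt H0 := Real.sqrt_pos.2 (by linarith)
  rw [le_div_iff₀ hs0]
  have e : (8 ^ k : ℝ) * (4 * (2 * H) * t^(2*k) * ((2 * H) * (2 * N * L ^ (k + j * (2 * h + 1)) * (3 * (4 * k) * 8 ^ k) ^ 2))) * Real.sqrt H0
     = N * (4608 * 512 ^ k * H ^ 2 * k ^ 2 * (t ^ 2 * L) ^ k * L ^ (j * (2 * h + 1)) * Real.sqrt H0) := by
    rw [pow_add L, mul_pow (t ^ 2), ← pow_mul t,
      show (512:ℝ) ^ k = 8 ^ k * (8 ^ k * 8 ^ k) by rw [← mul_pow, ← mul_pow]; norm_num]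
    ring
  rw [e]
  refine mul_le_of_le_one_right (by positivity) ?_
  have a1 : (4608:ℝ) ≤ Real.exp k := c.const_le (by norm_num)
  have a2 : (512:ℝ) ^ k ≤ Real.exp (7 * k) := by
    have := pow_le_exp 512 7 k (by norm_num) (by norm_num); exact_mod_cast this
  have a3 : H ^ 2 ≤ Real.exp (2 * k) := by
    calc H ^ 2 ≤ Real.exp k ^ 2 := pow_le_pow_left₀ (by linarith) hH 2
      _ = Real.exp (2 * k) := by rw [← Real.exp_nat_mul]; norm_num
  have a4 : (k:ℝ) ^ 2 ≤ Real.exp (2 * k) := by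
    have : (k:ℝ) ≤ Real.exp k := by linarith [Real.add_one_le_exp (k:ℝ)]
    calc (k:ℝ) ^ 2 ≤ Real.exp k ^ 2 := pow_le_pow_left₀ (by positivity) this 2
      _ = Real.exp (2 * k) := by rw [← Real.exp_nat_mul]; norm_num
  have a5 : (t ^ 2 * L) ^ k ≤ Real.exp (-24 * k) := by
    calc (t ^ 2 * L) ^ k ≤ Real.exp (-24) ^ k := pow_le_pow_left₀ (by positivity) ht k
      _ = Real.exp (-24 * k) := by rw [← Real.exp_nat_mul, mul_comm]
  have a6 := c.LJ hL1 hL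
  have a7 := c.sqrt_le hH1 h01 hH
  calc 4608 * 512 ^ k * H ^ 2 * k ^ 2 * (t ^ 2 * L) ^ k * L ^ (j * (2 * h + 1)) * Real.sqrt H0
      ≤ Real.exp k * Real.exp (7 * k) * Real.exp (2 * k) * Real.exp (2 * k) * Real.exp (-24 * k) * Real.exp k * Real.exp k := by
        gcongr
    _ = Real.exp (-10 * k) := by
        simp only [← Real.exp_add]; congr 1; ring
    _ ≤ 1 := by
        rw [Real.exp_le_one_iff]
        have := c.k100; linarith

theorem termB2 (c : KF k h j z) {H0 H L t : ℝ} (N : ℕ) (hH0 : Real.exp (z ^ 16) ≤ H0) (hH1 : 1 ≤ H0) (h01 : H0 ≤ H) (hH : H ≤ Real.exp k)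
    (hL1 : 1 ≤ L) (hL : L ≤ 1 + k) (ht0 : 0 < t) (ht : t ≤ 1) :
    (8 ^ k : ℝ) * (4 * (2 * H) * t^(2*k) * ((2 * H) * (4 ^ k * (2 * N) * (2 * ((j * (2 * h + 1) : ℝ) + 2 * k + L)) ^ (2 * k) *
      (1 / Real.sqrt H0) ^ j))) ≤ N / Real.sqrt H0 := by
  have hs0 : 0 < Real.sqrt H0 := Real.sqrt_pos.2 (by linarith)
  have hz := c.hz
  have hk := c.k100
  rw [le_div_iff₀ hs0]
  have e : (8 ^ k : ℝ) * (4 * (2 * H) * t^(2*k) * ((2 * H) * (4 ^ k * (2 * N) * (2 * ((j * (2 * h + 1) : ℝ) + 2 * k + L)) ^ (2 * k) *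
      (1 / Real.sqrt H0) ^ j))) * Real.sqrt H0
     = N * (32 * 32 ^ k * H ^ 2 * t ^ (2 * k) * (2 * ((j * (2 * h + 1) : ℝ) + 2 * k + L)) ^ (2 * k) * (1 / Real.sqrt H0) ^ j * Real.sqrt H0) := by
    rw [show (32:ℝ) ^ k = 8 ^ k * 4 ^ k by rw [← mul_pow]; norm_num]
    ring
  rw [e]
  refine mul_le_of_le_one_right (by positivity) ?_
  have a1 : (32:ℝ) ≤ Real.exp k := c.const_le (by norm_num)
  have a2 : (32:ℝ) ^ k ≤ Real.exp (4 * k) := by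
    have := pow_le_exp 32 4 k (by norm_num) (by norm_num); exact_mod_cast this
  have a3 : H ^ 2 ≤ Real.exp (2 * k) := by
    calc H ^ 2 ≤ Real.exp k ^ 2 := pow_le_pow_left₀ (by linarith) hH 2
      _ = Real.exp (2 * k) := by rw [← Real.exp_nat_mul]; norm_num
  have a4 : t ^ (2 * k) ≤ 1 := pow_le_one₀ ht0.le ht
  have a5 : (2 * ((j * (2 * h + 1) : ℝ) + 2 * k + L)) ^ (2 * k) ≤ Real.exp (4 * z * k) := by
    have hJ := c.J_le.trans c.z14k
    have : 2 * ((j * (2 * h + 1) : ℝ) + 2 * k + L) ≤ Real.exp (2 * z) := by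
      have := c.kpow 2
      push_cast at this
      refine le_trans ?_ this
      nlinarith
    calc (2 * ((j * (2 * h + 1) : ℝ) + 2 * k + L)) ^ (2 * k) ≤ Real.exp (2 * z) ^ (2 * k) := pow_le_pow_left₀ (by positivity) this _
      _ = Real.exp (4 * z * k) := by rw [← Real.exp_nat_mul]; push_cast; congr 1; ring
  have a6 : (1 / Real.sqrt H0) ^ j ≤ Real.exp (- (z ^ 28 / 4)) := by
    have h1 : 1 / Real.sqrt H0 ≤ Real.exp (-(z ^ 16 / 2)) := by
      rw [Real.exp_neg, ← one_div]
      exact one_div_le_one_div_of_le (Real.exp_pos _) (sqrt_ge hH0)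
    calc (1 / Real.sqrt H0) ^ j ≤ Real.exp (-(z ^ 16 / 2)) ^ j := pow_le_pow_left₀ (by positivity) h1 j
      _ = Real.exp (j * (-(z ^ 16 / 2))) := by rw [← Real.exp_nat_mul]
      _ ≤ _ := by
        apply Real.exp_le_exp.2
        have := c.hj1
        have : z ^ 12 / 2 * (z ^ 16 / 2) ≤ j * (z ^ 16 / 2) := by gcongr
        nlinarith
  have a7 := c.sqrt_le hH1 h01 hH
  calc 32 * 32 ^ k * H ^ 2 * t ^ (2 * k) * (2 * ((j * (2 * h + 1) : ℝ) + 2 * k + L)) ^ (2 * k) * (1 / Real.sqrt H0) ^ j * Real.sqrt H0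
      ≤ Real.exp k * Real.exp (4 * k) * Real.exp (2 * k) * 1 * Real.exp (4 * z * k) * Real.exp (- (z ^ 28 / 4)) * Real.exp k := by
        gcongr
    _ = Real.exp (8 * k + 4 * z * k - z ^ 28 / 4) := by
        rw [mul_one]; simp only [← Real.exp_add]; congr 1; ring
    _ ≤ 1 := by
        rw [Real.exp_le_one_iff, c.hk]
        have h1 := pow_mono_z hz (show 24 ≤ 25 by norm_num)
        have h2 := pow_mono_z hz (show 26 ≤ 28 by norm_num)
        have h3 : z ^ 26 = z * z ^ 25 := by ring
        have h4 : 4 * z * z ^ 24 = 4 * z ^ 25 := by ring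
        have h5 : 100 * z ^ 25 ≤ z * z ^ 25 := by gcongr
        have h6 : 0 ≤ z ^ 25 := by positivity
        linarith

theorem termB1 (c : KF k h j z) {H0 H η t : ℝ} (N : ℕ) (hN : Real.exp (25 * (k:ℝ) ^ 2) ≤ N) (hH1 : 1 ≤ H0) (h01 : H0 ≤ H) (hH : H ≤ Real.exp k)
    (ht0 : 0 < t) (ht : t ≤ 1) (hη0 : 0 ≤ η) (hη : η ≤ 1) :
    (8 ^ k : ℝ) * (4 * (2 * H) * t^(2*k) * ((2 * H) * ((2 * H) ^ (2 * k) * (2 * (8 ^ k * H ^ (j * (2 * h + 1) + 2 * k))) * (1 + H ^ (2 * h + 1) * η) ^ j))) ≤ N / Real.sqrt H0 := by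
  have hs0 : 0 < Real.sqrt H0 := Real.sqrt_pos.2 (by linarith)
  have hk := c.k100
  have hH1' : 1 ≤ H := hH1.trans h01
  have hJ := c.J_le.trans c.z14k
  rw [le_div_iff₀ hs0]
  refine le_trans ?_ hN
  have a1 : (32:ℝ) ≤ Real.exp k := c.const_le (by norm_num)
  have a2 : (64:ℝ) ^ k ≤ Real.exp (5 * k) := by
    have := pow_le_exp 64 5 k (by norm_num) (by norm_num); exact_mod_cast this
  have hpow : ∀ m : ℕ, H ^ m ≤ Real.exp (m * k) := by
    intro m
    calc H ^ m ≤ Real.exp k ^ m := pow_le_pow_left₀ (by linarith) hH m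
      _ = Real.exp (m * k) := by rw [← Real.exp_nat_mul]
  have h2pow : ∀ m : ℕ, (2:ℝ) ^ m ≤ Real.exp m := by
    intro m
    have := pow_le_exp 2 1 m (by norm_num) (by norm_num); simpa using this
  have a3 : (2 * H) ^ (2 * k) ≤ Real.exp (2 * k + 2 * k * k) := by
    rw [mul_pow, Real.exp_add]
    have h1 := h2pow (2 * k)
    have h2 := hpow (2 * k)
    push_cast at h1 h2
    exact mul_le_mul h1 h2 (by positivity) (by positivity)
  have a4 : H ^ (j * (2 * h + 1) + 2 * k) ≤ Real.exp (3 * k * k) := by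
    refine (hpow _).trans (Real.exp_le_exp.2 ?_)
    push_cast
    gcongr; linarith
  have a5 : (1 + H ^ (2 * h + 1) * η) ^ j ≤ Real.exp (k + k * k) := by
    have h1 : 1 ≤ H ^ (2 * h + 1) := one_le_pow₀ hH1'
    have h2 : 1 + H ^ (2 * h + 1) * η ≤ 2 * H ^ (2 * h + 1) := by nlinarith
    calc (1 + H ^ (2 * h + 1) * η) ^ j ≤ (2 * H ^ (2 * h + 1)) ^ j := pow_le_pow_left₀ (by positivity) h2 j
      _ = 2 ^ j * H ^ (j * (2 * h + 1)) := by rw [mul_pow, ← pow_mul, mul_comm j]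
      _ ≤ Real.exp j * Real.exp ((j * (2 * h + 1) : ℕ) * k) := mul_le_mul (h2pow j) (hpow _) (by positivity) (by positivity)
      _ = Real.exp (j + (j * (2 * h + 1) : ℕ) * k) := by rw [Real.exp_add]
      _ ≤ _ := by
        apply Real.exp_le_exp.2
        push_cast
        have := c.j_le
        gcongr
  have a6 := c.sqrt_le hH1 h01 hH
  have a7 : t ^ (2 * k) ≤ 1 := pow_le_one₀ ht0.le ht
  have a8 := hpow 2
  push_cast at a8
  have hη' : 0 ≤ 1 + H ^ (2 * h + 1) * η := by positivity
  have e : (8 ^ k : ℝ) * (4 * (2 * H) * t^(2*k) * ((2 * H) * ((2 * H) ^ (2 * k) * (2 * (8 ^ k * H ^ (j * (2 * h + 1) + 2 * k))) * (1 + H ^ (2 * h + 1) * η) ^ j))) * Real.sqrt H0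
    = 32 * 64 ^ k * H ^ 2 * t ^ (2 * k) * (2 * H) ^ (2 * k) * H ^ (j * (2 * h + 1) + 2 * k) * (1 + H ^ (2 * h + 1) * η) ^ j * Real.sqrt H0 := by
    rw [show (64:ℝ) ^ k = 8 ^ k * 8 ^ k by rw [← mul_pow]; norm_num]
    generalize (1 + H ^ (2 * h + 1) * η) ^ j = Y
    generalize (2 * H) ^ (2 * k) = Z
    ring
  rw [e]
  calc 32 * 64 ^ k * H ^ 2 * t ^ (2 * k) * (2 * H) ^ (2 * k) * H ^ (j * (2 * h + 1) + 2 * k) * (1 + H ^ (2 * h + 1) * η) ^ j * Real.sqrt H0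
      ≤ Real.exp k * Real.exp (5 * k) * Real.exp (2 * k) * 1 * Real.exp (2 * k + 2 * k * k) * Real.exp (3 * k * k) * Real.exp (k + k * k) * Real.exp k := by
        gcongr
    _ = Real.exp (12 * k + 6 * k * k) := by
        rw [mul_one]; simp only [← Real.exp_add]; congr 1; ring
    _ ≤ _ := by
        apply Real.exp_le_exp.2
        nlinarith
end KF
end PartSevenC

section PartEight
open scoped Classical

theorem empty_case (N : ℕ) (P : Finset ℕ) (C c : ℝ) (hc : 0 ≤ c) (hC : (N:ℝ) ≤ C) :
    ∃ X : Finset ℤ, X ⊆ Finset.Ioc (N : ℤ) (2 * (N : ℤ)) ∧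
      ((Finset.Ioc (N : ℤ) (2 * (N : ℤ)) \ X).card : ℝ) ≤ C ∧
      ∀ (μ : ℂ) (f : ℤ → ℂ), f ≠ 0 → (∀ n : ℤ, opARestrict N P X f n = μ * f n) → ‖μ‖ ≤ c := by
  refine ⟨∅, Finset.empty_subset _, ?_, ?_⟩
  · rw [Finset.sdiff_empty, Int.card_Ioc]
    have : (2 * (N:ℤ) - N).toNat = N := by omega
    rw [this]; exact hC
  · intro μ f hf hμ
    obtain ⟨n, hn⟩ := Function.ne_iff.1 hf
    have := hμ n
    rw [opARestrict, if_neg (Finset.notMem_empty n)] at this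
    rcases mul_eq_zero.1 this.symm with h | h
    · rw [h, norm_zero]; exact hc
    · exact absurd h hn

theorem fact_bound (K L : ℝ) (hK : 1 ≤ K) (hL : 1 ≤ L) (D : ℕ) (hD : 3 * (K * L) ≤ D) :
    L ^ D / (D.factorial : ℝ) ≤ Real.exp (-(K * L * Real.log K)) := by
  have h1 := Real.pow_div_factorial_le_exp (3 * (K * L)) (by positivity) D
  have e : L ^ D / (D.factorial : ℝ) = ((3 * K) ^ D)⁻¹ * ((3 * (K * L)) ^ D / D.factorial) := by
    rw [show 3 * (K * L) = 3 * K * L by ring, mul_pow (3 * K) L]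
    have : (3 * K) ^ D ≠ 0 := by positivity
    field_simp
  have hlog3 : 1 ≤ Real.log 3 := by
    rw [Real.le_log_iff_exp_le (by norm_num)]
    linarith [Real.exp_one_lt_d9]
  have hlK : 0 ≤ Real.log K := Real.log_nonneg hK
  have e2 : ((3 * K) ^ D)⁻¹ = Real.exp (-(D * (Real.log 3 + Real.log K))) := by
    rw [Real.exp_neg, Real.exp_nat_mul, ← Real.log_mul (by norm_num) (by positivity), Real.exp_log (by positivity)]
  rw [e, e2]
  calc _ ≤ Real.exp (-(D * (Real.log 3 + Real.log K))) * Real.exp (3 * (K * L)) := mul_le_mul_of_nonneg_left h1 (Real.exp_pos _).le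
    _ = Real.exp (-(D * (Real.log 3 + Real.log K)) + 3 * (K * L)) := by rw [Real.exp_add]
    _ ≤ _ := by
      apply Real.exp_le_exp.2
      have h3 : 3 * (K * L) * (Real.log 3 + Real.log K) ≤ D * (Real.log 3 + Real.log K) := by gcongr
      have h4 : 0 < K * L := by positivity
      nlinarith [mul_nonneg h4.le hlK]

theorem dist_three (M c b x y w : ℝ) : M * (c * (b * (x + (y + w)))) =
    M * (c * (b * x)) + M * (c * (b * y)) + M * (c * (b * w)) := by ring

theorem t_sqrt (t r s : ℝ) (h : r * r = s) : 2 * t * (20 * s) = 40 * (t * r) * r := by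
  rw [← h]; ring

theorem Hsqrt_le (H₀ H : ℝ) (k : ℕ) (hH0 : 1 ≤ H₀) (h01 : H₀ ≤ H) (hHk : H ≤ Real.exp k) :
    H * Real.sqrt H₀ ≤ 8 ^ k := by
  have hsH : Real.sqrt H₀ ≤ H := by
    rw [Real.sqrt_le_left (by linarith)]; nlinarith
  have he8 : Real.exp 1 * Real.exp 1 ≤ 8 := by
    have := Real.exp_one_lt_d9
    nlinarith [Real.exp_pos 1]
  calc H * Real.sqrt H₀ ≤ Real.exp k * Real.exp k := by
        have := hsH.trans hHk
        gcongr
    _ = (Real.exp 1 * Real.exp 1) ^ k := by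
        rw [mul_pow, ← Real.exp_nat_mul, mul_one]
    _ ≤ 8 ^ k := by gcongr

set_option maxHeartbeats 4000000 in
theorem big_case (k0 : ℕ) (hk0 : ∀ k : ℕ, k0 ≤ k → ∃ z : ℝ, 100 ≤ z ∧ (k:ℝ) = z ^ 24 ∧ Real.log k ≤ z ∧ (k:ℝ) ^ ((2:ℝ)/3) = z ^ 16)
    (N : ℕ) (H₀ H : ℝ) (P : Finset ℕ) (L : ℝ) (hN : 0 < N) (hH0 : 1 ≤ H₀) (h01 : H₀ ≤ H)
    (hlog : Real.log H ^ ((2 : ℝ) / 3) * Real.log (Real.log H) ^ 2 ≤ Real.log H₀)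
    (hP : ∀ p ∈ P, Nat.Prime p ∧ H₀ ≤ (p : ℝ) ∧ (p : ℝ) ≤ H)
    (hL : L = ∑ p ∈ P, (1 : ℝ) / (p : ℝ)) (hL1 : 1 ≤ L) (K : ℝ) (hK : 1 ≤ K)
    (hKN : K ≤ Real.log (N : ℝ) / (L * Real.log H ^ 2)) (hKL : 100 ≤ K * L)
    (hbig1 : 10 ≤ Real.log H) (hbig2 : (k0:ℝ) ≤ Real.log H) :
    ∃ X : Finset ℤ, X ⊆ Finset.Ioc (N : ℤ) (2 * (N : ℤ)) ∧
      ((Finset.Ioc (N : ℤ) (2 * (N : ℤ)) \ X).card : ℝ) ≤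
        8 * ((N : ℝ) * Real.exp (-(K * L * Real.log K)) + (N : ℝ) / Real.sqrt H₀) ∧
      ∀ (μ : ℂ) (f : ℤ → ℂ), f ≠ 0 → (∀ n : ℤ, opARestrict N P X f n = μ * f n) → ‖μ‖ ≤ (Real.exp 12 + 40) * Real.sqrt (K * L) := by
  set l := Real.log H with hl
  obtain ⟨k, hlk, hkl⟩ : ∃ k : ℕ, l ≤ k ∧ (k:ℝ) < l + 1 :=
    ⟨⌈l⌉₊, Nat.le_ceil l, Nat.ceil_lt_add_one (by linarith)⟩
  have hHpos : 0 < H := by linarith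
  have hH1 : 1 ≤ H := hH0.trans h01
  have hNr : (0:ℝ) < N := by exact_mod_cast hN
  obtain ⟨z, hz, hkz, hlz, hk16⟩ := hk0 k (by exact_mod_cast hbig2.trans hlk)
  obtain ⟨h, j, c⟩ : ∃ h j : ℕ, KF k h j z := ⟨_, _, KF.mk' k z hz hkz hlz⟩
  have hk1000 := c.k100
  have hHk : H ≤ Real.exp k := by
    rw [← Real.exp_log hHpos]; exact Real.exp_le_exp.2 hlk
  have hlN : K * L * l ^ 2 ≤ Real.log N := by
    rw [le_div_iff₀ (by positivity)] at hKN
    linarith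
  have hN25 : Real.exp (25 * (k:ℝ) ^ 2) ≤ N := by
    rw [← Real.exp_log hNr]
    apply Real.exp_le_exp.2
    refine le_trans ?_ hlN
    have : (k:ℝ) / 2 ≤ l := by linarith
    have h2 : ((k:ℝ)/2) ^ 2 ≤ l ^ 2 := pow_le_pow_left₀ (by positivity) this 2
    nlinarith [sq_nonneg l]
  have hH0e : Real.exp (z ^ 16) ≤ H₀ := by
    rw [← Real.le_log_iff_exp_le (by linarith), ← hk16]
    refine le_trans ?_ hlog
    have h1 : (k:ℝ) ^ ((2:ℝ)/3) ≤ 2 * l ^ ((2:ℝ)/3) := by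
      calc (k:ℝ) ^ ((2:ℝ)/3) ≤ (2 * l) ^ ((2:ℝ)/3) := Real.rpow_le_rpow (by positivity) (by linarith) (by norm_num)
        _ = 2 ^ ((2:ℝ)/3) * l ^ ((2:ℝ)/3) := Real.mul_rpow (by norm_num) (by linarith)
        _ ≤ 2 ^ (1:ℝ) * l ^ ((2:ℝ)/3) := by
          gcongr
          · norm_num
          · norm_num
        _ = _ := by rw [Real.rpow_one]
    have h2 : 2 ≤ Real.log l := by
      rw [Real.le_log_iff_exp_le (by linarith)]
      have := Real.exp_one_lt_d9
      have h3 : Real.exp 2 = Real.exp 1 * Real.exp 1 := by rw [← Real.exp_add]; norm_num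
      nlinarith [Real.exp_pos 1]
    have h3 : 0 ≤ l ^ ((2:ℝ)/3) := Real.rpow_nonneg (by linarith) _
    have h4 : 2 ≤ Real.log l ^ 2 := by nlinarith
    nlinarith
  have hPpr : ∀ p ∈ P, p.Prime := fun p hp => (hP p hp).1
  have hLk : L ≤ 1 + k := by
    rw [hL]
    refine (L_le P (fun p hp => (hPpr p hp).pos) ⌊H⌋₊ (fun p hp => Nat.le_floor (hP p hp).2.2)).trans ?_
    have hHn1 : 1 ≤ ⌊H⌋₊ := Nat.le_floor (by exact_mod_cast hH1)
    have : Real.log (⌊H⌋₊ : ℕ) ≤ l := Real.log_le_log (by exact_mod_cast hHn1) (Nat.floor_le hHpos.le)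
    linarith
  obtain ⟨D, hD1, hD2⟩ : ∃ D : ℕ, 3 * (K * L) ≤ D ∧ (D:ℝ) < 3 * (K * L) + 1 :=
    ⟨_, Nat.le_ceil _, Nat.ceil_lt_add_one (by linarith)⟩
  have hpowE : ∀ m : ℕ, ∀ x : ℝ, (m:ℝ) * l ≤ x → x ≤ Real.log N → H ^ m ≤ N := by
    intro m x h1 h2
    rw [← Real.exp_log hHpos, ← Real.exp_nat_mul, ← Real.exp_log hNr]
    exact Real.exp_le_exp.2 (h1.trans h2)
  have hN25' : 25 * (k:ℝ) ^ 2 ≤ Real.log N := by rwa [Real.le_log_iff_exp_le hNr]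
  have hs0 : 0 < Real.sqrt H₀ := Real.sqrt_pos.2 (by linarith)
  have hsk := c.sqrt_le hH0 h01 hHk
  have h8k : (8:ℝ) ^ k ≤ Real.exp (3 * k) := by
    have := pow_le_exp 8 3 k (by norm_num) (by norm_num); exact_mod_cast this
  have hM2 : 2 * (8:ℝ) ^ k ≤ N / Real.sqrt H₀ := by
    rw [le_div_iff₀ hs0]
    refine le_trans ?_ hN25
    calc 2 * (8:ℝ) ^ k * Real.sqrt H₀ ≤ Real.exp k * Real.exp (3 * k) * Real.exp k := by
          have : (2:ℝ) ≤ Real.exp k := c.const_le (by norm_num)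
          gcongr
      _ = Real.exp (5 * k) := by simp only [← Real.exp_add]; congr 1; ring
      _ ≤ _ := by apply Real.exp_le_exp.2; nlinarith
  have hs1 : 1 ≤ Real.sqrt H₀ := by rw [Real.one_le_sqrt]; exact hH0
  have hMN : 2 * 8 ^ k ≤ N := by
    have : 2 * (8:ℝ) ^ k ≤ N := hM2.trans (div_le_self hNr.le hs1)
    exact_mod_cast this
  have hkH0 := c.kH0 hH0e
  have hq : (Nat.log 2 ((2 * h) * ((2 * h) * ⌊H⌋₊)) : ℝ) ≤ 8 * k := by
    set q := Nat.log 2 ((2 * h) * ((2 * h) * ⌊H⌋₊)) with hqd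
    have hne : (2 * h) * ((2 * h) * ⌊H⌋₊) ≠ 0 := by
      have hHn1 : 1 ≤ ⌊H⌋₊ := Nat.le_floor (by exact_mod_cast hH1)
      have := c.hh1
      positivity
    have h1 : (2:ℝ) ^ q ≤ (2 * h) * ((2 * h) * (⌊H⌋₊ : ℕ)) := by exact_mod_cast Nat.pow_log_le_self 2 hne
    have h2 : (2:ℝ) ^ q ≤ Real.exp (4 * k) := by
      refine h1.trans ?_
      have hh := c.h_le
      have hfl : ((⌊H⌋₊ : ℕ) : ℝ) ≤ Real.exp k := (Nat.floor_le hHpos.le).trans hHk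
      have hke : (k:ℝ) ≤ Real.exp k := by linarith [Real.add_one_le_exp (k:ℝ)]
      have h4 : (4:ℝ) ≤ Real.exp k := c.const_le (by norm_num)
      calc (2 * (h:ℝ)) * ((2 * h) * (⌊H⌋₊ : ℕ)) = 4 * h * h * (⌊H⌋₊ : ℕ) := by ring
        _ ≤ Real.exp k * Real.exp k * Real.exp k * Real.exp k := by
          have := hh.trans hke
          gcongr
        _ = Real.exp (4 * k) := by simp only [← Real.exp_add]; congr 1; ring
    have h3 := Real.log_le_log (by positivity) h2
    rw [Real.log_pow, Real.log_exp] at h3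
    have := Real.log_two_gt_d9
    nlinarith [Nat.cast_nonneg (α := ℝ) q]
  obtain ⟨t, htd⟩ : ∃ t : ℝ, t = Real.exp (-12) / Real.sqrt (K * L) := ⟨_, rfl⟩
  have hKL0 : 0 < K * L := by linarith
  have hr0 : 0 < Real.sqrt (K * L) := Real.sqrt_pos.2 hKL0
  have hr1 : 10 ≤ Real.sqrt (K * L) := Real.le_sqrt_of_sq_le (by linarith)
  have hrr : Real.sqrt (K * L) * Real.sqrt (K * L) = K * L := Real.mul_self_sqrt hKL0.le
  have ht0 : 0 < t := by rw [htd]; positivity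
  have he12 : Real.exp (-12) ≤ 1 := by rw [Real.exp_le_one_iff]; norm_num
  have ht : t ≤ 1/2 := by
    rw [htd, div_le_iff₀ hr0]; linarith
  have ht2 : t ^ 2 * L ≤ Real.exp (-24) := by
    have : t ^ 2 = Real.exp (-24) / (K * L) := by
      rw [htd, div_pow, sq (Real.sqrt _), hrr, ← Real.exp_nat_mul]; norm_num
    rw [this, div_mul_eq_mul_div, div_le_iff₀ hKL0]
    have := Real.exp_pos (-24)
    have h1 : L ≤ K * L := le_mul_of_one_le_left (by linarith) hK
    gcongr
  have hJk := c.J_le.trans c.z14k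
  have hk1 : 1 ≤ k := by exact_mod_cast (by linarith : (1:ℝ) ≤ k)
  have hhk : h ≤ k := by exact_mod_cast c.h_le
  have hj1 : 1 ≤ j := by
    have h1 := c.hj1
    have h2 := pow_mono_z hz (show 1 ≤ 12 by norm_num)
    rw [pow_one] at h2
    have : (1:ℝ) ≤ j := by linarith
    exact_mod_cast this
  obtain ⟨M, hMdef⟩ : ∃ M : ℕ, M = 8 ^ k := ⟨_, rfl⟩
  have hMr : (M:ℝ) = 8 ^ k := by rw [hMdef]; push_cast; rfl
  have hM0 : 0 < M := by rw [hMdef]; positivity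
  have hMc : ∀ p ∈ P, M.Coprime p := by
    intro p hp
    rw [hMdef]
    apply Nat.Coprime.pow_left
    rw [show 8 = 2 ^ 3 by norm_num]
    apply Nat.Coprime.pow_left
    rw [Nat.coprime_primes Nat.prime_two (hPpr p hp)]
    rintro rfl
    have := (hP 2 hp).2.1
    push_cast at this
    linarith
  rw [← hMdef] at hMN
  have hpw1 : H ^ (j * (2 * h + 1) + 2 * k) ≤ N :=
    hpowE _ (3 * k * k) (by push_cast; gcongr; linarith) (by nlinarith)
  have hpw2 : H ^ D ≤ N :=
    hpowE _ (4 * (K * L) * l) (by gcongr; linarith) (by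
      refine le_trans ?_ hlN
      have : 4 * l ≤ l ^ 2 := by nlinarith
      nlinarith)
  have hsm := c.small hH0e hlk
  have het := c.eta hH0e (by linarith) hlk hL1 hLk _ hq
  obtain ⟨X, hX1, hX2, hX3⟩ := assembled N P hPpr H₀ H (by linarith) hH1 (fun p hp => (hP p hp).2.1)
    (fun p hp => (hP p hp).2.2) L hL.symm hL1 k h j M D hk1 c.hh1 c.h8 hhk hj1 hM0 hMc hMN hpw1 hpw2
    hkH0 hsm (1 / Real.sqrt H₀) het t ht0 ht
  refine ⟨X, hX1, hX2.trans ?_, fun μ f hf hμ => (hX3 μ f hf hμ).trans ?_⟩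
  · have tA := c.termA N hH0 h01 hHk hL1 hLk ht0 ht2
    have tB1 := c.termB1 (η := 1 / Real.sqrt H₀) N hN25 hH0 h01 hHk ht0 (by linarith) (by positivity) (by rw [div_le_one hs0]; exact hs1)
    have tB2 := c.termB2 N hH0e hH0 h01 hHk hL1 hLk ht0 (by linarith)
    have tF := fact_bound K L hK hL1 D hD1
    have tF' : 2 * (N:ℝ) * (L ^ D / D.factorial) ≤ 2 * N * Real.exp (-(K * L * Real.log K)) := by gcongr
    have tM : (N:ℝ) / (8 ^ k) * (2 * H) ≤ 2 * (N / Real.sqrt H₀) := by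
      have h1 : H * Real.sqrt H₀ ≤ 8 ^ k := Hsqrt_le H₀ H k hH0 h01 hHk
      rw [div_mul_eq_mul_div, ← mul_div_assoc, div_le_div_iff₀ (by positivity) hs0]
      have h2 := mul_le_mul_of_nonneg_left h1 (by positivity : 0 ≤ 2 * (N:ℝ))
      calc _ = 2 * (N:ℝ) * (H * Real.sqrt H₀) := by ring
        _ ≤ _ := h2
    rw [hMr]
    have e2 : 2 * (N:ℝ) * (1 / Real.sqrt H₀) = 2 * (N / Real.sqrt H₀) := by ring
    rw [e2]
    have hpe : 0 ≤ (N:ℝ) * Real.exp (-(K * L * Real.log K)) := by positivity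
    rw [dist_three]
    linarith only [tA, tB1, tB2, tF', tM, hM2, hpe]
  · have h1 : 1 / t = Real.exp 12 * Real.sqrt (K * L) := by
      rw [htd, one_div_div, Real.exp_neg, div_inv_eq_mul, mul_comm]
    have h2 : 2 * t * (2 * D + 2 * L) ≤ 40 * Real.sqrt (K * L) := by
      have h3 : L ≤ K * L := le_mul_of_one_le_left (by linarith) hK
      have h4 : 2 * (D:ℝ) + 2 * L ≤ 20 * (K * L) := by linarith
      calc 2 * t * (2 * D + 2 * L) ≤ 2 * t * (20 * (K * L)) := by gcongr
        _ = 40 * (t * Real.sqrt (K * L)) * Real.sqrt (K * L) := t_sqrt _ _ _ hrr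
        _ = 40 * Real.exp (-12) * Real.sqrt (K * L) := by rw [htd, div_mul_cancel₀ _ hr0.ne']
        _ ≤ 40 * 1 * Real.sqrt (K * L) := by gcongr
        _ = _ := by ring
    rw [h1]; linarith
end PartEight


theorem main_theorem :
    ∃ C₁ C₂ : ℝ, 0 < C₁ ∧ 0 < C₂ ∧
      ∀ (N : ℕ) (H₀ H : ℝ) (P : Finset ℕ) (L : ℝ),
        0 < N →
        1 ≤ H₀ → H₀ ≤ H →
        Real.log H ^ ((2 : ℝ) / 3) * Real.log (Real.log H) ^ 2 ≤ Real.log H₀ →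
        (∀ p ∈ P, Nat.Prime p ∧ H₀ ≤ (p : ℝ) ∧ (p : ℝ) ≤ H) →
        L = ∑ p ∈ P, (1 : ℝ) / (p : ℝ) →
        Real.exp 1 ≤ L →
        Real.log H ≤ Real.sqrt (Real.log (N : ℝ) / L) →
        ∀ K : ℝ, 1 ≤ K → K ≤ Real.log (N : ℝ) / (L * Real.log H ^ 2) →
          ∃ X : Finset ℤ, X ⊆ Finset.Ioc (N : ℤ) (2 * (N : ℤ)) ∧
            ((Finset.Ioc (N : ℤ) (2 * (N : ℤ)) \ X).card : ℝ) ≤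
              C₁ * ((N : ℝ) * Real.exp (-(K * L * Real.log K)) + (N : ℝ) / Real.sqrt H₀) ∧
            ∀ (μ : ℂ) (f : ℤ → ℂ), f ≠ 0 →
              (∀ n : ℤ, n ∉ Finset.Ioc (N : ℤ) (2 * (N : ℤ)) → f n = 0) →
              (∀ n : ℤ, opARestrict N P X f n = μ * f n) →
              ‖μ‖ ≤ C₂ * Real.sqrt (K * L) := by
  obtain ⟨k0, hk0⟩ := kfacts
  have q1 := Real.exp_pos ((k0:ℝ) + 10)
  have q2 := Real.exp_pos ((10000:ℝ))
  have q3 := Real.exp_pos ((12:ℝ))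
  refine ⟨8 + Real.exp (k0 + 10) + Real.exp 10000, Real.exp 12 + 40, by linarith, by linarith, ?_⟩
  intro N H₀ H P L hN hH0 h01 hlog hP hL hL1 _ K hK hKN
  have hL1' : 1 ≤ L := by linarith [Real.add_one_le_exp (1:ℝ)]
  have hNr : (0:ℝ) < N := by exact_mod_cast hN
  have hs0 : 0 < Real.sqrt H₀ := Real.sqrt_pos.2 (by linarith)
  have hHpos : 0 < H := by linarith
  have t1 : 0 ≤ (N : ℝ) * Real.exp (-(K * L * Real.log K)) := by positivity
  have t2 : 0 ≤ (N : ℝ) / Real.sqrt H₀ := by positivity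
  have hc : 0 ≤ (Real.exp 12 + 40) * Real.sqrt (K * L) := by positivity
  have fin : ∀ C : ℝ, (∃ X : Finset ℤ, X ⊆ Finset.Ioc (N : ℤ) (2 * (N : ℤ)) ∧
      ((Finset.Ioc (N : ℤ) (2 * (N : ℤ)) \ X).card : ℝ) ≤ C ∧
      ∀ (μ : ℂ) (f : ℤ → ℂ), f ≠ 0 → (∀ n : ℤ, opARestrict N P X f n = μ * f n) →
        ‖μ‖ ≤ (Real.exp 12 + 40) * Real.sqrt (K * L)) →
      C ≤ (8 + Real.exp (k0 + 10) + Real.exp 10000) *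
        ((N : ℝ) * Real.exp (-(K * L * Real.log K)) + (N : ℝ) / Real.sqrt H₀) →
      ∃ X : Finset ℤ, X ⊆ Finset.Ioc (N : ℤ) (2 * (N : ℤ)) ∧
            ((Finset.Ioc (N : ℤ) (2 * (N : ℤ)) \ X).card : ℝ) ≤
              (8 + Real.exp (k0 + 10) + Real.exp 10000) *
                ((N : ℝ) * Real.exp (-(K * L * Real.log K)) + (N : ℝ) / Real.sqrt H₀) ∧
            ∀ (μ : ℂ) (f : ℤ → ℂ), f ≠ 0 →
              (∀ n : ℤ, n ∉ Finset.Ioc (N : ℤ) (2 * (N : ℤ)) → f n = 0) →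
              (∀ n : ℤ, opARestrict N P X f n = μ * f n) →
              ‖μ‖ ≤ (Real.exp 12 + 40) * Real.sqrt (K * L) := by
    rintro C ⟨X, h1, h2, h3⟩ hC
    exact ⟨X, h1, h2.trans hC, fun μ f hf _ h => h3 μ f hf h⟩
  by_cases ca : Real.log H ≤ k0 + 10
  · refine fin N (empty_case N P N _ hc le_rfl) ?_
    have h1 : H ≤ Real.exp (k0 + 10) := by rwa [← Real.log_le_iff_le_exp hHpos]
    have h2 : Real.sqrt H₀ ≤ H₀ := by
      rw [Real.sqrt_le_left (by linarith)]; nlinarith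
    have h3 : (N:ℝ) ≤ Real.exp (k0 + 10) * (N / Real.sqrt H₀) := by
      rw [← mul_div_assoc, le_div_iff₀ hs0, mul_comm]
      have : Real.sqrt H₀ ≤ Real.exp (k0 + 10) := by linarith
      gcongr
    nlinarith [mul_nonneg q1.le t1, mul_nonneg q2.le t1, mul_nonneg q2.le t2]
  by_cases cb : K * L < 100
  · refine fin N (empty_case N P N _ hc le_rfl) ?_
    have h1 : K ≤ K * L := le_mul_of_one_le_right (by linarith) hL1'
    have h2 : Real.log K ≤ 100 := by
      have := Real.log_le_self (by linarith : 0 ≤ K)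
      linarith
    have h3 : 0 ≤ Real.log K := Real.log_nonneg hK
    have h4 : K * L * Real.log K ≤ 10000 := by nlinarith
    have h5 : 1 ≤ Real.exp 10000 * Real.exp (-(K * L * Real.log K)) := by
      rw [← Real.exp_add]; exact Real.one_le_exp (by linarith)
    have h6 : (N:ℝ) ≤ Real.exp 10000 * (N * Real.exp (-(K * L * Real.log K))) := by
      calc (N:ℝ) = N * 1 := (mul_one _).symm
        _ ≤ N * (Real.exp 10000 * Real.exp (-(K * L * Real.log K))) := by gcongr
        _ = _ := by ring
    nlinarith [mul_nonneg q1.le t1, mul_nonneg q1.le t2, mul_nonneg q2.le t2]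
  · rw [not_le] at ca
    rw [not_lt] at cb
    refine fin _ (big_case k0 hk0 N H₀ H P L hN hH0 h01 hlog hP hL hL1' K hK hKN cb
      (by linarith [Nat.cast_nonneg (α := ℝ) k0]) (by linarith)) ?_
    have : 0 ≤ (N : ℝ) * Real.exp (-(K * L * Real.log K)) + (N : ℝ) / Real.sqrt H₀ := by linarith
    gcongr
    linarith
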